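/- For every δ > 0 there exist c > 0 and n₀ such that for all n ≥ n₀ and all ε > 0, if B_n is an n × n random matrix whose entries are independent and uniform in {-1, 1}, then ℙ(σ_min(B_n) ≤ ε n^{-1/2}) ≤ (1 + δ) ε + 2 e^{-c n}, where σ_min denotes the least singular value. -/

import Mathlib

set_option linter.unusedSectionVars false

/-- The Euclidean (ℓ₂) norm of a vector in `ℝ^n`. -/
noncomputable def euclNorm {n : ℕ} (x : Fin n → ℝ) : ℝ :=
  Real.sqrt (∑ i, x i ^ 2)

/-- The least singular value `σ_min(M) = min_{‖x‖₂ = 1} ‖Mx‖₂` of a square matrix. -/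
noncomputable def sigmaMin {n : ℕ} (M : Matrix (Fin n) (Fin n) ℝ) : ℝ :=
  sInf {r : ℝ | ∃ x : Fin n → ℝ, euclNorm x = 1 ∧ r = euclNorm (M.mulVec x)}

namespace LSV

open Finset

section Averages

variable {Ω Ω' : Type*} [Fintype Ω] [Fintype Ω']

/-- The average of a real function over a finite type. -/
noncomputable def ev (f : Ω → ℝ) : ℝ := (∑ ω, f ω) / Fintype.card Ω

open Classical in
/-- The uniform probability of an event on a finite type. -/
noncomputable def pr (P : Ω → Prop) : ℝ := ev fun ω => if P ω then 1 else 0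

lemma ev_mono {f g : Ω → ℝ} (h : ∀ ω, f ω ≤ g ω) : ev f ≤ ev g :=
  div_le_div_of_nonneg_right (sum_le_sum fun ω _ => h ω) (Nat.cast_nonneg _)

lemma ev_nonneg {f : Ω → ℝ} (h : ∀ ω, 0 ≤ f ω) : 0 ≤ ev f :=
  div_nonneg (sum_nonneg fun ω _ => h ω) (Nat.cast_nonneg _)

lemma ev_add (f g : Ω → ℝ) : ev (fun ω => f ω + g ω) = ev f + ev g := by
  simp [ev, sum_add_distrib, add_div]

lemma ev_sub (f g : Ω → ℝ) : ev (fun ω => f ω - g ω) = ev f - ev g := by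
  simp [ev, sum_sub_distrib, sub_div]

lemma ev_const_mul (c : ℝ) (f : Ω → ℝ) : ev (fun ω => c * f ω) = c * ev f := by
  simp [ev, ← mul_sum, mul_div_assoc]

lemma ev_mul_const (c : ℝ) (f : Ω → ℝ) : ev (fun ω => f ω * c) = ev f * c := by
  simp [ev, ← sum_mul, div_mul_eq_mul_div]

lemma ev_const [Nonempty Ω] (c : ℝ) : ev (fun _ : Ω => c) = c := by
  have : (Fintype.card Ω : ℝ) ≠ 0 := Nat.cast_ne_zero.2 Fintype.card_ne_zero
  simp [ev, mul_div_cancel_left₀ _ this]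

lemma ev_const_le {c : ℝ} (hc : 0 ≤ c) : ev (fun _ : Ω => c) ≤ c := by
  rcases isEmpty_or_nonempty Ω with h | h
  · simpa [ev] using hc
  · exact (ev_const c).le

lemma ev_sum {α : Type*} (s : Finset α) (f : α → Ω → ℝ) :
    ev (fun ω => ∑ a ∈ s, f a ω) = ∑ a ∈ s, ev (f a) := by
  simp only [ev]
  rw [sum_comm, sum_div]

lemma ev_comm (f : Ω → Ω' → ℝ) :
    ev (fun ω => ev fun ω' => f ω ω') = ev (fun ω' => ev fun ω => f ω ω') := by
  simp only [ev, ← sum_div]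
  rw [sum_comm, div_div, div_div, mul_comm]

lemma ev_equiv (e : Ω ≃ Ω') (f : Ω' → ℝ) : ev (fun ω => f (e ω)) = ev f := by
  simp only [ev]
  rw [e.sum_comp f, Fintype.card_congr e]

lemma pr_nonneg (P : Ω → Prop) : 0 ≤ pr P :=
  ev_nonneg fun ω => by split_ifs <;> norm_num

lemma pr_mono {P Q : Ω → Prop} (h : ∀ ω, P ω → Q ω) : pr P ≤ pr Q :=
  ev_mono fun ω => by
    by_cases hp : P ω
    · simp [hp, h ω hp]
    · simp only [hp, if_false]; split_ifs <;> norm_num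

lemma pr_le_one (P : Ω → Prop) : pr P ≤ 1 :=
  (ev_mono fun ω => by split_ifs <;> norm_num).trans (ev_const_le zero_le_one)

lemma pr_le_ev {P : Ω → Prop} {f : Ω → ℝ} (h0 : ∀ ω, 0 ≤ f ω) (h : ∀ ω, P ω → 1 ≤ f ω) :
    pr P ≤ ev f :=
  ev_mono fun ω => by
    split_ifs with hp
    · exact h ω hp
    · exact h0 ω

lemma pr_or_le (P Q : Ω → Prop) : pr (fun ω => P ω ∨ Q ω) ≤ pr P + pr Q := by
  classical
  rw [pr, pr, pr, ← ev_add]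
  refine ev_mono fun ω => ?_
  by_cases hp : P ω <;> by_cases hq : Q ω <;> simp [hp, hq]

lemma pr_exists_le {α : Type*} (s : Finset α) (P : α → Ω → Prop) :
    pr (fun ω => ∃ a ∈ s, P a ω) ≤ ∑ a ∈ s, pr (P a) := by
  classical
  simp only [pr, ← ev_sum]
  refine ev_mono fun ω => ?_
  split_ifs with h
  · obtain ⟨a, ha, hp⟩ := h
    calc (1 : ℝ) = if P a ω then 1 else 0 := by simp [hp]
      _ ≤ ∑ a ∈ s, if P a ω then (1 : ℝ) else 0 :=
        single_le_sum (f := fun a => if P a ω then (1 : ℝ) else 0)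
          (fun a _ => by split_ifs <;> norm_num) ha
  · exact sum_nonneg fun a _ => by split_ifs <;> norm_num

lemma pr_exists_fintype_le {α : Type*} [Fintype α] (P : α → Ω → Prop) :
    pr (fun ω => ∃ a, P a ω) ≤ ∑ a, pr (P a) := by
  simpa using pr_exists_le (univ : Finset α) P

open Classical in
lemma pr_eq_ncard (P : Ω → Prop) : pr P = (Set.ncard {ω | P ω} : ℝ) / Fintype.card Ω := by
  rw [pr, ev, Set.ncard_eq_toFinset_card', Finset.sum_boole]
  congr 2
  congr 1
  ext; simp

section Pi

variable {κ : Type*} [Fintype κ] [DecidableEq κ]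

lemma ev_pi_prod (f : κ → Ω → ℝ) :
    ev (fun D : κ → Ω => ∏ k, f k (D k)) = ∏ k, ev (f k) := by
  simp only [ev]
  rw [prod_div_distrib, prod_univ_sum, Fintype.piFinset_univ]
  simp

/-- Resampling: replacing the coordinates in the range of `τ` by fresh ones does not change
averages. -/
lemma ev_resample {m : ℕ} (τ : Fin m → κ) (hτ : Function.Injective τ) (F : (κ → Ω) → ℝ) :
    ev F = ev fun D : κ → Ω => ev fun d : Fin m → Ω => F (Function.extend τ d D) := by
  classical
  have hinv : Function.Involutive
      (fun p : (κ → Ω) × (Fin m → Ω) => (Function.extend τ p.2 p.1, p.1 ∘ τ)) := by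
    rintro ⟨D, d⟩
    refine Prod.ext ?_ ?_
    · funext k
      by_cases hk : ∃ a, τ a = k
      · obtain ⟨a, rfl⟩ := hk
        simp [hτ.extend_apply]
      · simp [Function.extend_apply' _ _ _ hk]
    · funext a
      simp [hτ.extend_apply]
  rcases isEmpty_or_nonempty Ω with h | h
  · rcases Nat.eq_zero_or_pos m with rfl | hm
    · have : ∀ (D : κ → Ω) (d : Fin 0 → Ω), Function.extend τ d D = D := by
        intro D d
        funext k
        exact Function.extend_apply' _ _ _ (by rintro ⟨a, _⟩; exact a.elim0)
      simp only [this]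
      congr 1
      funext D
      exact (ev_const _).symm
    · have : Nonempty κ := ⟨τ ⟨0, hm⟩⟩
      simp [ev]
  · have key : ∑ p : (κ → Ω) × (Fin m → Ω), F (Function.extend τ p.2 p.1)
        = ∑ p : (κ → Ω) × (Fin m → Ω), F p.1 :=
      (Equiv.sum_comp (hinv.toPerm _) (fun p : (κ → Ω) × (Fin m → Ω) => F p.1))
    rw [Fintype.sum_prod_type, Fintype.sum_prod_type] at key
    simp only [ev, ← sum_div, key]
    have : (Fintype.card (Fin m → Ω) : ℝ) ≠ 0 := Nat.cast_ne_zero.2 Fintype.card_ne_zero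
    simp only [sum_const, card_univ, nsmul_eq_mul, ← mul_sum]
    field_simp

lemma pr_resample_le {m : ℕ} (τ : Fin m → κ) (hτ : Function.Injective τ) (P : (κ → Ω) → Prop)
    (g : (κ → Ω) → ℝ) (h : ∀ D, pr (fun d : Fin m → Ω => P (Function.extend τ d D)) ≤ g D) :
    pr P ≤ ev g := by
  rw [pr, ev_resample τ hτ]
  exact ev_mono h

end Pi

end Averages

section Signs

variable {ι : Type*} [Fintype ι]

/-- The sign encoded by a Boolean. -/
def sg (b : Bool) : ℝ := if b then 1 else -1

@[simp] lemma sg_true : sg true = 1 := rfl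
@[simp] lemma sg_false : sg false = -1 := rfl
@[simp] lemma sg_sq (b : Bool) : sg b ^ 2 = 1 := by cases b <;> norm_num

/-- The inner product of a sign vector with a real vector. -/
def dot (X : ι → Bool) (y : ι → ℝ) : ℝ := ∑ i, sg (X i) * y i

/-- The squared Euclidean norm. -/
def q (y : ι → ℝ) : ℝ := ∑ i, y i ^ 2

/-- The squared Euclidean distance to the integer lattice. -/
noncomputable def nz (y : ι → ℝ) : ℝ := ∑ i, (y i - round (y i)) ^ 2

lemma q_nonneg (y : ι → ℝ) : 0 ≤ q y := sum_nonneg fun _ _ => sq_nonneg _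
lemma nz_nonneg (y : ι → ℝ) : 0 ≤ nz y := sum_nonneg fun _ _ => sq_nonneg _

lemma q_smul (c : ℝ) (y : ι → ℝ) : q (fun i => c * y i) = c ^ 2 * q y := by
  simp [q, mul_pow, mul_sum]

lemma q_eq_zero {y : ι → ℝ} : q y = 0 ↔ y = 0 := by
  rw [q, sum_eq_zero_iff_of_nonneg fun _ _ => sq_nonneg _]
  simp [funext_iff]

lemma sq_le_q (y : ι → ℝ) (i : ι) : y i ^ 2 ≤ q y :=
  single_le_sum (f := fun i => y i ^ 2) (fun _ _ => sq_nonneg _) (mem_univ i)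

lemma q_add_le (x y : ι → ℝ) : q (fun i => x i + y i) ≤ 2 * q x + 2 * q y := by
  simp only [q, mul_sum, ← sum_add_distrib]
  exact sum_le_sum fun i _ => by nlinarith [sq_nonneg (x i - y i)]

lemma sqrt_q_add_le (x y : ι → ℝ) : √(q (fun i => x i + y i)) ≤ √(q x) + √(q y) := by
  have := norm_add_le (WithLp.toLp 2 x : EuclideanSpace ℝ ι) (WithLp.toLp 2 y)
  simpa [EuclideanSpace.norm_eq, q] using this

lemma sq_sum_mul_le (x y : ι → ℝ) : (∑ i, x i * y i) ^ 2 ≤ q x * q y :=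
  sum_mul_sq_le_sq_mul_sq univ x y

lemma nz_le_of_int (y : ι → ℝ) (p : ι → ℤ) : nz y ≤ q fun i => y i - p i :=
  sum_le_sum fun i _ => sq_le_sq.2 (round_le (y i) (p i))

lemma dot_add (X : ι → Bool) (x y : ι → ℝ) :
    dot X (fun i => x i + y i) = dot X x + dot X y := by
  simp [dot, mul_add, sum_add_distrib]

lemma dot_sub (X : ι → Bool) (x y : ι → ℝ) :
    dot X (fun i => x i - y i) = dot X x - dot X y := by
  simp [dot, mul_sub, sum_sub_distrib]

lemma dot_smul (X : ι → Bool) (c : ℝ) (y : ι → ℝ) : dot X (fun i => c * y i) = c * dot X y := by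
  simp only [dot, mul_sum]
  exact sum_congr rfl fun i _ => by ring

lemma dot_sum {α : Type*} (s : Finset α) (X : ι → Bool) (c : α → ℝ) (z : α → ι → ℝ) :
    dot X (fun i => ∑ a ∈ s, c a * z a i) = ∑ a ∈ s, c a * dot X (z a) := by
  simp only [dot, mul_sum]
  rw [sum_comm]
  exact sum_congr rfl fun i _ => sum_congr rfl fun a _ => by ring

lemma dot_sq_le (X : ι → Bool) (y : ι → ℝ) : dot X y ^ 2 ≤ Fintype.card ι * q y := by
  have := sq_sum_mul_le (fun i => sg (X i)) y
  simpa [dot, q] using this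

variable [DecidableEq ι]

lemma ev_exp_dot (y : ι → ℝ) : ev (fun X => Real.exp (dot X y)) = ∏ i, Real.cosh (y i) := by
  simp only [dot, Real.exp_sum]
  rw [ev_pi_prod (fun i b => Real.exp (sg b * y i))]
  refine prod_congr rfl fun i _ => ?_
  simp [ev, Real.cosh_eq]

lemma ev_exp_dot_le (y : ι → ℝ) : ev (fun X => Real.exp (dot X y)) ≤ Real.exp (q y / 2) := by
  rw [ev_exp_dot, q, sum_div, Real.exp_sum]
  exact prod_le_prod (fun i _ => (Real.cosh_pos _).le) fun i _ => Real.cosh_le_exp_half_sq _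

lemma ev_sg_mul_sg (i j : ι) :
    ev (fun X : ι → Bool => sg (X i) * sg (X j)) = if i = j then 1 else 0 := by
  split_ifs with h
  · subst h
    simp only [← sq, sg_sq]
    exact ev_const _
  · let e : (ι → Bool) ≃ (ι → Bool) :=
      Function.Involutive.toPerm (fun X => Function.update X i (!X i)) (fun X => by simp)
    have h1 := ev_equiv e (fun X : ι → Bool => sg (X i) * sg (X j))
    have h2 : ∀ X : ι → Bool, sg ((e X) i) * sg ((e X) j) = (-1) * (sg (X i) * sg (X j)) := by
      intro X
      have hj : j ≠ i := fun h' => h h'.symm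
      have : ∀ b, sg (!b) = - sg b := by intro b; cases b <;> simp
      simp [e, Function.Involutive.toPerm, Function.update_of_ne hj, this]
    simp only [h2] at h1
    rw [ev_const_mul] at h1
    linarith

lemma ev_dot_sq (y : ι → ℝ) : ev (fun X => dot X y ^ 2) = q y := by
  have : ∀ X : ι → Bool, dot X y ^ 2 = ∑ i, ∑ j, (y i * y j) * (sg (X i) * sg (X j)) := by
    intro X
    rw [sq, dot, sum_mul_sum]
    exact sum_congr rfl fun i _ => sum_congr rfl fun j _ => by ring
  simp only [this]
  rw [ev_sum]
  simp_rw [ev_sum, ev_const_mul, ev_sg_mul_sg]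
  simp [q, sq]

end Signs

end LSV

namespace LSV

open Finset MeasureTheory

section Fourier

variable {ι : Type*} [Fintype ι] [DecidableEq ι] {r : ℕ}

lemma integrable_exp_neg_sum {b : Fin r → ℝ} (hb : ∀ k, 0 < b k) :
    Integrable (fun ξ : Fin r → ℝ => Real.exp (-∑ k, b k * ξ k ^ 2)) := by
  have := Integrable.fintype_prod (μ := fun _ : Fin r => (volume : Measure ℝ))
    (f := fun k x => Real.exp (-b k * x ^ 2)) fun k => integrable_exp_neg_mul_sq (hb k)
  refine this.congr (Filter.Eventually.of_forall fun ξ => ?_)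
  simp [← Real.exp_sum, sum_neg_distrib]

lemma integral_exp_neg_sum (b : Fin r → ℝ) :
    ∫ ξ : Fin r → ℝ, Real.exp (-∑ k, b k * ξ k ^ 2) = ∏ k, √(Real.pi / b k) := by
  have := integral_fintype_prod_volume_eq_prod (𝕜 := ℝ)
    (fun (k : Fin r) (x : ℝ) => Real.exp (-b k * x ^ 2))
  simp only [integral_gaussian, ← Real.exp_sum] at this
  rw [← this]
  simp [sum_neg_distrib]

lemma integrable_exp_neg_q {b : ℝ} (hb : 0 < b) :
    Integrable (fun ξ : Fin r → ℝ => Real.exp (-(b * q ξ))) := by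
  simpa [q, mul_sum] using integrable_exp_neg_sum (fun _ : Fin r => hb)

lemma integral_exp_neg_q (b : ℝ) :
    ∫ ξ : Fin r → ℝ, Real.exp (-(b * q ξ)) = √(Real.pi / b) ^ r := by
  simpa [q, mul_sum] using integral_exp_neg_sum (fun _ : Fin r => b)

lemma integral_cexp_gauss_one {b : ℝ} (hb : 0 < b) (a : ℝ) :
    ∫ x : ℝ, Complex.exp (Complex.I * a * x) * (Real.exp (-b * x ^ 2) : ℂ)
      = (√(Real.pi / b) * Real.exp (-(a ^ 2 / (4 * b))) : ℝ) := by
  have h := fourierIntegral_gaussian (b := b) (by simpa using hb) a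
  have h2 : ((Real.pi : ℂ) / b) ^ (1 / 2 : ℂ) = (√(Real.pi / b) : ℝ) := by
    rw [Real.sqrt_eq_rpow, Complex.ofReal_cpow (by positivity)]
    norm_num
  rw [h2] at h
  push_cast
  rw [neg_div] at h
  rw [← h]

lemma integral_cexp_gauss {b : ℝ} (hb : 0 < b) (a : Fin r → ℝ) :
    ∫ ξ : Fin r → ℝ, Complex.exp (Complex.I * (∑ k, a k * ξ k : ℝ)) * (Real.exp (-(b * q ξ)) : ℂ)
      = (√(Real.pi / b) ^ r * Real.exp (-(q a / (4 * b))) : ℝ) := by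
  have h := integral_fintype_prod_volume_eq_prod (𝕜 := ℂ) (fun (k : Fin r) (x : ℝ) =>
    Complex.exp (Complex.I * a k * x) * (Real.exp (-b * x ^ 2) : ℂ))
  simp only [integral_cexp_gauss_one hb] at h
  rw [← Complex.ofReal_prod, prod_mul_distrib, ← Real.exp_sum, prod_const, card_univ,
    Fintype.card_fin] at h
  rw [q, sum_div, ← sum_neg_distrib, ← h]
  congr 1
  funext ξ
  rw [prod_mul_distrib, ← Complex.exp_sum, ← Complex.ofReal_prod, ← Real.exp_sum]
  congr 2
  · push_cast
    rw [mul_sum]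
    exact sum_congr rfl fun k _ => by ring
  · congr 1
    simp [q, mul_sum, sum_neg_distrib]

/-- The frequency vector `∑ ξ_k z_k`. -/
def comb (z : Fin r → ι → ℝ) (ξ : Fin r → ℝ) (i : ι) : ℝ := ∑ k, ξ k * z k i

lemma dot_comb (X : ι → Bool) (z : Fin r → ι → ℝ) (ξ : Fin r → ℝ) :
    dot X (comb z ξ) = ∑ k, ξ k * dot X (z k) := dot_sum univ X ξ z

/-- The tilted characteristic function of the vector `(dot X z_k)_k`. -/
noncomputable def cf (z0 : ι → ℝ) (z : Fin r → ι → ℝ) (ξ : Fin r → ℝ) : ℂ :=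
  ∏ i, Complex.cosh (z0 i + comb z ξ i * Complex.I)

lemma sum_cexp_dot (z0 θ : ι → ℝ) :
    ∑ X : ι → Bool, Complex.exp (dot X z0 + dot X θ * Complex.I)
      = Fintype.card (ι → Bool) * ∏ i, Complex.cosh (z0 i + θ i * Complex.I) := by
  have : ∀ X : ι → Bool, Complex.exp (dot X z0 + dot X θ * Complex.I)
      = ∏ i, Complex.exp (sg (X i) * (z0 i + θ i * Complex.I)) := by
    intro X
    rw [← Complex.exp_sum]
    congr 1
    simp only [dot]
    push_cast
    rw [sum_mul, ← sum_add_distrib]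
    exact sum_congr rfl fun i _ => by ring
  simp only [this]
  have h := (prod_univ_sum (fun _ : ι => (univ : Finset Bool))
    (fun i b => Complex.exp (sg b * (z0 i + θ i * Complex.I)))).symm
  rw [Fintype.piFinset_univ] at h
  rw [h]
  simp only [Fintype.univ_bool, mem_singleton, Bool.true_eq_false, not_false_eq_true,
    sum_insert, sum_singleton, sg_true, sg_false, Complex.cosh, prod_div_distrib, prod_const,
    card_univ, Fintype.card_pi, Fintype.card_bool]
  push_cast
  rw [← mul_div_assoc, mul_div_cancel_left₀ _ (pow_ne_zero _ two_ne_zero)]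
  refine prod_congr rfl fun i _ => ?_
  congr 2 <;> ring_nf

lemma norm_cf_le_exp (z0 : ι → ℝ) (z : Fin r → ι → ℝ) (ξ : Fin r → ℝ) :
    ‖cf z0 z ξ‖ ≤ Real.exp (q z0 / 2) := by
  rw [cf, norm_prod, q, sum_div, Real.exp_sum]
  refine prod_le_prod (fun _ _ => norm_nonneg _) fun i _ => ?_
  refine le_trans ?_ (Real.cosh_le_exp_half_sq _)
  rw [Complex.cosh, norm_div, Complex.norm_ofNat, Real.cosh_eq]
  refine div_le_div_of_nonneg_right ((norm_add_le _ _).trans ?_) zero_le_two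
  simp [Complex.norm_exp]

lemma continuous_comb (z : Fin r → ι → ℝ) (i : ι) : Continuous fun ξ => comb z ξ i := by
  unfold comb; fun_prop

lemma continuous_q {α : Type*} [Fintype α] : Continuous (q : (α → ℝ) → ℝ) := by
  unfold q; fun_prop

lemma continuous_cf (z0 : ι → ℝ) (z : Fin r → ι → ℝ) : Continuous (cf z0 z) := by
  unfold cf
  refine continuous_finsetProd _ fun i _ => ?_
  have := continuous_comb z i
  have h : Continuous fun ξ => ((comb z ξ i : ℝ) : ℂ) := Complex.continuous_ofReal.comp this
  exact Complex.continuous_cosh.comp (by fun_prop)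

lemma integrable_gauss_cexp {b : ℝ} (hb : 0 < b) (a : Fin r → ℝ) :
    Integrable (fun ξ : Fin r → ℝ =>
      Complex.exp (Complex.I * (∑ k, a k * ξ k : ℝ)) * (Real.exp (-(b * q ξ)) : ℂ)) := by
  refine (integrable_exp_neg_q (r := r) hb).mono' ?_ (Filter.Eventually.of_forall fun ξ => ?_)
  · refine Continuous.aestronglyMeasurable ?_
    have := continuous_q (α := Fin r)
    fun_prop
  · rw [norm_mul, mul_comm Complex.I, Complex.norm_exp_ofReal_mul_I, one_mul, Complex.norm_real,
      Real.norm_eq_abs, abs_of_pos (Real.exp_pos _)]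

/-- Fourier inversion for the tilted and Gaussian-smoothed law of `(dot X z_k)_k`. -/
lemma fourier_smooth {b : ℝ} (hb : 0 < b) (z0 : ι → ℝ) (z : Fin r → ι → ℝ) (y : Fin r → ℝ) :
    ((√(Real.pi / b) ^ r * ev (fun X : ι → Bool => Real.exp (dot X z0) *
        Real.exp (-(q (fun k => dot X (z k) - y k) / (4 * b)))) : ℝ) : ℂ)
      = ∫ ξ : Fin r → ℝ, Complex.exp (Complex.I * (∑ k, -y k * ξ k : ℝ)) *
          (Real.exp (-(b * q ξ)) : ℂ) * cf z0 z ξ := by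
  have hcard : (Fintype.card (ι → Bool) : ℂ) ≠ 0 := Nat.cast_ne_zero.2 Fintype.card_ne_zero
  have hpt : ∀ ξ : Fin r → ℝ, Complex.exp (Complex.I * (∑ k, -y k * ξ k : ℝ)) *
      (Real.exp (-(b * q ξ)) : ℂ) * cf z0 z ξ = ∑ X : ι → Bool,
        (Real.exp (dot X z0) / Fintype.card (ι → Bool) : ℂ) * (Complex.exp (Complex.I *
          (∑ k, (dot X (z k) - y k) * ξ k : ℝ)) * (Real.exp (-(b * q ξ)) : ℂ)) := by
    intro ξ
    have h1 := sum_cexp_dot z0 (comb z ξ)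
    rw [cf, eq_div_of_mul_eq hcard ((mul_comm _ _).trans h1.symm), sum_div, mul_sum]
    refine sum_congr rfl fun X _ => ?_
    rw [Complex.exp_add, dot_comb]
    have : Complex.exp (Complex.I * (∑ k, (dot X (z k) - y k) * ξ k : ℝ)) =
        Complex.exp (Complex.I * (∑ k, -y k * ξ k : ℝ)) *
          Complex.exp ((∑ k, ξ k * dot X (z k) : ℝ) * Complex.I) := by
      rw [← Complex.exp_add]
      congr 1
      push_cast
      rw [mul_comm _ Complex.I, ← mul_add, ← sum_add_distrib]
      congr 1
      exact sum_congr rfl fun k _ => by ring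
    rw [this]
    push_cast
    ring
  simp only [hpt]
  rw [integral_finsetSum _ fun X _ => (integrable_gauss_cexp hb _).const_mul _]
  simp only [integral_const_mul, integral_cexp_gauss hb]
  rw [ev, sum_div, mul_sum]
  push_cast
  exact sum_congr rfl fun X _ => by ring

/-- Distance-to-lattice decay of the hyperbolic cosine off the real axis. -/
lemma norm_cosh_le {a : ℝ} (ha : |a| ≤ 1) (θ : ℝ) :
    ‖Complex.cosh (a + θ * Complex.I)‖ ≤
      Real.exp (a ^ 2 / 2) * Real.exp (-((θ / Real.pi - round (θ / Real.pi)) ^ 2 / 2)) := by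
  have hpi := Real.pi_pos
  set d := θ / Real.pi - round (θ / Real.pi) with hd
  have hsin : 4 * d ^ 2 ≤ Real.sin θ ^ 2 := by
    have h1 : Real.sin θ ^ 2 = Real.sin (d * Real.pi) ^ 2 := by
      have : d * Real.pi = θ - round (θ / Real.pi) * Real.pi := by
        rw [hd]; field_simp
      have h5 : ((-1 : ℝ) ^ round (θ / Real.pi)) ^ 2 = 1 := by
        rw [← zpow_natCast, ← zpow_mul, mul_comm, zpow_mul]
        simp
      rw [this, Real.sin_sub_int_mul_pi, mul_pow, h5, one_mul]
    have hd2 : |d| ≤ 1 / 2 := abs_sub_round _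
    have h2 : |Real.sin (d * Real.pi)| = Real.sin (|d| * Real.pi) := by
      rw [Real.abs_sin_eq_sin_abs_of_abs_le_pi, abs_mul, abs_of_pos hpi]
      rw [abs_mul, abs_of_pos hpi]
      nlinarith
    have h3 := Real.mul_le_sin (x := |d| * Real.pi) (by positivity) (by nlinarith)
    rw [h1, ← sq_abs (Real.sin _), h2]
    have h4 : 2 / Real.pi * (|d| * Real.pi) = 2 * |d| := by field_simp
    rw [h4] at h3
    have := pow_le_pow_left₀ (by positivity) h3 2
    rw [mul_pow, sq_abs] at this
    linarith
  have hnorm : ‖Complex.cosh (a + θ * Complex.I)‖ ^ 2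
      = Real.cosh a ^ 2 - Real.sin θ ^ 2 := by
    rw [Complex.cosh_add, Complex.cosh_mul_I, Complex.sinh_mul_I, ← mul_assoc,
      ← Complex.ofReal_cosh, ← Complex.ofReal_sinh, ← Complex.ofReal_cos, ← Complex.ofReal_sin,
      ← Complex.ofReal_mul, ← Complex.ofReal_mul, Complex.sq_norm, Complex.normSq_add_mul_I]
    have h1 := Real.cosh_sq a
    have h2 := Real.sin_sq_add_cos_sq θ
    nlinarith
  have hcosh : Real.cosh a ^ 2 ≤ 4 := by
    have h1 : Real.cosh a ≤ Real.exp (1 / 2) := by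
      refine (Real.cosh_le_exp_half_sq a).trans (Real.exp_le_exp.2 ?_)
      have := (sq_le_one_iff_abs_le_one a).2 ha
      linarith
    have h2 := pow_le_pow_left₀ (Real.cosh_pos a).le h1 2
    rw [← Real.exp_nat_mul] at h2
    norm_num at h2
    linarith [Real.exp_one_lt_d9]
  have hsq : ‖Complex.cosh (a + θ * Complex.I)‖ ^ 2 ≤
      (Real.exp (a ^ 2 / 2) * Real.exp (-(d ^ 2 / 2))) ^ 2 := by
    have h1 : Real.cosh a ^ 2 - Real.sin θ ^ 2 ≤ Real.cosh a ^ 2 * (1 - d ^ 2) := by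
      nlinarith [sq_nonneg d]
    have h2 : 1 - d ^ 2 ≤ Real.exp (-(d ^ 2 / 2)) ^ 2 := by
      rw [← Real.exp_nat_mul]
      have := Real.add_one_le_exp (-d ^ 2)
      have h3 : ((2 : ℕ) : ℝ) * -(d ^ 2 / 2) = -d ^ 2 := by push_cast; ring
      rw [h3]; linarith
    rw [hnorm, mul_pow]
    refine h1.trans ?_
    exact (mul_le_mul_of_nonneg_left h2 (sq_nonneg _)).trans (mul_le_mul_of_nonneg_right
      (pow_le_pow_left₀ (Real.cosh_pos a).le (Real.cosh_le_exp_half_sq a) 2) (sq_nonneg _))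
  exact le_of_sq_le_sq hsq (by positivity)

lemma norm_cf_le {z0 : ι → ℝ} (hz : q z0 ≤ 1) (z : Fin r → ι → ℝ) (ξ : Fin r → ℝ) :
    ‖cf z0 z ξ‖ ≤
      Real.exp (q z0 / 2) * Real.exp (-(nz (fun i => comb z ξ i / Real.pi) / 2)) := by
  rw [cf, norm_prod, q, nz, sum_div, sum_div, ← sum_neg_distrib, Real.exp_sum, Real.exp_sum,
    ← prod_mul_distrib]
  refine prod_le_prod (fun _ _ => norm_nonneg _) fun i _ => norm_cosh_le ?_ _
  rw [← sq_le_one_iff_abs_le_one]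
  exact (sq_le_q z0 i).trans hz

/-- Tilted small ball estimate in terms of arithmetic structure. -/
lemma tilted_small_ball {z0 : ι → ℝ} (hz : q z0 ≤ 1) (z : Fin r → ι → ℝ) {b : Fin r → ℝ}
    (hb : ∀ k, 0 < b k) {B Ξ : ℝ}
    (h : ∀ ξ : Fin r → ℝ, q ξ ≤ Ξ →
      min (∑ k, b k * ξ k ^ 2) B ≤ nz (fun i => comb z ξ i / Real.pi)) :
    ev (fun X : ι → Bool => Real.exp (dot X z0) * Real.exp (-(∑ k, dot X (z k) ^ 2) / 2)) ≤
      2 * (∏ k, (√(b k))⁻¹ + Real.exp (-(B / 2)) + √2 ^ r * Real.exp (-(Ξ / 4))) := by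
  have hpi := Real.pi_pos
  have hF := fourier_smooth (b := 1 / 2) one_half_pos z0 z 0
  set E := ev (fun X : ι → Bool =>
    Real.exp (dot X z0) * Real.exp (-(∑ k, dot X (z k) ^ 2) / 2)) with hE
  have hE0 : 0 ≤ E := ev_nonneg fun X => by positivity
  have hE1 : ev (fun X : ι → Bool => Real.exp (dot X z0) *
        Real.exp (-(q (fun k => dot X (z k) - (0 : Fin r → ℝ) k) / (4 * (1 / 2))))) = E := by
    rw [hE]
    congr 1
    funext X
    congr 2
    simp only [q, Pi.zero_apply, sub_zero]
    ring
  rw [hE1] at hF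
  have hE2 := congrArg norm hF
  rw [Complex.norm_real, Real.norm_eq_abs, abs_of_nonneg (by positivity)] at hE2
  have hpt : ∀ ξ : Fin r → ℝ, ‖Complex.exp (Complex.I * (∑ k, -(0 : Fin r → ℝ) k * ξ k : ℝ)) *
          (Real.exp (-(1 / 2 * q ξ)) : ℂ) * cf z0 z ξ‖ ≤
      2 * (Real.exp (-∑ k, b k / 2 * ξ k ^ 2) + Real.exp (-(B / 2)) * Real.exp (-(1 / 2 * q ξ))
        + Real.exp (-(Ξ / 4)) * Real.exp (-(1 / 4 * q ξ))) := by
    intro ξ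
    rw [norm_mul, norm_mul, mul_comm Complex.I, Complex.norm_exp_ofReal_mul_I, one_mul,
      Complex.norm_real, Real.norm_eq_abs, abs_of_pos (Real.exp_pos _)]
    have h2 : Real.exp (q z0 / 2) ≤ 2 := by
      have h3 : Real.exp (1 / 2) ^ 2 ≤ 2 ^ 2 := by
        rw [← Real.exp_nat_mul]
        norm_num
        linarith [Real.exp_one_lt_d9]
      exact (Real.exp_le_exp.2 (by linarith)).trans (le_of_sq_le_sq h3 (by norm_num))
    have hcf : ‖cf z0 z ξ‖ ≤ 2 * Real.exp (-(nz (fun i => comb z ξ i / Real.pi) / 2)) :=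
      (norm_cf_le hz z ξ).trans (mul_le_mul_of_nonneg_right h2 (Real.exp_pos _).le)
    have hmain : Real.exp (-(1 / 2 * q ξ)) *
          Real.exp (-(nz (fun i => comb z ξ i / Real.pi) / 2)) ≤
        Real.exp (-∑ k, b k / 2 * ξ k ^ 2) + Real.exp (-(B / 2)) * Real.exp (-(1 / 2 * q ξ))
        + Real.exp (-(Ξ / 4)) * Real.exp (-(1 / 4 * q ξ)) := by
      have hq := q_nonneg ξ
      have hn := nz_nonneg (fun i => comb z ξ i / Real.pi)
      rw [← Real.exp_add, ← Real.exp_add, ← Real.exp_add]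
      have p1 := Real.exp_pos (-∑ k, b k / 2 * ξ k ^ 2)
      have p2 := Real.exp_pos (-(B / 2) + -(1 / 2 * q ξ))
      have p3 := Real.exp_pos (-(Ξ / 4) + -(1 / 4 * q ξ))
      have hs : ∑ k, b k / 2 * ξ k ^ 2 = (∑ k, b k * ξ k ^ 2) / 2 := by
        rw [sum_div]; exact sum_congr rfl fun k _ => by ring
      rcases le_or_gt (q ξ) Ξ with hξ | hξ
      · rcases min_le_iff.1 (h ξ hξ) with h4 | h4
        · have : Real.exp (-(1 / 2 * q ξ) + -(nz (fun i => comb z ξ i / Real.pi) / 2)) ≤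
            Real.exp (-∑ k, b k / 2 * ξ k ^ 2) := Real.exp_le_exp.2 (by rw [hs]; linarith)
          linarith
        · have : Real.exp (-(1 / 2 * q ξ) + -(nz (fun i => comb z ξ i / Real.pi) / 2)) ≤
            Real.exp (-(B / 2) + -(1 / 2 * q ξ)) := Real.exp_le_exp.2 (by linarith)
          linarith
      · have : Real.exp (-(1 / 2 * q ξ) + -(nz (fun i => comb z ξ i / Real.pi) / 2)) ≤
            Real.exp (-(Ξ / 4) + -(1 / 4 * q ξ)) := Real.exp_le_exp.2 (by linarith)
        linarith
    calc _ ≤ Real.exp (-(1 / 2 * q ξ)) *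
          (2 * Real.exp (-(nz (fun i => comb z ξ i / Real.pi) / 2))) :=
          mul_le_mul_of_nonneg_left hcf (Real.exp_pos _).le
      _ = 2 * (Real.exp (-(1 / 2 * q ξ)) *
          Real.exp (-(nz (fun i => comb z ξ i / Real.pi) / 2))) := by ring
      _ ≤ _ := by linarith
  have i1 := integrable_exp_neg_sum (b := fun k => b k / 2) (fun k => half_pos (hb k))
  have i2 := (integrable_exp_neg_q (r := r) (b := 1 / 2) (by norm_num)).const_mul
    (Real.exp (-(B / 2)))
  have i3 := (integrable_exp_neg_q (r := r) (b := 1 / 4) (by norm_num)).const_mul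
    (Real.exp (-(Ξ / 4)))
  have hle := norm_integral_le_of_norm_le (((i1.add i2).add i3).const_mul 2)
    (Filter.Eventually.of_forall hpt)
  rw [← hE2, integral_const_mul] at hle
  simp only [Pi.add_apply] at hle
  rw [integral_add (by exact i1.add i2) i3, integral_add i1 i2, integral_const_mul,
    integral_const_mul, integral_exp_neg_q, integral_exp_neg_q, integral_exp_neg_sum] at hle
  have hs0 : 0 < √(Real.pi / (1 / 2)) := Real.sqrt_pos.2 (by positivity)
  have e1 : ∏ k, √(Real.pi / (b k / 2)) = √(Real.pi / (1 / 2)) ^ r * ∏ k, (√(b k))⁻¹ := by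
    have : √(Real.pi / (1 / 2)) ^ r = ∏ _k : Fin r, √(Real.pi / (1 / 2)) := by simp
    rw [this, ← prod_mul_distrib]
    refine prod_congr rfl fun k _ => ?_
    rw [← Real.sqrt_inv, ← Real.sqrt_mul (by positivity)]
    congr 1
    field_simp
  have e2 : √(Real.pi / (1 / 4)) ^ r = √(Real.pi / (1 / 2)) ^ r * √2 ^ r := by
    rw [← mul_pow, ← Real.sqrt_mul (by positivity)]
    congr 2
    ring
  rw [e1, e2] at hle
  have hp : 0 < √(Real.pi / (1 / 2)) ^ r := pow_pos hs0 r
  refine le_of_mul_le_mul_left ?_ hp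
  refine hle.trans (le_of_eq ?_)
  ring

end Fourier

end LSV

namespace LSV

open Finset MeasureTheory

section Lattice

variable {ι : Type*} [Fintype ι] [DecidableEq ι]

/-- The integer points in the ball of squared radius `M`. -/
noncomputable def latt (ι : Type*) [Fintype ι] [DecidableEq ι] (M : ℝ) : Finset (ι → ℤ) :=
  (Fintype.piFinset fun _ : ι => Icc (-(⌈M⌉₊ : ℤ)) ⌈M⌉₊).filter fun p => q (fun i => (p i : ℝ)) ≤ M

lemma mem_latt {M : ℝ} {p : ι → ℤ} : p ∈ latt ι M ↔ q (fun i => (p i : ℝ)) ≤ M := by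
  simp only [latt, mem_filter, Fintype.mem_piFinset, mem_Icc, and_iff_right_iff_imp]
  intro h i
  rw [← abs_le]
  have h1 : (p i : ℝ) ^ 2 ≤ M := (sq_le_q (fun i => (p i : ℝ)) i).trans h
  have h2 : |p i| ≤ p i ^ 2 := by
    rw [← sq_abs]
    exact Int.le_self_sq _
  have h3 : ((|p i| : ℤ) : ℝ) ≤ (⌈M⌉₊ : ℝ) := by
    refine le_trans ?_ (Nat.le_ceil M)
    refine le_trans ?_ h1
    exact_mod_cast h2
  exact_mod_cast h3

lemma sum_Icc_exp_abs_le {a : ℝ} (ha : 0 < a) (K : ℕ) :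
    ∑ k ∈ Icc (-(K : ℤ)) K, Real.exp (-(a * |(k : ℝ)|)) ≤ 1 + 2 / (Real.exp a - 1) := by
  rw [Finset.sum_Icc_of_even_eq_range (fun k => by simp)]
  have hx : Real.exp (-a) < 1 := by simpa using ha
  have h1 : ∑ m ∈ range (K + 1), Real.exp (-(a * |((m : ℤ) : ℝ)|)) ≤ 1 / (1 - Real.exp (-a)) := by
    have : ∀ m : ℕ, Real.exp (-(a * |((m : ℤ) : ℝ)|)) = Real.exp (-a) ^ m := by
      intro m
      rw [← Real.exp_nat_mul]
      congr 1
      simp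
      ring
    simp only [this]
    rw [geom_sum_eq hx.ne, ← neg_div_neg_eq, neg_sub, neg_sub]
    refine div_le_div_of_nonneg_right ?_ (by linarith)
    have := pow_pos (Real.exp_pos (-a)) (K + 1)
    linarith
  have h2 : 1 / (1 - Real.exp (-a)) = 1 + 1 / (Real.exp a - 1) := by
    have h3 : 1 < Real.exp a := by simpa using ha
    rw [Real.exp_neg]
    field_simp [sub_ne_zero.2 h3.ne']
    ring
  rw [h2] at h1
  simp only [nsmul_eq_mul]
  push_cast
  simp only [Int.cast_natCast, abs_zero, mul_zero, neg_zero, Real.exp_zero] at h1 ⊢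
  have h4 : 2 / (Real.exp a - 1) = 2 * (1 / (Real.exp a - 1)) := by ring
  rw [h4]
  linarith

lemma card_latt_le_of {M β s : ℝ} (hβ : 0 ≤ β)
    (hs : ∀ K : ℕ, ∑ k ∈ Icc (-(K : ℤ)) K, Real.exp (-(β * (k : ℝ) ^ 2)) ≤ s) :
    ((latt ι M).card : ℝ) ≤ Real.exp (β * M) * s ^ Fintype.card ι := by
  have h1 : ((latt ι M).card : ℝ) ≤ ∑ p ∈ Fintype.piFinset fun _ : ι => Icc (-(⌈M⌉₊ : ℤ)) ⌈M⌉₊,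
      Real.exp (β * M) * ∏ i, Real.exp (-(β * (p i : ℝ) ^ 2)) := by
    rw [card_eq_sum_ones, Nat.cast_sum]
    refine (sum_le_sum fun p hp => ?_).trans
      (sum_le_sum_of_subset_of_nonneg (filter_subset _ _) fun p _ _ => by positivity)
    rw [← Real.exp_sum, ← Real.exp_add, Nat.cast_one, Real.one_le_exp_iff, sum_neg_distrib,
      ← mul_sum]
    have := mul_le_mul_of_nonneg_left (mem_latt.1 hp) hβ
    simp only [q] at this
    linarith
  refine h1.trans ?_
  rw [← mul_sum, ← prod_univ_sum (fun _ : ι => Icc (-(⌈M⌉₊ : ℤ)) ⌈M⌉₊)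
    (fun _ k => Real.exp (-(β * (k : ℝ) ^ 2))), prod_const, card_univ]
  exact mul_le_mul_of_nonneg_left (pow_le_pow_left₀ (sum_nonneg fun _ _ => (Real.exp_pos _).le)
    (hs _) _) (Real.exp_pos _).le

lemma card_latt_le {β : ℝ} (hβ : 0 < β) (M : ℝ) :
    ((latt ι M).card : ℝ) ≤
      Real.exp (β * M) * (1 + 2 / (Real.exp β - 1)) ^ Fintype.card ι := by
  refine card_latt_le_of hβ.le fun K => (sum_le_sum fun k _ => ?_).trans (sum_Icc_exp_abs_le hβ K)
  refine Real.exp_le_exp.2 (neg_le_neg (mul_le_mul_of_nonneg_left ?_ hβ.le))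
  have : |k| ≤ k ^ 2 := by
    rw [← sq_abs]
    exact Int.le_self_sq _
  exact_mod_cast this

lemma card_latt_le' {β : ℝ} (hβ : 0 < β) (M : ℝ) :
    ((latt ι M).card : ℝ) ≤
      Real.exp (β * M) * (Real.exp 1 * (1 + 2 / √β)) ^ Fintype.card ι := by
  have hb := Real.sqrt_pos.2 hβ
  refine card_latt_le_of hβ.le fun K => ?_
  calc _ ≤ ∑ k ∈ Icc (-(K : ℤ)) K, Real.exp 1 * Real.exp (-(√β * |(k : ℝ)|)) := by
        refine sum_le_sum fun k _ => ?_
        rw [← Real.exp_add]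
        refine Real.exp_le_exp.2 ?_
        have h1 : β * (k : ℝ) ^ 2 = (√β * |(k : ℝ)|) ^ 2 := by
          rw [mul_pow, Real.sq_sqrt hβ.le, sq_abs]
        rw [h1]
        nlinarith [sq_nonneg (√β * |(k : ℝ)| - 1), sq_nonneg (√β * |(k : ℝ)|)]
    _ ≤ _ := by
        rw [← mul_sum]
        refine mul_le_mul_of_nonneg_left ((sum_Icc_exp_abs_le hb K).trans ?_) (Real.exp_pos _).le
        have h2 := Real.add_one_le_exp (√β)
        have h3 : 2 / (Real.exp √β - 1) ≤ 2 / √β :=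
          div_le_div_of_nonneg_left zero_le_two hb (by linarith)
        linarith

end Lattice

section Concentration

variable {ι κ : Type*} [Fintype ι] [DecidableEq ι] [Fintype κ] [DecidableEq κ]

lemma exp_sq_div_four (a : ℝ) :
    Real.exp (a ^ 2 / 4) = (√Real.pi)⁻¹ * ∫ x : ℝ, Real.exp (-x ^ 2) * Real.exp (x * a) := by
  have h1 : ∀ x : ℝ, Real.exp (-x ^ 2) * Real.exp (x * a)
      = Real.exp (a ^ 2 / 4) * Real.exp (-1 * (x - a / 2) ^ 2) := by
    intro x
    rw [← Real.exp_add, ← Real.exp_add]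
    congr 1
    ring
  simp only [h1]
  rw [integral_const_mul, integral_sub_right_eq_self (fun x => Real.exp (-1 * x ^ 2)) (a / 2),
    integral_gaussian, div_one, mul_comm (Real.exp _), inv_mul_cancel_left₀
    (Real.sqrt_pos.2 Real.pi_pos).ne']

lemma integrable_exp_neg_sq_mul (a : ℝ) :
    Integrable fun x : ℝ => Real.exp (-x ^ 2) * Real.exp (x * a) := by
  have h1 : ∀ x : ℝ, Real.exp (-x ^ 2) * Real.exp (x * a)
      = Real.exp (a ^ 2 / 4) * Real.exp (-1 * (x - a / 2) ^ 2) := by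
    intro x
    rw [← Real.exp_add, ← Real.exp_add]
    congr 1
    ring
  simp only [h1]
  exact ((integrable_exp_neg_mul_sq one_pos).comp_sub_right (a / 2)).const_mul _

lemma ev_exp_dot_sq {y : ι → ℝ} (hy : q y ≤ 1) :
    ev (fun X => Real.exp (dot X y ^ 2 / 4)) ≤ √2 := by
  have hpi := Real.sqrt_pos.2 Real.pi_pos
  have h1 : ev (fun X : ι → Bool => Real.exp (dot X y ^ 2 / 4)) =
      (√Real.pi)⁻¹ * ∫ x : ℝ, Real.exp (-x ^ 2) * ev (fun X => Real.exp (dot X fun i => x * y i)) := by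
    simp only [exp_sq_div_four, ev_const_mul, dot_smul]
    congr 1
    simp only [ev]
    rw [← integral_finsetSum _ fun X _ => integrable_exp_neg_sq_mul _, ← integral_div]
    congr 1
    funext x
    rw [mul_div_assoc', mul_sum]
  rw [h1]
  have h2 : ∫ x : ℝ, Real.exp (-x ^ 2) * ev (fun X => Real.exp (dot X fun i => x * y i)) ≤
      ∫ x : ℝ, Real.exp (-(1 / 2) * x ^ 2) := by
    refine integral_mono_of_nonneg (Filter.Eventually.of_forall fun x => ?_)
      (integrable_exp_neg_mul_sq one_half_pos) (Filter.Eventually.of_forall fun x => ?_)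
    · exact mul_nonneg (Real.exp_pos _).le (ev_nonneg fun X => (Real.exp_pos _).le)
    · refine (mul_le_mul_of_nonneg_left (ev_exp_dot_le _) (Real.exp_pos _).le).trans ?_
      rw [← Real.exp_add, q_smul]
      refine Real.exp_le_exp.2 ?_
      nlinarith [sq_nonneg x, mul_le_mul_of_nonneg_left hy (sq_nonneg x)]
  refine (mul_le_mul_of_nonneg_left h2 (inv_pos.2 hpi).le).trans (le_of_eq ?_)
  rw [integral_gaussian, ← Real.sqrt_inv, ← Real.sqrt_mul (by positivity)]
  congr 1
  field_simp

lemma ev_exp_sum_pi (c : ℝ) (y : ι → ℝ) :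
    ev (fun D : κ → ι → Bool => Real.exp (∑ k, c * dot (D k) y ^ 2)) =
      ev (fun X : ι → Bool => Real.exp (c * dot X y ^ 2)) ^ Fintype.card κ := by
  simp only [Real.exp_sum]
  rw [ev_pi_prod (fun _ X => Real.exp (c * dot X y ^ 2)), prod_const, card_univ]

/-- The image of `y` under the sign matrix with rows `D k`. -/
def im (D : κ → ι → Bool) (y : ι → ℝ) (k : κ) : ℝ := dot (D k) y

lemma im_add (D : κ → ι → Bool) (x y : ι → ℝ) :
    im D (fun i => x i + y i) = fun k => im D x k + im D y k := by
  funext k; exact dot_add _ _ _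

lemma im_smul (D : κ → ι → Bool) (c : ℝ) (y : ι → ℝ) :
    im D (fun i => c * y i) = fun k => c * im D y k := by
  funext k; exact dot_smul _ _ _

lemma q_im_le (D : κ → ι → Bool) (y : ι → ℝ) :
    q (im D y) ≤ Fintype.card κ * (Fintype.card ι * q y) := by
  refine (sum_le_sum fun k _ => dot_sq_le (D k) y).trans ?_
  simp

lemma exists_unit_smul {y : ι → ℝ} (hy : y ≠ 0) :
    ∃ u : ι → ℝ, q u = 1 ∧ ∀ X : ι → Bool, dot X y ^ 2 = q y * dot X u ^ 2 := by
  have hq : 0 < q y := lt_of_le_of_ne (q_nonneg y) fun h => hy (q_eq_zero.1 h.symm)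
  have hs := Real.sqrt_pos.2 hq
  refine ⟨fun i => (√(q y))⁻¹ * y i, ?_, fun X => ?_⟩
  · rw [q_smul, inv_pow, Real.sq_sqrt hq.le, inv_mul_cancel₀ hq.ne']
  · rw [dot_smul, mul_pow, inv_pow, Real.sq_sqrt hq.le, mul_inv_cancel_left₀ hq.ne']

lemma pr_im_large (y : ι → ℝ) (N : ℝ) :
    pr (fun D : κ → ι → Bool => 40 * N * q y < q (im D y)) ≤
      √2 ^ Fintype.card κ * Real.exp (-(10 * N)) := by
  by_cases hy : y = 0
  · subst hy
    refine (pr_mono (Q := fun _ => False) fun D h => ?_).trans (le_trans (le_of_eq ?_)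
      (by positivity : (0 : ℝ) ≤ _))
    · have := q_im_le D (0 : ι → ℝ)
      simp [q_eq_zero.2 rfl] at h this
      linarith
    · simp [pr, ev]
  obtain ⟨u, hu, hd⟩ := exists_unit_smul hy
  have hq : 0 < q y := lt_of_le_of_ne (q_nonneg y) fun h => hy (q_eq_zero.1 h.symm)
  calc _ ≤ ev (fun D : κ → ι → Bool =>
          Real.exp (∑ k, 1 / 4 * dot (D k) u ^ 2) * Real.exp (-(10 * N))) := by
        refine pr_le_ev (fun D => by positivity) fun D h => ?_
        rw [← Real.exp_add, Real.one_le_exp_iff, ← mul_sum]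
        have : q (im D y) = q y * ∑ k, dot (D k) u ^ 2 := by
          rw [mul_sum]; exact sum_congr rfl fun k _ => hd _
        rw [this, mul_comm] at h
        have := lt_of_mul_lt_mul_left h hq.le
        linarith
    _ ≤ _ := by
        rw [ev_mul_const, ev_exp_sum_pi]
        refine mul_le_mul_of_nonneg_right (pow_le_pow_left₀ (ev_nonneg fun X => by positivity)
          ?_ _) (Real.exp_pos _).le
        refine le_trans (le_of_eq ?_) (ev_exp_dot_sq hu.le)
        congr 1
        funext X
        congr 1
        ring

lemma nz_eq (y : ι → ℝ) : nz y = q (fun i => y i - round (y i)) := rfl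

lemma nz_le_quarter (y : ι → ℝ) : nz y ≤ Fintype.card ι / 4 := by
  have : ∀ i ∈ univ, (y i - round (y i)) ^ 2 ≤ (1 / 4 : ℝ) := by
    intro i _
    have := pow_le_pow_left₀ (abs_nonneg _) (abs_sub_round (y i)) 2
    rw [sq_abs] at this
    linarith
  refine (sum_le_sum this).trans ?_
  simp
  linarith

/-- The operator norm bound. -/
def OpBd (D : κ → ι → Bool) : Prop := ∀ y, q (im D y) ≤ 200 * Fintype.card ι * q y

lemma opBd_of_latt (D : κ → ι → Bool)
    (h : ∀ p ∈ latt ι (25 / 4 * Fintype.card ι),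
      q (im D fun i => (p i : ℝ)) ≤ 40 * Fintype.card ι * q fun i => (p i : ℝ)) : OpBd D := by
  set N : ℝ := (Fintype.card ι : ℝ) with hN
  have hN0 : 0 ≤ N := Nat.cast_nonneg _
  let S : Set ℝ := {a | 0 ≤ a ∧ ∀ y, √(q (im D y)) ≤ a * √(q y)}
  have hne : S.Nonempty := by
    refine ⟨√(Fintype.card κ * N), Real.sqrt_nonneg _, fun y => ?_⟩
    rw [← Real.sqrt_mul (by positivity)]
    refine Real.sqrt_le_sqrt ((q_im_le D y).trans (le_of_eq ?_))
    ring
  have hbdd : BddBelow S := ⟨0, fun a ha => ha.1⟩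
  set A := sInf S with hA
  have hA0 : 0 ≤ A := le_csInf hne fun a ha => ha.1
  have hAS : ∀ y, √(q (im D y)) ≤ A * √(q y) := by
    intro y
    rcases (Real.sqrt_nonneg (q y)).eq_or_lt with h0 | h0
    · obtain ⟨a, ha⟩ := hne
      have := ha.2 y
      rwa [← h0, mul_zero] at this ⊢
    · rw [← div_le_iff₀ h0]
      exact le_csInf hne fun a ha => (div_le_iff₀ h0).2 (ha.2 y)
  have hstep : 8 * √N + A / 4 ∈ S := by
    refine ⟨by positivity, fun y => ?_⟩
    by_cases hy : y = 0
    · subst hy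
      have h1 := hAS 0
      rw [q_eq_zero.2 rfl, Real.sqrt_zero, mul_zero] at h1 ⊢
      exact h1
    have hq : 0 < q y := lt_of_le_of_ne (q_nonneg y) fun h => hy (q_eq_zero.1 h.symm)
    have hsq := Real.sqrt_pos.2 hq
    have hNpos : 0 < N := by
      rcases hN0.eq_or_lt with h0 | h0
      · have : IsEmpty ι := Fintype.card_eq_zero_iff.1 (by
          have := hN ▸ h0.symm
          exact_mod_cast this)
        exact absurd (Subsingleton.elim y 0) hy
      · exact h0
    have hsN := Real.sqrt_pos.2 hNpos
    set c : ℝ := 2 * √N / √(q y) with hc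
    have hc0 : 0 < c := by positivity
    set w : ι → ℝ := fun i => c * y i with hw
    set p : ι → ℤ := fun i => round (w i) with hp
    set e : ι → ℝ := fun i => w i - p i with he
    have hqw : √(q w) = 2 * √N := by
      rw [hw, q_smul, Real.sqrt_mul (sq_nonneg _), Real.sqrt_sq hc0.le, hc]
      field_simp
    have hqe : √(q e) ≤ √N / 2 := by
      have h1 : q e ≤ (√N / 2) ^ 2 := by
        rw [div_pow, Real.sq_sqrt hN0]
        have := nz_le_quarter w
        rw [nz_eq] at this
        refine this.trans (le_of_eq ?_)
        rw [hN]
        norm_num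
      exact Real.sqrt_le_iff.2 ⟨by positivity, h1⟩
    have hqp : √(q fun i => (p i : ℝ)) ≤ 5 / 2 * √N := by
      have h1 := sqrt_q_add_le w (fun i => (-1) * e i)
      have h2 : (fun i => w i + (-1) * e i) = fun i => (p i : ℝ) := by
        funext i; simp [he]
      have h3 : (q fun i => (-1) * e i) = q e := by rw [q_smul]; norm_num
      rw [h2, h3, hqw] at h1
      linarith
    have hpm : p ∈ latt ι (25 / 4 * N) := by
      rw [mem_latt]
      have h1 := pow_le_pow_left₀ (Real.sqrt_nonneg _) hqp 2
      rw [Real.sq_sqrt (q_nonneg _), mul_pow, Real.sq_sqrt hN0] at h1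
      linarith
    have hDp : √(q (im D fun i => (p i : ℝ))) ≤ 16 * N := by
      have h1 := h p hpm
      have h2 := mem_latt.1 hpm
      refine Real.sqrt_le_iff.2 ⟨by positivity, h1.trans ?_⟩
      nlinarith [mul_le_mul_of_nonneg_left h2 (by positivity : 0 ≤ 40 * N)]
    have hDw : √(q (im D w)) ≤ 16 * N + A * (√N / 2) := by
      have h1 := sqrt_q_add_le (im D fun i => (p i : ℝ)) (im D e)
      rw [← im_add] at h1
      have h2 : (fun i => (p i : ℝ) + e i) = w := by
        funext i; simp [he]
      rw [h2] at h1
      have h3 := (hAS e).trans (mul_le_mul_of_nonneg_left hqe hA0)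
      linarith
    have hDw' : √(q (im D w)) = c * √(q (im D y)) := by
      rw [hw, im_smul, q_smul, Real.sqrt_mul (sq_nonneg _), Real.sqrt_sq hc0.le]
    rw [hDw', hc] at hDw
    have h4 : √(q (im D y)) = (√(q y) / (2 * √N)) * (2 * √N / √(q y) * √(q (im D y))) := by
      field_simp
    rw [h4]
    refine (mul_le_mul_of_nonneg_left hDw (by positivity)).trans (le_of_eq ?_)
    have h5 : N = √N * √N := (Real.mul_self_sqrt hN0).symm
    have h6 : 16 * N + A * (√N / 2) = (2 * √N) * (8 * √N + A / 4) := by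
      linear_combination 16 * h5
    rw [h6]
    field_simp
  have hle := csInf_le hbdd hstep
  rw [← hA] at hle
  intro y
  have h1 : A ≤ 32 / 3 * √N := by linarith
  have h2 := (hAS y).trans (mul_le_mul_of_nonneg_right h1 (Real.sqrt_nonneg _))
  have h3 := pow_le_pow_left₀ (Real.sqrt_nonneg _) h2 2
  rw [Real.sq_sqrt (q_nonneg _), mul_pow, mul_pow, Real.sq_sqrt hN0, Real.sq_sqrt (q_nonneg _)] at h3
  have := mul_nonneg hN0 (q_nonneg y)
  nlinarith

lemma pr_not_opBd (hκ : Fintype.card κ ≤ 2 * Fintype.card ι) :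
    pr (fun D : κ → ι → Bool => ¬ OpBd D) ≤ Real.exp (-Fintype.card ι) := by
  set N : ℝ := (Fintype.card ι : ℝ) with hN
  have hN0 : 0 ≤ N := Nat.cast_nonneg _
  calc _ ≤ pr (fun D : κ → ι → Bool => ∃ p ∈ latt ι (25 / 4 * Fintype.card ι),
        40 * N * (q fun i => (p i : ℝ)) < q (im D fun i => (p i : ℝ))) := by
        refine pr_mono fun D h => ?_
        by_contra! h2
        exact h (opBd_of_latt D h2)
    _ ≤ ∑ p ∈ latt ι (25 / 4 * Fintype.card ι), √2 ^ Fintype.card κ * Real.exp (-(10 * N)) :=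
        (pr_exists_le _ _).trans (sum_le_sum fun p _ => pr_im_large _ _)
    _ ≤ (Real.exp (1 * (25 / 4 * N)) * (Real.exp 1) ^ Fintype.card ι) *
          (Real.exp 1 ^ Fintype.card ι * Real.exp (-(10 * N))) := by
        rw [sum_const, nsmul_eq_mul]
        refine mul_le_mul ((card_latt_le one_pos _).trans ?_) (mul_le_mul_of_nonneg_right ?_ ?_)
          (by positivity) (by positivity)
        · refine mul_le_mul_of_nonneg_left (pow_le_pow_left₀ ?_ ?_ _) (Real.exp_pos _).le
          · have := Real.exp_one_gt_d9
            have : 0 < Real.exp 1 - 1 := by linarith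
            positivity
          · have h1 := Real.exp_one_gt_d9
            have : 2 / (Real.exp 1 - 1) ≤ 1.5 := by
              rw [div_le_iff₀ (by linarith)]; linarith
            linarith
        · refine (pow_le_pow_right₀ (Real.one_le_sqrt.2 one_le_two) hκ).trans ?_
          rw [pow_mul, Real.sq_sqrt zero_le_two]
          exact pow_le_pow_left₀ zero_le_two (by linarith [Real.exp_one_gt_d9]) _
        · exact (Real.exp_pos _).le
    _ ≤ _ := by
        rw [← Real.exp_nat_mul, ← Real.exp_add, ← Real.exp_add, ← Real.exp_add, Real.exp_le_exp]
        rw [← hN]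
        linarith

lemma ev_exp_neg_dot_sq {y : ι → ℝ} (hy : q y = 1) :
    ev (fun X => Real.exp (-(1 / 4) * dot X y ^ 2)) ≤ 7 / 8 := by
  have hcosh : ∀ x : ℝ, x ^ 4 ≤ 24 * (Real.cosh x - 1 - x ^ 2 / 2) := by
    intro x
    have h := sum_le_hasSum (range 3) (fun n _ => by
      rw [pow_mul]; positivity) (Real.hasSum_cosh x)
    simp only [sum_range_succ, range_zero, sum_empty] at h
    norm_num [Nat.factorial] at h
    linarith
  have hexp : ∀ u : ℝ, 0 ≤ u → Real.exp (-u) ≤ 1 - u + u ^ 2 / 2 := by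
    intro u hu
    have h1 := Real.quadratic_le_exp_of_nonneg hu
    rw [Real.exp_neg, inv_le_comm₀ (Real.exp_pos _) (by nlinarith [sq_nonneg (u - 1)])]
    refine le_trans ?_ h1
    rw [inv_le_iff_one_le_mul₀ (by nlinarith [sq_nonneg (u - 1)])]
    nlinarith [sq_nonneg (u ^ 2)]
  have hpt : ∀ X : ι → Bool, Real.exp (-(1 / 4) * dot X y ^ 2) ≤
      1 / 4 - 5 / 8 * dot X y ^ 2 + 3 / 8 * (Real.exp (dot X y) + Real.exp (dot X fun i => (-1) * y i)) := by
    intro X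
    have h1 := hexp (dot X y ^ 2 / 4) (by positivity)
    have h2 := hcosh (dot X y)
    rw [Real.cosh_eq] at h2
    rw [dot_smul]
    have h3 : -(1 / 4) * dot X y ^ 2 = -(dot X y ^ 2 / 4) := by ring
    have h4 : (-1) * dot X y = -dot X y := by ring
    rw [h3, h4]
    nlinarith
  have hy' : q (fun i => (-1) * y i) = 1 := by rw [q_smul, hy]; norm_num
  have h1 := ev_exp_dot_le y
  have h2 := ev_exp_dot_le fun i => (-1) * y i
  rw [hy] at h1
  rw [hy'] at h2
  have h3 : Real.exp (1 / 2) ≤ 1.65 := by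
    have : Real.exp (1 / 2) ^ 2 ≤ 1.65 ^ 2 := by
      rw [← Real.exp_nat_mul]
      norm_num
      linarith [Real.exp_one_lt_d9]
    exact le_of_sq_le_sq this (by norm_num)
  refine (ev_mono hpt).trans ?_
  rw [ev_add, ev_sub, ev_const_mul, ev_const_mul, ev_add, ev_const, ev_dot_sq, hy]
  linarith

lemma pr_im_small {y : ι → ℝ} (hy : y ≠ 0) (N : ℝ) :
    pr (fun D : κ → ι → Bool => q (im D y) < N * q y / 25) ≤
      (7 / 8) ^ Fintype.card κ * Real.exp (N / 100) := by
  obtain ⟨u, hu, hd⟩ := exists_unit_smul hy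
  have hq : 0 < q y := lt_of_le_of_ne (q_nonneg y) fun h => hy (q_eq_zero.1 h.symm)
  calc _ ≤ ev (fun D : κ → ι → Bool =>
          Real.exp (∑ k, -(1 / 4) * dot (D k) u ^ 2) * Real.exp (N / 100)) := by
        refine pr_le_ev (fun D => by positivity) fun D h => ?_
        rw [← Real.exp_add, Real.one_le_exp_iff, ← mul_sum]
        have : q (im D y) = q y * ∑ k, dot (D k) u ^ 2 := by
          rw [mul_sum]; exact sum_congr rfl fun k _ => hd _
        rw [this, mul_comm N, mul_div_assoc] at h
        have := lt_of_mul_lt_mul_left h hq.le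
        linarith
    _ ≤ _ := by
        rw [ev_mul_const, ev_exp_sum_pi]
        exact mul_le_mul_of_nonneg_right (pow_le_pow_left₀ (ev_nonneg fun X => by positivity)
          (ev_exp_neg_dot_sq hu) _) (Real.exp_pos _).le

/-- No short nonzero integer vector is nearly annihilated. -/
def SmBd (D : κ → ι → Bool) : Prop :=
  ∀ p : ι → ℤ, p ≠ 0 → q (fun i => (p i : ℝ)) ≤ Fintype.card ι / 400 →
    Fintype.card ι * q (fun i => (p i : ℝ)) / 25 ≤ q (im D fun i => (p i : ℝ))

lemma pr_not_smBd (hκ : Fintype.card ι ≤ 2 * Fintype.card κ) :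
    pr (fun D : κ → ι → Bool => ¬ SmBd D) ≤ Real.exp (-(Fintype.card ι / 50)) := by
  set N : ℝ := (Fintype.card ι : ℝ) with hN
  have hN0 : 0 ≤ N := Nat.cast_nonneg _
  have hκ' : N ≤ 2 * Fintype.card κ := by rw [hN]; exact_mod_cast hκ
  calc _ ≤ pr (fun D : κ → ι → Bool => ∃ p ∈ (latt ι (N / 400)).filter (· ≠ 0),
        q (im D fun i => (p i : ℝ)) < N * (q fun i => (p i : ℝ)) / 25) := by
        refine pr_mono fun D h => ?_
        by_contra! h2
        exact h fun p hp hq => h2 p (mem_filter.2 ⟨mem_latt.2 hq, hp⟩)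
    _ ≤ ∑ p ∈ (latt ι (N / 400)).filter (· ≠ 0),
          (7 / 8) ^ Fintype.card κ * Real.exp (N / 100) :=
        (pr_exists_le _ _).trans (sum_le_sum fun p hp => pr_im_small (fun h => by
          refine (mem_filter.1 hp).2 (funext fun i => ?_)
          have := congrFun h i
          simpa using this) _)
    _ ≤ (Real.exp (6 * (N / 400)) * Real.exp (1 / 200) ^ Fintype.card ι) *
          (Real.exp (-(1 / 8)) ^ Fintype.card κ * Real.exp (N / 100)) := by
        rw [sum_const, nsmul_eq_mul]
        refine mul_le_mul (le_trans (Nat.cast_le.2 (card_filter_le _ _))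
          ((card_latt_le (β := 6) (by norm_num) _).trans ?_))
          (mul_le_mul_of_nonneg_right ?_ ?_) (by positivity) (by positivity)
        · have h6 : 401 ≤ Real.exp 6 := by
            have : Real.exp 6 = Real.exp 1 ^ 6 := by
              rw [← Real.exp_nat_mul]; norm_num
            rw [this]
            have := pow_le_pow_left₀ (by norm_num) Real.exp_one_gt_d9.le 6
            refine le_trans ?_ this
            norm_num
          refine mul_le_mul_of_nonneg_left (pow_le_pow_left₀ ?_ ?_ _) (Real.exp_pos _).le
          · have : 0 < Real.exp 6 - 1 := by linarith
            positivity
          · have h1 : 2 / (Real.exp 6 - 1) ≤ 1 / 200 := by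
              rw [div_le_iff₀ (by linarith)]; linarith
            linarith [Real.add_one_le_exp (1 / 200)]
        · exact pow_le_pow_left₀ (by norm_num) (by linarith [Real.add_one_le_exp (-(1 / 8))]) _
        · exact (Real.exp_pos _).le
    _ ≤ _ := by
        rw [← Real.exp_nat_mul, ← Real.exp_nat_mul, ← Real.exp_add, ← Real.exp_add, ← Real.exp_add,
          Real.exp_le_exp, ← hN]
        linarith

lemma q_sub_le (x y : ι → ℝ) : q (fun i => x i - y i) ≤ 2 * q x + 2 * q y := by
  have := q_add_le x (fun i => (-1) * y i)
  rw [q_smul] at this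
  norm_num [← sub_eq_add_neg] at this
  exact this

/-- The distance-to-lattice constant. -/
noncomputable def gam : ℝ := 1 / 50000

lemma gam_pos : 0 < gam := by norm_num [gam]

/-- Almost annihilated short vectors are far from the lattice. -/
lemma nz_ge_of_small {D : κ → ι → Bool} (h1 : OpBd D) (h2 : SmBd D) {y : ι → ℝ}
    (hy : q (im D y) ≤ gam * Fintype.card ι * q y) (hq : q y ≤ Fintype.card ι / 1000) :
    gam * q y ≤ nz y := by
  by_contra! hlt
  set N : ℝ := (Fintype.card ι : ℝ) with hN
  have hN0 : 0 ≤ N := Nat.cast_nonneg _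
  set p : ι → ℤ := fun i => round (y i) with hp
  set e : ι → ℝ := fun i => y i - p i with he
  have hqe : q e < gam * q y := hlt
  have hq0 : 0 < q y := by
    by_contra! h
    have := nz_nonneg y
    have h3 : q y = 0 := le_antisymm h (q_nonneg y)
    rw [h3, mul_zero] at hlt
    linarith
  have hpe : (fun i => y i - e i) = fun i => (p i : ℝ) := by funext i; simp [he]
  have hpe' : (fun i => (p i : ℝ) + e i) = y := by funext i; simp [he]
  have hqp := q_sub_le y e
  rw [hpe] at hqp
  have hqy := q_add_le (fun i => (p i : ℝ)) e
  rw [hpe'] at hqy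
  have hp0 : p ≠ 0 := by
    intro h0
    have : e = y := by funext i; simp [he, h0]
    rw [this, gam] at hqe
    linarith
  have h3 := h2 p hp0 (by rw [gam] at hqe; rw [← hN]; linarith)
  have h4 : q (im D fun i => (p i : ℝ)) ≤ 2 * q (im D y) + 2 * q (im D e) := by
    have := q_sub_le (im D y) (im D e)
    have h5 : im D (fun i => y i - e i) = fun k => im D y k - im D e k := by
      funext k; exact dot_sub _ _ _
    rwa [← h5, hpe] at this
  have h6 := h1 e
  rw [← hN] at h3 h6
  rw [gam] at hqe hy
  have hNpos : 0 < N := by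
    by_contra! h
    have : N = 0 := le_antisymm h hN0
    rw [this] at hq
    linarith
  have h7 := mul_lt_mul_of_pos_left hqe hNpos
  have h8 := mul_le_mul_of_nonneg_left hqy hN0
  have h9 := mul_pos hNpos hq0
  nlinarith

end Concentration

end LSV

namespace LSV

open Finset MeasureTheory

section Structure

variable {ι κ : Type*} [Fintype ι] [DecidableEq ι] [Fintype κ] [DecidableEq κ]

lemma tilted_small_ball_one {z0 : ι → ℝ} (hz : q z0 ≤ 1) (z : ι → ℝ) {b : ℝ} (hb : 0 < b)
    {B Ξ : ℝ} (h : ∀ x : ℝ, x ^ 2 ≤ Ξ → min (b * x ^ 2) B ≤ nz (fun i => x * z i / Real.pi)) :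
    ev (fun X : ι → Bool => Real.exp (dot X z0) * Real.exp (-(dot X z ^ 2) / 2)) ≤
      2 * ((√b)⁻¹ + Real.exp (-(B / 2)) + √2 * Real.exp (-(Ξ / 4))) := by
  have := tilted_small_ball hz (fun _ : Fin 1 => z) (fun _ => hb) (B := B) (Ξ := Ξ) fun ξ hξ => by
    simpa [comb] using h (ξ 0) (by simpa [q] using hξ)
  simpa using this

/-- No vector of the kernel of moderate length is close to the integer lattice. -/
def Good (α c : ℝ) (D : κ → ι → Bool) : Prop :=
  ∀ y, im D y = 0 → q y ≤ Real.exp (c * Fintype.card ι) →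
    min (gam * q y) (α * Fintype.card ι) ≤ nz y

/-- The arithmetic constant. -/
noncomputable def sal : ℝ := (1 / 20000) ^ 2 / 128000

lemma sal_pos : 0 < sal := by norm_num [sal]

lemma pr_lattice_point {p : ι → ℤ} {N M : ℝ} (hN : 0 < N) (hM : 0 < M)
    (hMN : M * (27 : ℝ) ≤
      (32000 * sal) ^ 2 * N * Real.exp (sal ^ 2 * N / 10))
    (hp : ∀ t : ℝ, |t| ≤ 1 / 2 →
      1 / 10 * min (gam * t ^ 2 * M) (sal ^ 2 * N) ≤ nz fun i => t * p i) :
    pr (fun D : κ → ι → Bool => q (im D fun i => (p i : ℝ)) ≤ 200 * N * (sal ^ 2 * N)) ≤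
      Real.exp (N / 2) * (128000 * sal * √(N / M)) ^ Fintype.card κ := by
  have hs := sal_pos
  have hpi := Real.pi_pos
  have hpi3 := Real.pi_gt_three
  have hpi4 : Real.pi ^ 2 ≤ 10 := by nlinarith [Real.pi_lt_d2]
  set T : ℝ := √(200 * (sal ^ 2 * N)) with hT
  have hT2 : T ^ 2 = 200 * (sal ^ 2 * N) := Real.sq_sqrt (by positivity)
  have hT0 : 0 < T := Real.sqrt_pos.2 (by positivity)
  set b : ℝ := 1 / 10 * gam * M / (T ^ 2 * Real.pi ^ 2) with hb
  have hg := gam_pos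
  have hb0 : 0 < b := by positivity
  set S := √(N / M) with hS
  have hS0 : 0 < S := Real.sqrt_pos.2 (by positivity)
  have hS2 : S ^ 2 = N / M := Real.sq_sqrt (by positivity)
  have hbS : (√b)⁻¹ ≤ 32000 * sal * S := by
    rw [← Real.sqrt_inv]
    refine Real.sqrt_le_iff.2 ⟨by positivity, ?_⟩
    rw [mul_pow, hS2, hb, hT2, inv_div, div_le_iff₀ (by positivity)]
    have : (32000 * sal) ^ 2 * (N / M) * (1 / 10 * gam * M) = 2048 * sal ^ 2 * N := by
      rw [gam]; field_simp; norm_num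
    rw [this]
    have := mul_le_mul_of_nonneg_left hpi4 (by positivity : 0 ≤ 200 * (sal ^ 2 * N))
    nlinarith [mul_pos (pow_pos hs 2) hN]
  have hexp : 3 * Real.exp (-(sal ^ 2 * N / 20)) ≤ 32000 * sal * S := by
    have h1 : (3 * Real.exp (-(sal ^ 2 * N / 20))) ^ 2 ≤ (32000 * sal * S) ^ 2 := by
      rw [mul_pow, mul_pow _ S, hS2, ← Real.exp_nat_mul]
      have h2 : ((2 : ℕ) : ℝ) * -(sal ^ 2 * N / 20) = -(sal ^ 2 * N / 10) := by push_cast; ring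
      rw [h2, Real.exp_neg, ← div_eq_mul_inv, mul_div_assoc', div_le_div_iff₀ (Real.exp_pos _) hM]
      nlinarith
    exact le_of_sq_le_sq h1 (by positivity)
  have hball := tilted_small_ball_one (z0 := (0 : ι → ℝ)) (by simp [q]) (fun i => p i / T)
    hb0 (B := 1 / 10 * (sal ^ 2 * N)) (Ξ := T ^ 2) fun x hx => by
      have habs : |x| ≤ T := by
        rw [← abs_of_pos hT0]; exact sq_le_sq.1 hx
      have ht : |x / (T * Real.pi)| ≤ 1 / 2 := by
        rw [abs_div, abs_of_pos (by positivity : 0 < T * Real.pi), div_le_iff₀ (by positivity)]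
        nlinarith
      have h1 := hp _ ht
      have h2 : (fun i => x / (T * Real.pi) * (p i : ℝ)) = fun i => x * (p i / T) / Real.pi := by
        funext i; field_simp
      rw [h2, mul_min_of_nonneg _ _ (by norm_num : (0 : ℝ) ≤ 1 / 10)] at h1
      refine le_trans (le_of_eq ?_) h1
      congr 1
      rw [hb]
      field_simp
  have hone : ev (fun X : ι → Bool => Real.exp (-(1 / (2 * T ^ 2)) * dot X (fun i => (p i : ℝ)) ^ 2))
      ≤ 128000 * sal * S := by
    have h1 : ∀ X : ι → Bool, Real.exp (-(1 / (2 * T ^ 2)) * dot X (fun i => (p i : ℝ)) ^ 2) =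
        Real.exp (dot X (0 : ι → ℝ)) * Real.exp (-(dot X fun i => p i / T) ^ 2 / 2) := by
      intro X
      have h2 : dot X (fun i => (p i : ℝ) / T) = T⁻¹ * dot X (fun i => (p i : ℝ)) := by
        rw [← dot_smul]; congr 1; funext i; rw [div_eq_inv_mul]
      have h3 : dot X (0 : ι → ℝ) = 0 := by simp [dot]
      rw [h2, h3, Real.exp_zero, one_mul]
      congr 1
      field_simp
    simp only [h1]
    refine hball.trans ?_
    have h2 : √2 ≤ 2 := Real.sqrt_le_iff.2 ⟨by norm_num, by norm_num⟩
    have h3 : Real.exp (-(T ^ 2 / 4)) ≤ Real.exp (-(sal ^ 2 * N / 20)) := by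
      rw [Real.exp_le_exp, hT2]
      nlinarith [mul_pos (pow_pos hs 2) hN]
    have h4 : -(1 / 10 * (sal ^ 2 * N) / 2) = -(sal ^ 2 * N / 20) := by ring
    rw [h4]
    have h5 := mul_le_mul h2 h3 (Real.exp_pos _).le zero_le_two
    linarith
  calc _ ≤ ev (fun D : κ → ι → Bool => Real.exp (N / 2) * Real.exp (∑ k,
          -(1 / (2 * T ^ 2)) * dot (D k) (fun i => (p i : ℝ)) ^ 2)) := by
        refine pr_le_ev (fun D => by positivity) fun D h => ?_
        rw [← Real.exp_add, Real.one_le_exp_iff, ← mul_sum]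
        have h1 : q (im D fun i => (p i : ℝ)) = ∑ k, dot (D k) (fun i => (p i : ℝ)) ^ 2 := rfl
        rw [← h1]
        have h2 : 1 / (2 * T ^ 2) * q (im D fun i => (p i : ℝ)) ≤ N / 2 := by
          rw [one_div_mul_eq_div, div_le_iff₀ (by positivity), hT2]
          linarith
        linarith
    _ ≤ _ := by
        rw [ev_const_mul, ev_exp_sum_pi]
        exact mul_le_mul_of_nonneg_left (pow_le_pow_left₀ (ev_nonneg fun X => by positivity)
          hone _) (Real.exp_pos _).le

lemma nz_smul_le (t : ℝ) (y : ι → ℝ) (p : ι → ℤ) :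
    nz (fun i => t * y i) ≤
      2 * nz (fun i => t * p i) + 2 * (t ^ 2 * q fun i => y i - p i) := by
  refine (nz_le_of_int _ (fun i => round (t * p i))).trans ?_
  have h := q_add_le (fun i => t * p i - round (t * p i)) (fun i => t * (y i - p i))
  rw [q_smul] at h
  refine le_trans (le_of_eq ?_) h
  congr 1
  funext i
  ring

/-- A bad kernel vector yields a structured integer vector that is almost annihilated. -/
lemma exists_structured {D : κ → ι → Bool} (h1 : OpBd D) (h2 : SmBd D) {c : ℝ}
    (hbad : ¬ Good (sal ^ 2) c D) :
    ∃ p : ι → ℤ, (Fintype.card ι : ℝ) / 2100 ≤ q (fun i => (p i : ℝ)) ∧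
      q (fun i => (p i : ℝ)) ≤ 3 * Real.exp (c * Fintype.card ι) ∧
      (∀ t : ℝ, |t| ≤ 1 / 2 → 1 / 10 * min (gam * t ^ 2 * q (fun i => (p i : ℝ)))
        (sal ^ 2 * Fintype.card ι) ≤ nz fun i => t * p i) ∧
      q (im D fun i => (p i : ℝ)) ≤ 200 * Fintype.card ι * (sal ^ 2 * Fintype.card ι) := by
  set N : ℝ := (Fintype.card ι : ℝ) with hN
  have hN0 : 0 ≤ N := Nat.cast_nonneg _
  have hg := gam_pos
  have hα0 : 0 < sal ^ 2 := pow_pos sal_pos 2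
  have hα : sal ^ 2 ≤ gam / 8000 := by norm_num [sal, gam]
  set α := sal ^ 2
  let Bad : Set (ι → ℝ) := {y | im D y = 0 ∧ q y ≤ Real.exp (c * N) ∧ nz y < min (gam * q y) (α * N)}
  have hBig : ∀ y ∈ Bad, N / 1000 < q y := by
    rintro y ⟨hy1, -, hy3⟩
    by_contra! h
    refine absurd (nz_ge_of_small h1 h2 ?_ h) (not_le.2 (hy3.trans_le (min_le_left _ _)))
    rw [hy1]
    have : q (0 : κ → ℝ) = 0 := q_eq_zero.2 rfl
    rw [this]
    have := q_nonneg y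
    positivity
  obtain ⟨y0, hy0⟩ : Bad.Nonempty := by
    unfold Good at hbad
    push Not at hbad
    obtain ⟨y, hy⟩ := hbad
    exact ⟨y, hy⟩
  have hNpos : 0 < N := by
    have h3 := hy0.2.2.trans_le (min_le_right _ _)
    have h4 := (nz_nonneg y0).trans_lt h3
    exact pos_of_mul_pos_right h4 hα0.le
  set m := sInf (q '' Bad) with hm
  have hne : (q '' Bad).Nonempty := ⟨_, y0, hy0, rfl⟩
  have hmpos : 0 < m := by
    refine lt_of_lt_of_le (by positivity : 0 < N / 1000) (le_csInf hne ?_)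
    rintro _ ⟨y, hy, rfl⟩
    exact (hBig y hy).le
  obtain ⟨_, ⟨y, hy, rfl⟩, hym⟩ := exists_lt_of_csInf_lt hne (show m < 4 * m by linarith)
  have hbdd : BddBelow (q '' Bad) := ⟨0, by rintro _ ⟨y, _, rfl⟩; exact q_nonneg y⟩
  have hsmall : ∀ t : ℝ, |t| ≤ 1 / 2 → min (gam * (t ^ 2 * q y)) (α * N) ≤ nz fun i => t * y i := by
    intro t ht
    by_contra! hlt
    have ht2 : t ^ 2 ≤ 1 / 4 := by
      have := pow_le_pow_left₀ (abs_nonneg t) ht 2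
      rw [sq_abs] at this
      linarith
    have hq' : q (fun i => t * y i) = t ^ 2 * q y := q_smul t y
    have hqy := q_nonneg y
    have hmem : (fun i => t * y i) ∈ Bad := by
      refine ⟨?_, ?_, ?_⟩
      · rw [im_smul, hy.1]; funext k; simp
      · rw [hq']
        refine le_trans ?_ hy.2.1
        nlinarith
      · rw [hq']; exact hlt
    have := csInf_le hbdd ⟨_, hmem, rfl⟩
    rw [hq', ← hm] at this
    nlinarith
  set p : ι → ℤ := fun i => round (y i) with hp
  set e : ι → ℝ := fun i => y i - p i with he
  have hqe : q e < min (gam * q y) (α * N) := hy.2.2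
  have hqe1 := hqe.trans_le (min_le_left _ _)
  have hqe2 := hqe.trans_le (min_le_right _ _)
  have hyN := hBig y hy
  have hpe : (fun i => y i - e i) = fun i => (p i : ℝ) := by funext i; simp [he]
  have hpe' : (fun i => (p i : ℝ) + e i) = y := by funext i; simp [he]
  have hqp := q_sub_le y e
  rw [hpe] at hqp
  have hqy := q_add_le (fun i => (p i : ℝ)) e
  rw [hpe'] at hqy
  have hqp' : q (fun i => (p i : ℝ)) ≤ 5 / 2 * q y := by
    rw [gam] at hqe1; linarith
  have hqy0 := q_nonneg y
  refine ⟨p, ?_, ?_, ?_, ?_⟩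
  · rw [gam] at hqe1; linarith
  · have := hy.2.1
    linarith [Real.exp_pos (c * N)]
  · intro t ht
    have h3 := (hsmall t ht).trans (nz_smul_le t y p)
    have ht2 : t ^ 2 ≤ 1 / 4 := by
      have := pow_le_pow_left₀ (abs_nonneg t) ht 2
      rw [sq_abs] at this
      linarith
    have ht0 := sq_nonneg t
    have h4 : 2 * (t ^ 2 * q e) ≤ 1 / 2 * min (gam * (t ^ 2 * q y)) (α * N) := by
      rw [mul_min_of_nonneg _ _ (by norm_num : (0 : ℝ) ≤ 1 / 2)]
      refine le_min ?_ ?_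
      · have h5 : q e ≤ gam * q y / 4 := by
          have := mul_le_mul_of_nonneg_right hα hN0
          nlinarith
        have := mul_le_mul_of_nonneg_left h5 ht0
        linarith
      · have := mul_le_mul ht2 hqe2.le (q_nonneg e) (by norm_num)
        linarith
    have h6 : 1 / 10 * min (gam * t ^ 2 * q (fun i => (p i : ℝ))) (α * N) ≤
        1 / 4 * min (gam * (t ^ 2 * q y)) (α * N) := by
      rw [mul_min_of_nonneg _ _ (by norm_num : (0 : ℝ) ≤ 1 / 10),
        mul_min_of_nonneg _ _ (by norm_num : (0 : ℝ) ≤ 1 / 4)]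
      refine min_le_min ?_ (by nlinarith)
      have := mul_le_mul_of_nonneg_left hqp' (by positivity : 0 ≤ gam * t ^ 2)
      linarith
    have h7 : (q fun i => y i - (p i : ℝ)) = q e := rfl
    rw [h7] at h3
    linarith
  · have h3 : q (im D fun i => (p i : ℝ)) = q (im D e) := by
      have : im D (fun i => (p i : ℝ)) = fun k => (-1) * im D e k := by
        rw [← hpe]
        funext k
        have h4 : im D (fun i => y i - e i) k = im D y k - im D e k := dot_sub _ _ _
        rw [h4, hy.1]
        simp
      rw [this, q_smul]
      norm_num
    rw [h3]
    exact (h1 e).trans (mul_le_mul_of_nonneg_left hqe2.le (by positivity))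

/-- The conjunction of the typical properties of a sign matrix. -/
def Nice (c : ℝ) (D : κ → ι → Bool) : Prop := OpBd D ∧ SmBd D ∧ Good (sal ^ 2) c D

lemma pr_structured_le {r : ℕ} (hcard : Fintype.card κ + r = Fintype.card ι)
    (hr : 2 * r ≤ Fintype.card ι) (hι : 0 < Fintype.card ι) {c : ℝ} (hc : c ≤ sal ^ 2 / 10)
    (hbig : 81 ≤ (32000 * sal) ^ 2 * (Fintype.card ι : ℝ)) (M : ℕ)
    (hM : (M : ℝ) ≤ 3 * Real.exp (c * Fintype.card ι)) :
    pr (fun D : κ → ι → Bool => ∃ p : ι → ℤ, q (fun i => (p i : ℝ)) = M ∧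
      (Fintype.card ι : ℝ) / 2100 ≤ q (fun i => (p i : ℝ)) ∧
      (∀ t : ℝ, |t| ≤ 1 / 2 → 1 / 10 * min (gam * t ^ 2 * q (fun i => (p i : ℝ)))
        (sal ^ 2 * Fintype.card ι) ≤ nz fun i => t * p i) ∧
      q (im D fun i => (p i : ℝ)) ≤ 200 * Fintype.card ι * (sal ^ 2 * Fintype.card ι)) ≤
      Real.exp (-3 * Fintype.card ι) * (3 * Real.exp (c * Fintype.card ι)) ^ r := by
  classical
  set N : ℝ := (Fintype.card ι : ℝ) with hN
  have hN1 : 1 ≤ N := by rw [hN]; exact_mod_cast hι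
  have hN0 : 0 < N := by linarith
  by_cases hM2 : N / 2100 ≤ M
  swap
  · refine (pr_mono (Q := fun _ => False) ?_).trans (le_trans (le_of_eq (by simp [pr, ev]))
      (by positivity : (0 : ℝ) ≤ _))
    rintro D ⟨p, h1, h2, -⟩
    exact hM2 (h1 ▸ h2)
  have hM0 : (0 : ℝ) < M := lt_of_lt_of_le (by positivity) hM2
  have hM1 : (1 : ℝ) ≤ M := by
    have : 0 < M := by exact_mod_cast hM0
    exact_mod_cast this
  set F := (latt ι (M : ℝ)).filter fun p => ∀ t : ℝ, |t| ≤ 1 / 2 →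
    1 / 10 * min (gam * t ^ 2 * M) (sal ^ 2 * N) ≤ nz fun i => t * p i with hF
  have hMN : (M : ℝ) * 27 ≤ (32000 * sal) ^ 2 * N * Real.exp (sal ^ 2 * N / 10) := by
    have h1 : Real.exp (c * N) ≤ Real.exp (sal ^ 2 * N / 10) := by
      rw [Real.exp_le_exp]; nlinarith
    have h2 := Real.exp_pos (sal ^ 2 * N / 10)
    nlinarith
  set S := √(N / M) with hS
  have hS0 : 0 < S := Real.sqrt_pos.2 (by positivity)
  have hS2 : S ^ 2 = N / M := Real.sq_sqrt (by positivity)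
  have hS46 : S ≤ 46 := by
    refine Real.sqrt_le_iff.2 ⟨by norm_num, ?_⟩
    rw [div_le_iff₀ hM0]
    linarith
  have hSM : S⁻¹ ≤ M := by
    rw [inv_le_comm₀ hS0 hM0]
    refine Real.le_sqrt_of_sq_le ?_
    rw [inv_pow, ← one_div, div_le_div_iff₀ (by positivity) hM0]
    nlinarith
  have hcardF : (F.card : ℝ) ≤ Real.exp N * (Real.exp 1 * (48 / S)) ^ Fintype.card ι := by
    refine (Nat.cast_le.2 (card_filter_le _ _)).trans
      ((card_latt_le' (β := N / M) (by positivity) _).trans ?_)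
    rw [div_mul_cancel₀ _ hM0.ne', ← hS]
    refine mul_le_mul_of_nonneg_left (pow_le_pow_left₀ (by positivity) (mul_le_mul_of_nonneg_left
      ?_ (Real.exp_pos _).le) _) (Real.exp_pos _).le
    rw [le_div_iff₀ hS0, add_mul, div_mul_cancel₀ _ hS0.ne']
    linarith
  calc _ ≤ pr (fun D : κ → ι → Bool => ∃ p ∈ F,
        q (im D fun i => (p i : ℝ)) ≤ 200 * N * (sal ^ 2 * N)) := by
        refine pr_mono ?_
        rintro D ⟨p, h1, h2, h3, h4⟩
        refine ⟨p, mem_filter.2 ⟨mem_latt.2 h1.le, ?_⟩, h4⟩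
        rwa [h1] at h3
    _ ≤ ∑ p ∈ F, Real.exp (N / 2) * (128000 * sal * S) ^ Fintype.card κ :=
        (pr_exists_le _ _).trans (sum_le_sum fun p hp =>
          pr_lattice_point hN0 hM0 hMN (mem_filter.1 hp).2)
    _ ≤ (Real.exp N * (Real.exp 1 * (48 / S)) ^ Fintype.card ι) *
          (Real.exp (N / 2) * (128000 * sal * S) ^ Fintype.card κ) := by
        rw [sum_const, nsmul_eq_mul]
        have := sal_pos
        exact mul_le_mul_of_nonneg_right hcardF (by positivity)
    _ = Real.exp (5 / 2 * N) * 48 ^ Fintype.card ι * ((1 / 20000) ^ (2 * Fintype.card κ)) *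
          S⁻¹ ^ r := by
        have h1 : 128000 * sal = (1 / 20000) ^ 2 := by rw [sal]; ring
        have h2 : Real.exp (5 / 2 * N) = Real.exp N * Real.exp (N / 2) * Real.exp 1 ^ Fintype.card ι := by
          rw [← Real.exp_nat_mul, ← Real.exp_add, ← Real.exp_add, ← hN]
          congr 1; ring
        have h3 : S ^ Fintype.card ι = S ^ Fintype.card κ * S ^ r := by rw [← hcard, pow_add]
        rw [h1, h2, mul_pow, div_pow, mul_pow, ← pow_mul, h3, inv_pow]
        field_simp
    _ ≤ Real.exp (5 / 2 * N) * 48 ^ Fintype.card ι * ((1 / 20000) ^ (Fintype.card ι)) *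
          (3 * Real.exp (c * N)) ^ r := by
        refine mul_le_mul (mul_le_mul_of_nonneg_left ?_ (by positivity))
          (pow_le_pow_left₀ (by positivity) (hSM.trans hM) _) (by positivity) (by positivity)
        exact pow_le_pow_of_le_one (by norm_num) (by norm_num) (by omega)
    _ ≤ _ := by
        refine mul_le_mul_of_nonneg_right ?_ (by positivity)
        have h1 : Real.exp (5 / 2 * N) = Real.exp (-3 * N) * Real.exp (11 / 2) ^ Fintype.card ι := by
          rw [← Real.exp_nat_mul, ← Real.exp_add, ← hN]
          congr 1; ring
        rw [h1, mul_assoc, mul_assoc, ← mul_pow, ← mul_pow]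
        refine mul_le_of_le_one_right (Real.exp_pos _).le (pow_le_one₀ (by positivity) ?_)
        have h2 : Real.exp (11 / 2) ≤ Real.exp 1 ^ 6 := by
          rw [← Real.exp_nat_mul, Real.exp_le_exp]; norm_num
        have h3 := pow_le_pow_left₀ (Real.exp_pos 1).le
          (Real.exp_one_lt_d9.le.trans (by norm_num : _ ≤ (2.72 : ℝ))) 6
        have h4 := h2.trans h3
        norm_num at h4 ⊢
        linarith

lemma q_int_eq_nat (p : ι → ℤ) : ∃ M : ℕ, q (fun i => (p i : ℝ)) = M := by
  refine ⟨∑ i, (p i).natAbs ^ 2, ?_⟩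
  simp only [q]
  push_cast
  refine sum_congr rfl fun i _ => ?_
  rw [Nat.cast_natAbs, Int.cast_abs, sq_abs]

theorem pr_not_nice (r : ℕ) : ∃ c : ℝ, 0 < c ∧ ∃ N0 : ℕ, ∀ (ι κ : Type) [Fintype ι] [DecidableEq ι]
    [Fintype κ] [DecidableEq κ], Fintype.card κ + r = Fintype.card ι → N0 ≤ Fintype.card ι →
    pr (fun D : κ → ι → Bool => ¬ Nice c D) ≤ Real.exp (-c * Fintype.card ι) := by
  have hs := sal_pos
  set c : ℝ := min (sal ^ 2 / 10) (min (1 / (r + 1)) (1 / 100)) with hc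
  have hc0 : 0 < c := by
    refine lt_min (by positivity) (lt_min (by positivity) (by norm_num))
  refine ⟨c, hc0, max (⌈81 / (32000 * sal) ^ 2⌉₊) (2 * r + 200), ?_⟩
  intro ι κ _ _ _ _ hcard hN0
  have hc1 : c ≤ sal ^ 2 / 10 := min_le_left _ _
  have hc2 : c * (r + 1) ≤ 1 := by
    rw [← le_div_iff₀ (by positivity)]
    exact (min_le_right _ _).trans (min_le_left _ _)
  have hc3 : c ≤ 1 / 100 := (min_le_right _ _).trans (min_le_right _ _)
  have hN2 : 2 * r + 200 ≤ Fintype.card ι := (le_max_right _ _).trans hN0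
  have hN1 : 81 ≤ (32000 * sal) ^ 2 * (Fintype.card ι : ℝ) := by
    rw [← div_le_iff₀' (by positivity)]
    exact (Nat.le_ceil _).trans (by exact_mod_cast (le_max_left _ _).trans hN0)
  have hN3 : (2 * r + 200 : ℝ) ≤ Fintype.card ι := by exact_mod_cast hN2
  have hunion : pr (fun D : κ → ι → Bool => OpBd D ∧ SmBd D ∧ ¬ Good (sal ^ 2) c D) ≤
      Real.exp (-(Fintype.card ι / 50)) := by
    set N : ℝ := (Fintype.card ι : ℝ) with hN
    calc _ ≤ pr (fun D : κ → ι → Bool => ∃ M ∈ range (⌊3 * Real.exp (c * N)⌋₊ + 1), ∃ p : ι → ℤ,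
          q (fun i => (p i : ℝ)) = M ∧ N / 2100 ≤ q (fun i => (p i : ℝ)) ∧
          (∀ t : ℝ, |t| ≤ 1 / 2 → 1 / 10 * min (gam * t ^ 2 * q (fun i => (p i : ℝ)))
            (sal ^ 2 * N) ≤ nz fun i => t * p i) ∧
          q (im D fun i => (p i : ℝ)) ≤ 200 * N * (sal ^ 2 * N)) := by
          refine pr_mono ?_
          rintro D ⟨h1, h2, h3⟩
          obtain ⟨p, hp1, hp2, hp3, hp4⟩ := exists_structured h1 h2 h3
          obtain ⟨M, hM⟩ := q_int_eq_nat p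
          refine ⟨M, ?_, p, hM, hp1, hp3, hp4⟩
          rw [mem_range, Nat.lt_succ_iff]
          exact Nat.le_floor (hM ▸ hp2)
      _ ≤ ∑ M ∈ range (⌊3 * Real.exp (c * N)⌋₊ + 1), Real.exp (-3 * N) * (3 * Real.exp (c * N)) ^ r := by
          refine (pr_exists_le _ _).trans (sum_le_sum fun M hM => ?_)
          refine pr_structured_le hcard (by omega) (by omega) hc1 hN1 M ?_
          rw [mem_range, Nat.lt_succ_iff] at hM
          exact (Nat.cast_le.2 hM).trans (Nat.floor_le (by positivity))
      _ ≤ (4 * Real.exp (c * N)) * (Real.exp (-3 * N) * (4 * Real.exp (c * N)) ^ r) := by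
          rw [sum_const, nsmul_eq_mul, card_range]
          refine mul_le_mul ?_ (mul_le_mul_of_nonneg_left (pow_le_pow_left₀ (by positivity) ?_ _)
            (Real.exp_pos _).le) (by positivity) (by positivity)
          · push_cast
            have h1 := Nat.floor_le (by positivity : 0 ≤ 3 * Real.exp (c * N))
            have h2 : 1 ≤ Real.exp (c * N) := Real.one_le_exp (by positivity)
            linarith
          · have := Real.exp_pos (c * N)
            linarith
      _ = 4 ^ (r + 1) * Real.exp (c * (r + 1) * N - 3 * N) := by
          have : Real.exp (c * (r + 1) * N - 3 * N) = Real.exp (c * N) ^ (r + 1) * Real.exp (-3 * N) := by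
            rw [← Real.exp_nat_mul, ← Real.exp_add]
            congr 1; push_cast; ring
          rw [this]
          ring
      _ ≤ Real.exp 2 ^ (r + 1) * Real.exp (1 * N - 3 * N) := by
          refine mul_le_mul (pow_le_pow_left₀ (by norm_num) ?_ _) (Real.exp_le_exp.2 ?_)
            (Real.exp_pos _).le (by positivity)
          · have h1 : Real.exp 2 = Real.exp 1 ^ 2 := by rw [← Real.exp_nat_mul]; norm_num
            rw [h1]
            nlinarith [Real.exp_one_gt_d9]
          · have : c * (r + 1) * N ≤ 1 * N := mul_le_mul_of_nonneg_right hc2 (by linarith)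
            linarith
      _ ≤ _ := by
          rw [← Real.exp_nat_mul, ← Real.exp_add, Real.exp_le_exp]
          push_cast
          linarith
  calc _ ≤ pr (fun D : κ → ι → Bool => ¬ OpBd D ∨ ¬ SmBd D ∨
        (OpBd D ∧ SmBd D ∧ ¬ Good (sal ^ 2) c D)) := by
        refine pr_mono fun D h => ?_
        unfold Nice at h
        tauto
    _ ≤ Real.exp (-Fintype.card ι) + (Real.exp (-(Fintype.card ι / 50)) +
          Real.exp (-(Fintype.card ι / 50))) :=
        (pr_or_le _ _).trans (add_le_add (pr_not_opBd (by omega)) ((pr_or_le _ _).trans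
          (add_le_add (pr_not_smBd (by omega)) hunion)))
    _ ≤ _ := by
        set N : ℝ := (Fintype.card ι : ℝ) with hN
        have h1 : Real.exp (-N) ≤ Real.exp (-(N / 50)) := Real.exp_le_exp.2 (by linarith)
        have h2 : 3 ≤ Real.exp (N / 100) := by linarith [Real.add_one_le_exp (N / 100)]
        have h3 : Real.exp (-(N / 50)) * Real.exp (N / 100) ≤ Real.exp (-c * N) := by
          rw [← Real.exp_add, Real.exp_le_exp]
          nlinarith
        have h4 := Real.exp_pos (-(N / 50))
        nlinarith

end Structure

end LSV

namespace LSV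

open Finset MeasureTheory

section Frames

variable {ι κ : Type*} [Fintype ι] [DecidableEq ι] [Fintype κ] [DecidableEq κ] {r : ℕ}

/-- Orthonormality of a family of vectors. -/
def OrthoN (z : Fin r → ι → ℝ) : Prop := ∀ k l, ∑ i, z k i * z l i = if k = l then 1 else 0

lemma sum_comb_mul_comb {z : Fin r → ι → ℝ} (hz : OrthoN z) (ξ η : Fin r → ℝ) :
    ∑ i, comb z ξ i * comb z η i = ∑ k, ξ k * η k := by
  simp only [comb, sum_mul_sum]
  rw [sum_comm]
  refine sum_congr rfl fun k _ => ?_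
  rw [sum_comm]
  calc _ = ∑ l, ξ k * η l * ∑ i, z k i * z l i := by
        refine sum_congr rfl fun l _ => ?_
        rw [mul_sum]
        exact sum_congr rfl fun i _ => by ring
    _ = _ := by simp [hz k]

lemma q_comb {z : Fin r → ι → ℝ} (hz : OrthoN z) (ξ : Fin r → ℝ) : q (comb z ξ) = q ξ := by
  simpa [q, sq] using sum_comb_mul_comb hz ξ ξ

lemma OrthoN.comb {m : ℕ} {z : Fin r → ι → ℝ} (hz : OrthoN z) {h : Fin m → Fin r → ℝ}
    (hh : OrthoN h) : OrthoN fun j => comb z (h j) := fun k l => by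
  rw [sum_comb_mul_comb hz, hh]

lemma OrthoN.q_eq_one {z : Fin r → ι → ℝ} (hz : OrthoN z) (k : Fin r) : q (z k) = 1 := by
  simpa [q, sq] using hz k k

lemma im_comb {D : κ → ι → Bool} {z : Fin r → ι → ℝ} (hz : ∀ k, im D (z k) = 0) (ξ : Fin r → ℝ) :
    im D (comb z ξ) = 0 := by
  funext a
  have : ∀ k, dot (D a) (z k) = 0 := fun k => congrFun (hz k) a
  simp [im, dot_comb, this]

lemma exists_orthonormal (u : κ → ι → ℝ) (h : Fintype.card κ + r ≤ Fintype.card ι) :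
    ∃ z : Fin r → ι → ℝ, OrthoN z ∧ ∀ k j, ∑ i, u k i * z j i = 0 := by
  let U : κ → EuclideanSpace ℝ ι := fun k => WithLp.toLp 2 (u k)
  set K := Submodule.span ℝ (Set.range U) with hK
  have h1 : Module.finrank ℝ K ≤ Fintype.card κ := finrank_range_le_card U
  have h2 := K.finrank_add_finrank_orthogonal
  rw [finrank_euclideanSpace] at h2
  have h3 : r ≤ Module.finrank ℝ Kᗮ := by omega
  let b := stdOrthonormalBasis ℝ Kᗮ
  have hb := orthonormal_iff_ite.1 b.orthonormal
  refine ⟨fun j => (b (Fin.castLE h3 j) : EuclideanSpace ℝ ι), fun k l => ?_, fun k j => ?_⟩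
  · have := hb (Fin.castLE h3 k) (Fin.castLE h3 l)
    rw [Submodule.coe_inner, PiLp.inner_apply] at this
    simp only [Fin.castLE_inj] at this
    rw [← this]
    exact sum_congr rfl fun i _ => by simp [mul_comm]
  · have := Submodule.mem_orthogonal K (b (Fin.castLE h3 j)) |>.1 (b (Fin.castLE h3 j)).2 (U k)
      (Submodule.subset_span ⟨k, rfl⟩)
    rw [PiLp.inner_apply] at this
    rw [← this]
    exact sum_congr rfl fun i _ => by simp [U, mul_comm]

lemma exists_frame (D : κ → ι → Bool) (h : Fintype.card κ + r ≤ Fintype.card ι) :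
    ∃ z : Fin r → ι → ℝ, OrthoN z ∧ ∀ k, im D (z k) = 0 := by
  obtain ⟨z, hz, h0⟩ := exists_orthonormal (fun k i => sg (D k i)) h
  exact ⟨z, hz, fun k => funext fun a => h0 a k⟩

/-- Small ball estimate for an orthonormal frame of the kernel. -/
lemma kernel_small_ball (r : ℕ) {c : ℝ} (hc : 0 < c) : ∃ C : ℝ, 0 < C ∧ ∃ c' : ℝ, 0 < c' ∧ ∃ N0 : ℕ,
    ∀ (ι κ : Type) [Fintype ι] [DecidableEq ι] [Fintype κ] [DecidableEq κ] (D : κ → ι → Bool),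
    N0 ≤ Fintype.card ι → Good (sal ^ 2) c D → ∀ z : Fin r → ι → ℝ, OrthoN z →
    (∀ k, im D (z k) = 0) → ∀ z0 : ι → ℝ, q z0 ≤ 1 → ∀ ρ : Fin r → ℝ,
    (∀ k, Real.exp (-c' * Fintype.card ι) ≤ ρ k) → ∀ P : (ι → Bool) → Prop, ∀ [DecidablePred P],
    (∀ X, P X → ∀ k, |dot X (z k)| ≤ ρ k) →
    ev (fun X => Real.exp (dot X z0) * if P X then 1 else 0) ≤
      C * ∏ k, ρ k + Real.exp (-c' * Fintype.card ι) := by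
  have hs := sal_pos
  have hg := gam_pos
  have hpi := Real.pi_pos
  set c' := min (c / 4) (sal ^ 2 / 4) with hc'
  have hc'0 : 0 < c' := lt_min (by positivity) (by positivity)
  have hc'1 : c' ≤ c / 4 := min_le_left _ _
  have hc'2 : c' ≤ sal ^ 2 / 4 := min_le_right _ _
  set A : ℝ := Real.exp (r / 2) * 2 with hA
  have hA0 : 0 < A := by positivity
  refine ⟨A * (Real.pi / √gam) ^ r, by positivity, c', hc'0,
    max ⌈64 * c' / c ^ 2⌉₊ ⌈A * (1 + √2 ^ r) / c'⌉₊, ?_⟩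
  intro ι κ _ _ _ _ D hN hD z hz hker z0 hz0 ρ hρ P _ hP
  set N : ℝ := (Fintype.card ι : ℝ) with hNdef
  have hN1 : 64 * c' / c ^ 2 ≤ N := Nat.ceil_le.1 ((le_max_left _ _).trans hN)
  have hN2 : A * (1 + √2 ^ r) / c' ≤ N := Nat.ceil_le.1 ((le_max_right _ _).trans hN)
  have hN0 : 0 ≤ N := Nat.cast_nonneg _
  have hρ0 : ∀ k, 0 < ρ k := fun k => (Real.exp_pos _).trans_le (hρ k)
  have hball := tilted_small_ball hz0 (fun k i => (ρ k)⁻¹ * z k i)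
    (b := fun k => gam / (ρ k * Real.pi) ^ 2) (fun k => by have := hρ0 k; positivity)
    (B := sal ^ 2 * N) (Ξ := Real.exp (c * N / 2)) fun ξ hξ => by
      set η : Fin r → ℝ := fun k => ξ k / (ρ k * Real.pi) with hη
      have h1 : (fun i => comb (fun k i => (ρ k)⁻¹ * z k i) ξ i / Real.pi) = comb z η := by
        funext i
        simp only [comb, sum_div, hη]
        refine sum_congr rfl fun k _ => ?_
        have := (hρ0 k).ne'
        field_simp
      have h2 : ∑ k, gam / (ρ k * Real.pi) ^ 2 * ξ k ^ 2 = gam * q (comb z η) := by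
        rw [q_comb hz, q, mul_sum]
        refine sum_congr rfl fun k _ => ?_
        simp only [hη]
        rw [div_pow]; ring
      rw [h1, h2]
      refine hD _ (im_comb hker η) ?_
      rw [q_comb hz]
      calc q η ≤ ∑ k, ξ k ^ 2 * Real.exp (2 * c' * N) := by
            refine sum_le_sum fun k _ => ?_
            simp only [hη]
            rw [div_pow, div_eq_mul_inv]
            refine mul_le_mul_of_nonneg_left ?_ (sq_nonneg _)
            have h3 : Real.exp (-c' * N) ≤ ρ k * Real.pi := by
              have := hρ k
              have h4 := Real.pi_gt_three
              nlinarith [hρ0 k]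
            rw [← inv_pow, show 2 * c' * N = c' * N + c' * N by ring, Real.exp_add, ← sq]
            refine pow_le_pow_left₀ (inv_nonneg.2 (by have := hρ0 k; positivity)) ?_ 2
            rw [show c' * N = -(-c' * N) by ring, Real.exp_neg]
            exact inv_anti₀ (Real.exp_pos _) h3
        _ = q ξ * Real.exp (2 * c' * N) := by rw [q, sum_mul]
        _ ≤ Real.exp (c * N / 2) * Real.exp (2 * c' * N) := by gcongr
        _ ≤ Real.exp (c * N) := by
            rw [← Real.exp_add]
            refine Real.exp_le_exp.2 ?_
            nlinarith
  have hprod : ∏ k, (√(gam / (ρ k * Real.pi) ^ 2))⁻¹ = (Real.pi / √gam) ^ r * ∏ k, ρ k := by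
    have h3 : (Real.pi / √gam) ^ r = ∏ _k : Fin r, Real.pi / √gam := by simp [div_pow]
    rw [h3, ← prod_mul_distrib]
    refine prod_congr rfl fun k _ => ?_
    rw [Real.sqrt_div hg.le, Real.sqrt_sq (by have := hρ0 k; positivity), inv_div]
    ring
  rw [hprod] at hball
  have hE1 : Real.exp (-(sal ^ 2 * N / 2)) ≤ Real.exp (-(2 * c' * N)) :=
    Real.exp_le_exp.2 (by nlinarith)
  have hE2 : Real.exp (-(Real.exp (c * N / 2) / 4)) ≤ Real.exp (-(2 * c' * N)) := by
    refine Real.exp_le_exp.2 ?_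
    have h3 : (c * N / 2) ^ 2 / 2 ≤ Real.exp (c * N / 2) := by
      have := Real.quadratic_le_exp_of_nonneg (x := c * N / 2) (by positivity)
      have : 0 ≤ c * N / 2 := by positivity
      linarith
    rw [div_le_iff₀ (by positivity)] at hN1
    nlinarith
  have hE3 : A * (1 + √2 ^ r) * Real.exp (-(2 * c' * N)) ≤ Real.exp (-c' * N) := by
    have h3 : A * (1 + √2 ^ r) ≤ Real.exp (c' * N) := by
      rw [div_le_iff₀ hc'0] at hN2
      linarith [Real.add_one_le_exp (c' * N)]
    calc _ ≤ Real.exp (c' * N) * Real.exp (-(2 * c' * N)) := by gcongr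
      _ = _ := by rw [← Real.exp_add]; congr 1; ring
  calc ev (fun X => Real.exp (dot X z0) * if P X then 1 else 0)
      ≤ ev (fun X => Real.exp (r / 2) * (Real.exp (dot X z0) *
          Real.exp (-(∑ k, dot X (fun i => (ρ k)⁻¹ * z k i) ^ 2) / 2))) := by
        refine ev_mono fun X => ?_
        split_ifs with h
        · rw [mul_left_comm]
          refine mul_le_mul_of_nonneg_left ?_ (Real.exp_pos _).le
          rw [← Real.exp_add, Real.one_le_exp_iff]
          have : ∑ k, dot X (fun i => (ρ k)⁻¹ * z k i) ^ 2 ≤ ∑ _k : Fin r, (1 : ℝ) := by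
            refine sum_le_sum fun k _ => ?_
            rw [dot_smul, sq_le_one_iff_abs_le_one, abs_mul, abs_of_pos (inv_pos.2 (hρ0 k)),
              inv_mul_le_iff₀ (hρ0 k), mul_one]
            exact hP X h k
          simp at this
          linarith
        · rw [mul_zero]; positivity
    _ = Real.exp (r / 2) * ev (fun X => Real.exp (dot X z0) *
          Real.exp (-(∑ k, dot X (fun i => (ρ k)⁻¹ * z k i) ^ 2) / 2)) := ev_const_mul _ _
    _ ≤ Real.exp (r / 2) * (2 * ((Real.pi / √gam) ^ r * ∏ k, ρ k + Real.exp (-(2 * c' * N)) +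
          √2 ^ r * Real.exp (-(2 * c' * N)))) := by
        refine mul_le_mul_of_nonneg_left (hball.trans ?_) (Real.exp_pos _).le
        gcongr
    _ = A * (Real.pi / √gam) ^ r * ∏ k, ρ k + A * (1 + √2 ^ r) * Real.exp (-(2 * c' * N)) := by
        rw [hA]; ring
    _ ≤ _ := by gcongr

end Frames

section Marginals

variable {Ω : Type*} [Fintype Ω] [Nonempty Ω] {κ : Type*} [Fintype κ] [DecidableEq κ]

lemma ev_prod_type {Ω Ω' : Type*} [Fintype Ω] [Fintype Ω'] (f : Ω × Ω' → ℝ) :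
    ev f = ev fun ω => ev fun ω' => f (ω, ω') := by
  simp only [ev, Fintype.sum_prod_type, Fintype.card_prod, Nat.cast_mul, sum_div, div_div]
  simp only [mul_comm]

lemma ev_restrict (p : κ → Prop) [DecidablePred p] (f : ({k // p k} → Ω) → ℝ) :
    ev (fun D : κ → Ω => f fun k => D k) = ev f := by
  have := ev_equiv (Equiv.piEquivPiSubtypeProd p fun _ : κ => Ω) (fun x => f x.1)
  rw [ev_prod_type] at this
  simp only [ev_const] at this
  exact this

lemma ev_cons {m : ℕ} (F : (Fin (m + 1) → Ω) → ℝ) :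
    ev F = ev fun d : Fin m → Ω => ev fun x : Ω => F (Fin.cons x d) := by
  rw [← ev_equiv (Fin.consEquiv fun _ : Fin (m + 1) => Ω), ev_prod_type, ev_comm]
  rfl

end Marginals

end LSV

namespace LSV

open Finset MeasureTheory

section Frames

variable {ι κ : Type*} [Fintype ι] [DecidableEq ι] [Fintype κ] [DecidableEq κ]

lemma pr_eq_ev {Ω : Type*} [Fintype Ω] (P : Ω → Prop) [DecidablePred P] :
    pr P = ev fun ω => if P ω then 1 else 0 := by
  unfold pr
  congr 1
  funext ω
  congr

lemma pr_eq_zero {Ω : Type*} [Fintype Ω] {P : Ω → Prop} (h : ∀ ω, ¬ P ω) : pr P = 0 := by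
  simp [pr, ev, h]

lemma pr_cons_le {Ω : Type*} [Fintype Ω] [Nonempty Ω] {m : ℕ} (P : (Fin (m + 1) → Ω) → Prop)
    (g : (Fin m → Ω) → ℝ) (h : ∀ d, pr (fun x => P (Fin.cons x d)) ≤ g d) : pr P ≤ ev g := by
  rw [pr, ev_cons]
  exact ev_mono h

/-- Small ball estimate for an orthonormal frame of the kernel, without tilt. -/
lemma pr_kernel_small_ball (r : ℕ) {c : ℝ} (hc : 0 < c) :
    ∃ C : ℝ, 0 < C ∧ ∃ c' : ℝ, 0 < c' ∧ ∃ N0 : ℕ,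
    ∀ (ι κ : Type) [Fintype ι] [DecidableEq ι] [Fintype κ] [DecidableEq κ] (D : κ → ι → Bool),
    N0 ≤ Fintype.card ι → Good (sal ^ 2) c D → ∀ z : Fin r → ι → ℝ, OrthoN z →
    (∀ k, im D (z k) = 0) → ∀ ρ : Fin r → ℝ,
    (∀ k, Real.exp (-c' * Fintype.card ι) ≤ ρ k) →
    pr (fun X : ι → Bool => ∀ k, |dot X (z k)| ≤ ρ k) ≤
      C * ∏ k, ρ k + Real.exp (-c' * Fintype.card ι) := by
  classical
  obtain ⟨C, hC, c', hc', N0, h⟩ := kernel_small_ball r hc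
  refine ⟨C, hC, c', hc', N0, fun ι κ _ _ _ _ D hN hD z hz hk ρ hρ => ?_⟩
  have := h ι κ D hN hD z hz hk 0 (by simp [q]) ρ hρ (fun X => ∀ k, |dot X (z k)| ≤ ρ k)
    fun X hX => hX
  refine le_trans (le_of_eq ?_) this
  rw [pr_eq_ev]
  congr 1
  funext X
  simp [dot]

lemma ev_exp_sum_abs {z : Fin 3 → ι → ℝ} (hz : ∀ j, q (z j) = 1) :
    ev (fun X : ι → Bool => Real.exp (∑ j, |dot X (z j)|)) ≤ 2 * Real.exp (9 / 2) := by
  have h1 : ∀ X : ι → Bool, Real.exp (∑ j, |dot X (z j)|) ≤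
      ∑ j, 1 / 3 * (Real.exp (dot X fun i => 3 * z j i) + Real.exp (dot X fun i => -3 * z j i)) := by
    intro X
    have := convexOn_exp.map_sum_le (t := univ) (w := fun _ : Fin 3 => (1 / 3 : ℝ))
      (p := fun j => 3 * |dot X (z j)|) (fun _ _ => by norm_num) (by simp) (fun _ _ => trivial)
    simp only [smul_eq_mul] at this
    refine le_trans (le_of_eq ?_) (this.trans ?_)
    · congr 1
      exact sum_congr rfl fun j _ => by ring
    · refine sum_le_sum fun j _ => ?_
      rw [dot_smul, dot_smul]
      have := Real.exp_pos (3 * dot X (z j))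
      have := Real.exp_pos (-3 * dot X (z j))
      rcases abs_cases (dot X (z j)) with h | h <;> rw [h.1]
      · linarith
      · rw [show 3 * -dot X (z j) = -3 * dot X (z j) by ring]; linarith
  refine (ev_mono h1).trans ?_
  rw [ev_sum]
  calc _ ≤ ∑ _j : Fin 3, 1 / 3 * (Real.exp (9 / 2) + Real.exp (9 / 2)) := by
        refine sum_le_sum fun j _ => ?_
        rw [ev_const_mul, ev_add]
        have h2 := ev_exp_dot_le (fun i => 3 * z j i)
        have h3 := ev_exp_dot_le (fun i => -3 * z j i)
        rw [q_smul, hz] at h2 h3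
        norm_num at h2 h3 ⊢
        linarith
    _ = _ := by rw [sum_const, card_univ, Fintype.card_fin]; ring

/-- The linear combination of the vectors `D k` with coefficients `v`. -/
def tr (D : κ → ι → Bool) (v : κ → ℝ) (i : ι) : ℝ := ∑ k, v k * sg (D k i)

lemma sum_tr_mul (D : κ → ι → Bool) (v : κ → ℝ) (y : ι → ℝ) :
    ∑ i, tr D v i * y i = ∑ k, v k * dot (D k) y := by
  simp only [tr, dot, sum_mul, mul_sum]
  rw [sum_comm]
  exact sum_congr rfl fun _ _ => sum_congr rfl fun _ _ => by ring

/-- Small ball estimate for one column, after conditioning on the remaining ones. -/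
lemma pr_tail_fixed (m : ℕ) : ∃ C : ℝ, 0 < C ∧ ∃ c : ℝ, 0 < c ∧ ∃ N0 : ℕ,
    ∀ (ι κ : Type) [Fintype ι] [DecidableEq ι] [Fintype κ] [DecidableEq κ],
    Fintype.card κ + 2 = Fintype.card ι + m → N0 ≤ Fintype.card ι →
    ∀ τ : Fin (m + 1) → κ, Function.Injective τ → ∀ a b δ P : ℝ, 0 ≤ δ → 0 ≤ P →
    (∀ Y : Fin m → Fin 3 → ℝ, ∃ h : Fin 3 → Fin 3 → ℝ, OrthoN h ∧ ∃ ρ : Fin 3 → ℝ,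
      (∀ j, Real.exp (-c * Fintype.card ι) ≤ ρ j) ∧ ∏ j, ρ j ≤ P * Real.exp (∑ a, ∑ j, |Y a j|) ∧
      ∀ (v0 : ℝ) (v : Fin m → ℝ) (Y0 : Fin 3 → ℝ), a ≤ |v0| → (∀ a, |v a| ≤ b) →
        (∀ u, q u = 1 → |∑ j, (v0 * Y0 j + ∑ a, v a * Y a j) * u j| ≤ δ) →
        ∀ j, |∑ i, h j i * Y0 i| ≤ ρ j) →
    pr (fun D : κ → ι → Bool => ∃ v : κ → ℝ, q (tr D v) ≤ δ ^ 2 ∧ a ≤ |v (τ 0)| ∧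
      ∀ k : Fin m, |v (τ k.succ)| ≤ b) ≤ C * P + 2 * Real.exp (-c * Fintype.card ι) := by
  classical
  obtain ⟨c1, hc1, N1, hnice⟩ := pr_not_nice 3
  obtain ⟨C, hC, c2, hc2, N2, hball⟩ := pr_kernel_small_ball 3 hc1
  set c := min c1 c2 with hc
  refine ⟨C * (2 * Real.exp (9 / 2)) ^ m, by positivity, c, lt_min hc1 hc2, max N1 N2, ?_⟩
  intro ι κ _ _ _ _ hcard hN τ hτ a b δ P hδ hP H
  set N : ℝ := (Fintype.card ι : ℝ) with hNdef
  have hN0 : 0 ≤ N := Nat.cast_nonneg _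
  have hE1 : Real.exp (-c1 * N) ≤ Real.exp (-c * N) :=
    Real.exp_le_exp.2 (by nlinarith [min_le_left c1 c2])
  have hE2 : Real.exp (-c2 * N) ≤ Real.exp (-c * N) :=
    Real.exp_le_exp.2 (by nlinarith [min_le_right c1 c2])
  let p : κ → Prop := fun k => k ∉ Set.range τ
  have hp : Fintype.card {k // p k} + 3 = Fintype.card ι := by
    have h1 := Fintype.card_subtype_compl fun k => k ∈ Set.range τ
    have h2 : Fintype.card {k // k ∈ Set.range τ} = m + 1 := by
      have := Set.card_range_of_injective hτ
      rw [Fintype.card_fin] at this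
      exact this
    have h3 := Fintype.card_le_of_injective τ hτ
    rw [h2] at h1
    rw [Fintype.card_fin] at h3
    have h4 : Fintype.card {k // p k} = Fintype.card κ - (m + 1) := by
      rw [← h1]
    omega
  let R : (κ → ι → Bool) → ({k // p k} → ι → Bool) := fun D k => D k
  refine (pr_resample_le τ hτ _ (fun D => (if ¬ Nice c1 (R D) then 1 else 0) +
    (C * (2 * Real.exp (9 / 2)) ^ m * P + Real.exp (-c * N))) fun D => ?_).trans ?_
  · by_cases hD : Nice c1 (R D)
    swap
    · rw [if_pos hD]
      refine (pr_le_one _).trans ?_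
      have : 0 ≤ C * (2 * Real.exp (9 / 2)) ^ m * P := by positivity
      linarith [Real.exp_pos (-c * N)]
    · rw [if_neg (not_not.2 hD), zero_add]
      obtain ⟨z, hz, hker⟩ := exists_frame (r := 3) (R D) hp.le
      refine (pr_cons_le _ (fun d => C * P * (∏ a, Real.exp (∑ j, |dot (d a) (z j)|)) +
        Real.exp (-c * N)) fun d => ?_).trans ?_
      · obtain ⟨h, hh, ρ, hρ, hprod, hYv⟩ := H fun a j => dot (d a) (z j)
        have hb := hball ι {k // p k} (R D) ((le_max_right _ _).trans hN) hD.2.2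
          (fun j => comb z (h j)) (hz.comb hh) (fun j => im_comb hker _) ρ
          fun k => hE2.trans (hρ k)
        refine (pr_mono fun x hx => ?_).trans (hb.trans ?_)
        · obtain ⟨v, hv1, hv2, hv3⟩ := hx
          intro j
          rw [dot_comb]
          refine hYv (v (τ 0)) (fun a => v (τ a.succ)) (fun j => dot x (z j)) hv2 hv3 ?_ j
          intro u hu
          set D' := Function.extend τ (Fin.cons x d) D with hD'
          have h1 : ∑ k, v k * dot (D' k) (comb z u) =
              ∑ j, (v (τ 0) * dot x (z j) + ∑ a : Fin m, v (τ a.succ) * dot (d a) (z j)) * u j := by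
            rw [← Fintype.sum_of_injective τ hτ
              (fun a => v (τ a) * dot (D' (τ a)) (comb z u)) _ ?_ fun _ => rfl]
            · simp only [hD', hτ.extend_apply, Fin.sum_univ_succ (n := m), Fin.cons_zero,
                Fin.cons_succ, dot_comb]
              simp only [add_mul, sum_mul, sum_add_distrib, mul_sum]
              congr 1
              · exact sum_congr rfl fun j _ => by ring
              · rw [sum_comm]
                exact sum_congr rfl fun j _ => sum_congr rfl fun a _ => by ring
            · intro k hk
              have h2 : D' k = R D ⟨k, hk⟩ := Function.extend_apply' _ _ _ hk
              have h3 := congrFun (im_comb hker u) ⟨k, hk⟩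
              rw [im] at h3
              rw [h2, h3]; simp
          rw [← h1, ← sum_tr_mul]
          refine abs_le_of_sq_le_sq ?_ hδ
          refine (sq_sum_mul_le _ _).trans ?_
          rw [q_comb hz, hu, mul_one]
          exact hv1
        · rw [← Real.exp_sum]
          have := mul_le_mul_of_nonneg_left hprod hC.le
          linarith
      · rw [ev_add, ev_const, ev_const_mul, ev_pi_prod fun _ x => Real.exp (∑ j, |dot x (z j)|)]
        have h1 : ∏ _a : Fin m, ev (fun x : ι → Bool => Real.exp (∑ j, |dot x (z j)|)) ≤
            (2 * Real.exp (9 / 2)) ^ m := by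
          rw [prod_const, card_univ, Fintype.card_fin]
          exact pow_le_pow_left₀ (ev_nonneg fun _ => (Real.exp_pos _).le)
            (ev_exp_sum_abs fun j => hz.q_eq_one j) m
        have := mul_le_mul_of_nonneg_left h1 (mul_nonneg hC.le hP)
        linarith
  · rw [ev_add, ev_const]
    have h1 := hnice ι {k // p k} hp ((le_max_left _ _).trans hN)
    rw [pr_eq_ev, ← ev_restrict p] at h1
    have h2 : ev (fun D : κ → ι → Bool => if ¬ Nice c1 (R D) then (1 : ℝ) else 0) ≤
        Real.exp (-c * N) := by
      refine le_trans (le_of_eq ?_) (h1.trans hE1)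
      rfl
    linarith

/-- Delocalisation on average: one large coordinate among many. -/
lemma pr_tail (m : ℕ) : ∃ C : ℝ, 0 < C ∧ ∃ c : ℝ, 0 < c ∧ ∃ N0 : ℕ,
    ∀ (ι κ : Type) [Fintype ι] [DecidableEq ι] [Fintype κ] [DecidableEq κ],
    Fintype.card κ + 2 = Fintype.card ι + m → N0 ≤ Fintype.card ι → N0 ≤ Fintype.card κ →
    ∀ k0 : κ, ∀ a δ P : ℝ, 0 ≤ δ → 0 ≤ P →
    (∀ Y : Fin m → Fin 3 → ℝ, ∃ h : Fin 3 → Fin 3 → ℝ, OrthoN h ∧ ∃ ρ : Fin 3 → ℝ,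
      (∀ j, Real.exp (-c * Fintype.card ι) ≤ ρ j) ∧ ∏ j, ρ j ≤ P * Real.exp (∑ a, ∑ j, |Y a j|) ∧
      ∀ (v0 : ℝ) (v : Fin m → ℝ) (Y0 : Fin 3 → ℝ), a ≤ |v0| →
        (∀ a, |v a| ≤ 2 / √(Fintype.card κ)) →
        (∀ u, q u = 1 → |∑ j, (v0 * Y0 j + ∑ a, v a * Y a j) * u j| ≤ δ) →
        ∀ j, |∑ i, h j i * Y0 i| ≤ ρ j) →
    pr (fun D : κ → ι → Bool => ∃ v : κ → ℝ, q v = 1 ∧ q (tr D v) ≤ δ ^ 2 ∧ a ≤ |v k0|) ≤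
      C * (P + Real.exp (-c * Fintype.card ι)) := by
  classical
  obtain ⟨C, hC, c, hc, N0, h⟩ := pr_tail_fixed m
  refine ⟨2 ^ m * (C + 2), by positivity, c, hc, max N0 (4 * (m + 1)), ?_⟩
  intro ι κ _ _ _ _ hcard hN hM k0 a δ P hδ hP H
  set N : ℝ := (Fintype.card ι : ℝ) with hNdef
  set M : ℝ := (Fintype.card κ : ℝ) with hMdef
  have hMm : 4 * ((m : ℝ) + 1) ≤ M := by
    rw [hMdef]; exact_mod_cast (le_max_right _ _).trans hM
  have hM0 : 0 < M := by have : (0 : ℝ) ≤ m := Nat.cast_nonneg _; linarith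
  set E : (κ → ι → Bool) → Prop := fun D => ∃ v : κ → ℝ, q v = 1 ∧ q (tr D v) ≤ δ ^ 2 ∧ a ≤ |v k0|
    with hE
  set F : (Fin m ↪ κ) → (κ → ι → Bool) → Prop := fun e D => k0 ∉ Set.range e ∧
    ∃ v : κ → ℝ, q (tr D v) ≤ δ ^ 2 ∧ a ≤ |v k0| ∧ ∀ k : Fin m, |v (e k)| ≤ 2 / √M with hF
  set B : ℝ := C * P + 2 * Real.exp (-c * N) with hB
  have hB0 : 0 ≤ B := by positivity
  have hFB : ∀ e, pr (F e) ≤ B := by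
    intro e
    by_cases hk : k0 ∈ Set.range e
    · rw [pr_eq_zero fun D hD => hD.1 hk]
      exact hB0
    · have := h ι κ hcard ((le_max_left _ _).trans hN) (Fin.cons k0 e)
        (Fin.cons_injective_iff.2 ⟨hk, e.injective⟩) a (2 / √M) δ P hδ hP H
      refine (pr_mono fun D hD => ?_).trans this
      obtain ⟨v, hv⟩ := hD.2
      exact ⟨v, by simpa using hv⟩
  have hcount : ∀ D, E D → (M / 2) ^ m ≤ ∑ e, if F e D then (1 : ℝ) else 0 := by
    rintro D ⟨v, hv1, hv2, hv3⟩
    set G : Finset κ := univ.filter fun k => k ≠ k0 ∧ |v k| ≤ 2 / √M with hG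
    have hGc : M / 2 + m ≤ (#G : ℝ) + 1 := by
      have h1 : M ≤ #G + 1 + #(univ.filter fun k => 2 / √M < |v k|) := by
        suffices h0 : Fintype.card κ ≤ #G + #{k0} + #(univ.filter fun k => 2 / √M < |v k|) by
          rw [card_singleton] at h0
          rw [hMdef]
          exact_mod_cast h0
        refine (card_le_card (t := (G ∪ {k0}) ∪ univ.filter fun k => 2 / √M < |v k|) ?_).trans
          ((card_union_le _ _).trans (Nat.add_le_add_right (card_union_le _ _) _))
        intro k _
        simp only [hG, mem_union, mem_filter, mem_univ, true_and, mem_singleton]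
        by_cases h1 : k = k0
        · exact Or.inl (Or.inr h1)
        · rcases le_or_gt (|v k|) (2 / √M) with h2 | h2
          · exact Or.inl (Or.inl ⟨h1, h2⟩)
          · exact Or.inr h2
      have h2 : (#(univ.filter fun k => 2 / √M < |v k|) : ℝ) * (4 / M) ≤ 1 := by
        rw [← hv1, q, ← nsmul_eq_mul]
        refine (card_nsmul_le_sum _ (fun k => v k ^ 2) _ fun k hk => ?_).trans
          (sum_le_univ_sum_of_nonneg fun _ => sq_nonneg _)
        have h3 : 2 / √M < |v k| := by simpa using hk
        have h4 := pow_le_pow_left₀ (by positivity) h3.le 2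
        rw [sq_abs, div_pow, Real.sq_sqrt hM0.le] at h4
        norm_num at h4
        exact h4
      rw [mul_div_assoc', div_le_one hM0] at h2
      linarith
    have h1 : (M / 2) ^ m ≤ Fintype.card (Fin m ↪ {k // k ∈ G}) := by
      rw [Fintype.card_embedding_eq, Fintype.card_fin, Fintype.card_coe]
      refine le_trans ?_ (Nat.cast_le.2 (Nat.pow_sub_le_descFactorial #G m))
      have hle : m ≤ #G + 1 := by
        have : (m : ℝ) ≤ ((#G + 1 : ℕ) : ℝ) := by push_cast; linarith
        exact_mod_cast this
      rw [Nat.cast_pow, Nat.cast_sub hle]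
      refine pow_le_pow_left₀ (by positivity) ?_ m
      push_cast
      linarith
    refine h1.trans ?_
    rw [sum_ite, sum_const_zero, add_zero, sum_const, nsmul_eq_mul, mul_one, Nat.cast_le,
      ← Fintype.card_coe]
    refine Fintype.card_le_of_injective
      (fun e => ⟨e.trans (Function.Embedding.subtype _), ?_⟩) fun e e' hee => ?_
    · simp only [mem_filter, mem_univ, true_and, hF]
      have hG' : ∀ k, (e k : κ) ≠ k0 ∧ |v (e k)| ≤ 2 / √M := fun k => by
        simpa only [hG, mem_filter, mem_univ, true_and] using (e k).2
      refine ⟨?_, v, hv2, hv3, fun k => (hG' k).2⟩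
      rintro ⟨k, hk⟩
      exact (hG' k).1 hk
    · ext k
      have := congrArg (fun f => f.1 k) hee
      simpa using this
  have h1 : pr E * (M / 2) ^ m ≤ M ^ m * B := by
    calc pr E * (M / 2) ^ m = ev fun D => (if E D then 1 else 0) * (M / 2) ^ m := by
          rw [ev_mul_const, pr_eq_ev]
      _ ≤ ev fun D => ∑ e, if F e D then (1 : ℝ) else 0 := by
          refine ev_mono fun D => ?_
          split_ifs with hD
          · rw [one_mul]; exact hcount D hD
          · rw [zero_mul]; exact sum_nonneg fun _ _ => by split_ifs <;> norm_num
      _ = ∑ e, pr (F e) := by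
          rw [ev_sum]
          exact sum_congr rfl fun e _ => (pr_eq_ev _).symm
      _ ≤ ∑ _e : Fin m ↪ κ, B := sum_le_sum fun e _ => hFB e
      _ ≤ M ^ m * B := by
          rw [sum_const, nsmul_eq_mul, card_univ, Fintype.card_embedding_eq, Fintype.card_fin]
          refine mul_le_mul_of_nonneg_right ?_ hB0
          rw [hMdef]
          exact_mod_cast Nat.descFactorial_le_pow _ _
  have h2 : pr E ≤ 2 ^ m * B := by
    rw [div_pow, mul_div_assoc', div_le_iff₀ (by positivity)] at h1
    have : 0 < M ^ m := by positivity
    nlinarith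
  refine h2.trans ?_
  rw [hB, mul_assoc]
  refine mul_le_mul_of_nonneg_left ?_ (by positivity)
  nlinarith [Real.exp_pos (-c * N)]

end Frames

end LSV

namespace LSV

open Finset MeasureTheory

lemma exists_orthoN_of_pair (Y : Fin 2 → Fin 3 → ℝ) :
    ∃ h : Fin 3 → Fin 3 → ℝ, OrthoN h ∧ ∀ a, ∑ i, h 0 i * Y a i = 0 := by
  obtain ⟨z, hz, hzY⟩ := exists_orthonormal (r := 1) Y (by simp)
  obtain ⟨w, hw, hwz⟩ := exists_orthonormal (r := 2) z (by simp)
  refine ⟨Fin.cons (z 0) w, fun k l => ?_, fun a => ?_⟩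
  · refine Fin.cases ?_ (fun k => ?_) k <;> refine Fin.cases ?_ (fun l => ?_) l
    · simpa using hz 0 0
    · simpa [(Fin.succ_ne_zero l).symm] using hwz 0 l
    · simpa [Fin.succ_ne_zero k, mul_comm] using hwz 0 k
    · simpa using hw k l
  · simpa [mul_comm] using hzY a 0

lemma OrthoN.abs_le_one {ι : Type*} [Fintype ι] [DecidableEq ι] {r : ℕ} {z : Fin r → ι → ℝ}
    (hz : OrthoN z) (k : Fin r) (i : ι) : |z k i| ≤ 1 := by
  rw [← sq_le_one_iff_abs_le_one, ← hz.q_eq_one k]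
  exact sq_le_q _ _

lemma orthoN_one (r : ℕ) : OrthoN (fun j i : Fin r => if j = i then (1 : ℝ) else 0) := fun k l => by
  simp

/-- The pairing bound used to control one coordinate vector by the others. -/
lemma abs_mul_pairing_le {m : ℕ} {u : Fin 3 → ℝ} (hu : ∀ i, |u i| ≤ 1) {v0 δ b : ℝ} {v : Fin m → ℝ}
    {Y0 : Fin 3 → ℝ} {Y : Fin m → Fin 3 → ℝ} (hb : ∀ a, |v a| ≤ b)
    (h : |∑ j, (v0 * Y0 j + ∑ a, v a * Y a j) * u j| ≤ δ) :
    |v0| * |∑ i, u i * Y0 i| ≤ δ + b * ∑ a, ∑ j, |Y a j| := by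
  have h1 : v0 * ∑ i, u i * Y0 i = (∑ j, (v0 * Y0 j + ∑ a, v a * Y a j) * u j) -
      ∑ a, v a * ∑ j, Y a j * u j := by
    have : ∑ a, v a * ∑ j, Y a j * u j = ∑ j, (∑ a, v a * Y a j) * u j := by
      simp only [mul_sum, sum_mul]
      rw [sum_comm]
      exact sum_congr rfl fun _ _ => sum_congr rfl fun _ _ => by ring
    rw [this, ← sum_sub_distrib, mul_sum]
    exact sum_congr rfl fun _ _ => by ring
  rw [← abs_mul, h1]
  refine (abs_sub _ _).trans (add_le_add h ?_)
  rw [mul_sum]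
  refine (abs_sum_le_sum_abs _ _).trans (sum_le_sum fun a _ => ?_)
  rw [abs_mul]
  refine mul_le_mul (hb a) ?_ (abs_nonneg _) ((abs_nonneg _).trans (hb a))
  refine (abs_sum_le_sum_abs _ _).trans (sum_le_sum fun j _ => ?_)
  rw [abs_mul]
  exact mul_le_of_le_one_right (abs_nonneg _) (hu j)

lemma cubic_le_exp {S : ℝ} (hS : 0 ≤ S) :
    (1 + 2 * S) ^ 2 ≤ 48 * Real.exp S ∧ (1 + 2 * S) ^ 3 ≤ 48 * Real.exp S := by
  have h := Real.sum_le_exp_of_nonneg hS 4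
  simp [sum_range_succ, Nat.factorial] at h
  have := pow_nonneg hS 2
  have := pow_nonneg hS 3
  constructor <;> nlinarith

/-- Square matrices: a large coordinate of an almost null vector is unlikely. -/
lemma pr_tail_square : ∃ C : ℝ, 0 < C ∧ ∃ c : ℝ, 0 < c ∧ ∃ N0 : ℕ,
    ∀ (ι κ : Type) [Fintype ι] [DecidableEq ι] [Fintype κ] [DecidableEq κ],
    Fintype.card κ = Fintype.card ι → N0 ≤ Fintype.card ι → ∀ (k0 : κ) (ε L : ℝ), 0 < L → ε ≤ 1 →
    Real.exp (-c * Fintype.card ι) ≤ ε / L → 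
    pr (fun D : κ → ι → Bool => ∃ v : κ → ℝ, q v = 1 ∧
      q (tr D v) ≤ (ε / √(Fintype.card ι)) ^ 2 ∧ L / √(Fintype.card ι) ≤ |v k0|) ≤
      C * (ε / L ^ 3 + Real.exp (-c * Fintype.card ι)) := by
  obtain ⟨C, hC, c, hc, N0, h⟩ := pr_tail 2
  refine ⟨48 * C, by positivity, c, hc, max N0 1, ?_⟩
  intro ι κ _ _ _ _ hcard hN k0 ε L hL hε hlow
  have hN0 : N0 ≤ Fintype.card ι := (le_max_left _ _).trans hN
  have hN1 : (1 : ℝ) ≤ Fintype.card ι := by exact_mod_cast (le_max_right _ _).trans hN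
  have hε0 : 0 < ε := by
    have := (Real.exp_pos _).trans_le hlow
    rwa [div_pos_iff_of_pos_right hL] at this
  have := h ι κ (by rw [hcard]) hN0 (hcard ▸ hN0) k0 (L / √(Fintype.card ι))
    (ε / √(Fintype.card ι)) (48 * (ε / L ^ 3)) (by positivity) (by positivity) fun Y => ?_
  · refine this.trans ?_
    have := mul_pos hC (Real.exp_pos (-c * Fintype.card ι))
    nlinarith
  rw [hcard]
  have hs : 0 < √(Fintype.card ι : ℝ) := Real.sqrt_pos.2 (by linarith)
  set s := √(Fintype.card ι : ℝ) with hsdef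
  obtain ⟨g, hg, hgY⟩ := exists_orthoN_of_pair Y
  set S := ∑ a, ∑ j, |Y a j| with hS
  have hS0 : 0 ≤ S := sum_nonneg fun _ _ => sum_nonneg fun _ _ => abs_nonneg _
  refine ⟨g, hg, Fin.cons (ε / L) fun _ => (1 + 2 * S) / L, ?_, ?_, ?_⟩
  · refine Fin.cases ?_ fun j => ?_
    · simpa using hlow
    · simp only [Fin.cons_succ]
      refine hlow.trans ?_
      gcongr
      linarith
  · simp only [Fin.prod_univ_succ (n := 2), Fin.cons_zero, Fin.cons_succ, prod_const, card_univ,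
      Fintype.card_fin]
    calc ε / L * ((1 + 2 * S) / L) ^ 2 = ε / L ^ 3 * (1 + 2 * S) ^ 2 := by field_simp
      _ ≤ ε / L ^ 3 * (48 * Real.exp S) := by
          have := (cubic_le_exp hS0).1
          gcongr
      _ = _ := by ring
  · intro v0 v Y0 hv0 hv hu
    have hv0' : 0 < |v0| := lt_of_lt_of_le (by positivity) hv0
    refine Fin.cases ?_ fun j => ?_
    · have h1 := hu (g 0) (hg.q_eq_one 0)
      have h2 : ∑ j, (v0 * Y0 j + ∑ a, v a * Y a j) * g 0 j = v0 * ∑ i, g 0 i * Y0 i := by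
        have : ∑ j, (∑ a, v a * Y a j) * g 0 j = 0 := by
          calc _ = ∑ a, v a * ∑ i, g 0 i * Y a i := by
                simp only [mul_sum, sum_mul]
                rw [sum_comm]
                exact sum_congr rfl fun _ _ => sum_congr rfl fun _ _ => by ring
            _ = 0 := by simp [hgY]
        simp only [add_mul, sum_add_distrib, this, add_zero, mul_sum]
        exact sum_congr rfl fun _ _ => by ring
      rw [h2, abs_mul] at h1
      simp only [Fin.cons_zero]
      have h3 : L / s * |∑ i, g 0 i * Y0 i| ≤ ε / s :=
        (mul_le_mul_of_nonneg_right hv0 (abs_nonneg _)).trans h1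
      rw [div_mul_eq_mul_div, div_le_div_iff_of_pos_right hs] at h3
      rwa [le_div_iff₀' hL]
    · have h1 := abs_mul_pairing_le (fun i => hg.abs_le_one j.succ i) hv
        (hu (g j.succ) (hg.q_eq_one _))
      simp only [Fin.cons_succ]
      have h3 : L / s * |∑ i, g j.succ i * Y0 i| ≤ (1 + 2 * S) / s := by
        refine (mul_le_mul_of_nonneg_right hv0 (abs_nonneg _)).trans (h1.trans ?_)
        rw [add_div, div_mul_eq_mul_div]
        gcongr
      rw [div_mul_eq_mul_div, div_le_div_iff_of_pos_right hs] at h3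
      rwa [le_div_iff₀' hL]

/-- Wide matrices: a large coordinate of a null vector is unlikely. -/
lemma pr_tail_wide (s : ℕ) : ∃ C : ℝ, 0 < C ∧ ∃ c : ℝ, 0 < c ∧ ∃ N0 : ℕ,
    ∀ (ι κ : Type) [Fintype ι] [DecidableEq ι] [Fintype κ] [DecidableEq κ],
    Fintype.card κ = Fintype.card ι + s → N0 ≤ Fintype.card ι → ∀ (k0 : κ) (L : ℝ), 0 < L →
    Real.exp (-c * Fintype.card ι) ≤ 1 / L → 
    pr (fun D : κ → ι → Bool => ∃ v : κ → ℝ, q v = 1 ∧ tr D v = 0 ∧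
      L / √(Fintype.card κ) ≤ |v k0|) ≤ C * (1 / L ^ 3 + Real.exp (-c * Fintype.card ι)) := by
  obtain ⟨C, hC, c, hc, N0, h⟩ := pr_tail (s + 2)
  refine ⟨48 * C, by positivity, c, hc, max N0 1, ?_⟩
  intro ι κ _ _ _ _ hcard hN k0 L hL hlow
  have hN0 : N0 ≤ Fintype.card ι := (le_max_left _ _).trans hN
  have hN1 : 1 ≤ Fintype.card ι := (le_max_right _ _).trans hN
  have hM : (1 : ℝ) ≤ Fintype.card κ := by rw [hcard]; exact_mod_cast Nat.le_add_right_of_le hN1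
  have hs : 0 < √(Fintype.card κ : ℝ) := Real.sqrt_pos.2 (by linarith)
  have := h ι κ (by rw [hcard]; ring) hN0 (by omega) k0 (L / √(Fintype.card κ))
    0 (48 * (1 / L ^ 3)) le_rfl (by positivity) fun Y => ?_
  · refine (pr_mono fun D hD => ?_).trans (this.trans ?_)
    · obtain ⟨v, hv1, hv2, hv3⟩ := hD
      exact ⟨v, hv1, by rw [q_eq_zero.2 hv2]; norm_num, hv3⟩
    · have := mul_pos hC (Real.exp_pos (-c * Fintype.card ι))
      nlinarith
  set t := √(Fintype.card κ : ℝ) with ht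
  set S := ∑ a, ∑ j, |Y a j| with hS
  have hS0 : 0 ≤ S := sum_nonneg fun _ _ => sum_nonneg fun _ _ => abs_nonneg _
  have hg := orthoN_one 3
  refine ⟨_, hg, fun _ => (1 + 2 * S) / L, fun _ => ?_, ?_, ?_⟩
  · refine hlow.trans ?_
    beta_reduce
    gcongr
    linarith
  · rw [prod_const, card_univ, Fintype.card_fin]
    calc ((1 + 2 * S) / L) ^ 3 = 1 / L ^ 3 * (1 + 2 * S) ^ 3 := by field_simp
      _ ≤ 1 / L ^ 3 * (48 * Real.exp S) := by
          have := (cubic_le_exp hS0).2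
          gcongr
      _ = _ := by ring
  · intro v0 v Y0 hv0 hv hu j
    have h1 := abs_mul_pairing_le (fun i => hg.abs_le_one j i) hv (hu _ (hg.q_eq_one j))
    have h3 : L / t * |∑ i, (if j = i then (1 : ℝ) else 0) * Y0 i| ≤ (1 + 2 * S) / t := by
      refine (mul_le_mul_of_nonneg_right hv0 (abs_nonneg _)).trans (h1.trans ?_)
      rw [zero_add, div_mul_eq_mul_div]
      gcongr
      linarith
    rw [div_mul_eq_mul_div, div_le_div_iff_of_pos_right hs] at h3
    rwa [le_div_iff₀' hL]

/-- All unit vectors of the kernel have small coordinates. -/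
def Deloc {ι κ : Type*} [Fintype ι] (η : ℝ) (D : κ → ι → Bool) : Prop :=
  ∀ w, q w = 1 → im D w = 0 → ∀ i, |w i| ≤ η

lemma pr_not_deloc (s : ℕ) {η p : ℝ} (hη : 0 < η) (hp : 0 < p) : ∃ N0 : ℕ,
    ∀ (ι κ : Type) [Fintype ι] [DecidableEq ι] [Fintype κ] [DecidableEq κ],
    Fintype.card κ + s = Fintype.card ι → N0 ≤ Fintype.card ι →
    pr (fun D : κ → ι → Bool => ¬ Deloc η D) ≤ p := by
  obtain ⟨C, hC, c, hc, N0, h⟩ := pr_tail_wide s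
  set A := C * (1 / η ^ 3 + 2 * Real.exp (c * s) / c ^ 2) with hA
  refine ⟨max (max (N0 + s) (s + 1)) (max ⌈(A / p) ^ 2⌉₊ ⌈η * (2 * Real.exp (c * s) / c ^ 2)⌉₊), ?_⟩
  intro ι κ _ _ _ _ hcard hN
  simp only [max_le_iff, Nat.ceil_le] at hN
  obtain ⟨⟨hN1, hN2⟩, hN3, hN4⟩ := hN
  set M : ℝ := (Fintype.card ι : ℝ) with hM
  have hκ : (Fintype.card κ : ℝ) = M - s := by rw [hM, ← hcard]; push_cast; ring
  have hM1 : 1 ≤ M := by rw [hM]; exact_mod_cast (by omega : 1 ≤ Fintype.card ι)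
  have hM0 : 0 < M := by linarith
  have hsM := Real.sqrt_pos.2 hM0
  have hexp : M * Real.exp (-c * Fintype.card κ) ≤ 2 * Real.exp (c * s) / c ^ 2 / M := by
    have h1 : (c * M) ^ 2 / 2 ≤ Real.exp (c * M) := by
      have := Real.quadratic_le_exp_of_nonneg (x := c * M) (by positivity)
      have : 0 ≤ c * M := by positivity
      linarith
    rw [hκ, show -c * (M - s) = c * s - c * M by ring, Real.exp_sub, div_div, mul_div_assoc',
      div_le_div_iff₀ (Real.exp_pos _) (by positivity)]
    nlinarith [Real.exp_pos (c * s)]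
  have hsq : √M ≤ M := by
    nlinarith [Real.mul_self_sqrt hM0.le, Real.one_le_sqrt.2 hM1]
  have hlow : Real.exp (-c * Fintype.card κ) ≤ 1 / (η * √M) := by
    rw [le_div_iff₀ (by positivity)]
    rw [div_eq_mul_inv] at hexp
    have h1 : η * (2 * Real.exp (c * s) / c ^ 2 * M⁻¹) ≤ 1 := by
      rw [← mul_assoc, ← div_eq_mul_inv, div_le_one hM0]; exact hN4
    calc _ ≤ η * (M * Real.exp (-c * Fintype.card κ)) := by
          have := mul_le_mul_of_nonneg_left hsq (mul_pos hη (Real.exp_pos (-c * Fintype.card κ))).le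
          linarith
      _ ≤ _ := (mul_le_mul_of_nonneg_left hexp hη.le).trans h1
  have hone : ∀ i : ι, pr (fun D : κ → ι → Bool => ∃ w, q w = 1 ∧ im D w = 0 ∧ η ≤ |w i|) ≤
      C * (1 / (η * √M) ^ 3 + Real.exp (-c * Fintype.card κ)) := by
    intro i
    refine le_trans (le_of_eq ?_) (h κ ι hcard.symm (by omega) i (η * √M) (by positivity) hlow)
    classical
    rw [pr_eq_ev, pr_eq_ev, ← ev_equiv (Equiv.piComm fun (_ : κ) (_ : ι) => Bool)]
    congr 1
    funext D
    have h1 : ∀ w : ι → ℝ, tr ((Equiv.piComm fun (_ : κ) (_ : ι) => Bool) D) w = im D w :=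
      fun w => funext fun k => sum_congr rfl fun i _ => mul_comm _ _
    simp only [h1, ← hM, mul_div_cancel_right₀ _ hsM.ne']
  calc _ ≤ pr (fun D : κ → ι → Bool => ∃ i : ι, ∃ w, q w = 1 ∧ im D w = 0 ∧ η ≤ |w i|) := by
        refine pr_mono fun D hD => ?_
        simp only [Deloc] at hD
        push Not at hD
        obtain ⟨w, h1, h2, i, h3⟩ := hD
        exact ⟨i, w, h1, h2, h3.le⟩
    _ ≤ ∑ _i : ι, C * (1 / (η * √M) ^ 3 + Real.exp (-c * Fintype.card κ)) :=
        (pr_exists_fintype_le _).trans (sum_le_sum fun i _ => hone i)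
    _ = C * (M * (1 / (η * √M) ^ 3) + M * Real.exp (-c * Fintype.card κ)) := by
        rw [sum_const, nsmul_eq_mul, card_univ]; ring
    _ ≤ C * (1 / η ^ 3 / √M + 2 * Real.exp (c * s) / c ^ 2 / √M) := by
        have h1 : M * (1 / (η * √M) ^ 3) = 1 / η ^ 3 / √M := by
          nth_rewrite 1 [← Real.mul_self_sqrt hM0.le]
          field_simp
        rw [h1]
        gcongr
        refine hexp.trans ?_
        gcongr
    _ = A / √M := by rw [hA]; ring
    _ ≤ p := by
        rw [div_le_iff₀ hsM, ← div_le_iff₀' hp]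
        exact Real.le_sqrt_of_sq_le hN3

end LSV

namespace LSV

open Finset MeasureTheory

section Density

variable {ι κ : Type*} [Fintype ι] [DecidableEq ι] [Fintype κ] [DecidableEq κ] {r : ℕ}

lemma abs_cos_sub_exp_le {θ : ℝ} (hθ : |θ| ≤ 1) :
    |Real.cos θ - Real.exp (-(θ ^ 2 / 2))| ≤ θ ^ 4 := by
  have h1 := abs_le.1 (Real.cos_bound hθ)
  have h2 := Real.add_one_le_exp (-(θ ^ 2 / 2))
  have h3 : Real.exp (-(θ ^ 2 / 2)) ≤ 1 - θ ^ 2 / 2 + (θ ^ 2 / 2) ^ 2 := by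
    have h4 : |-(θ ^ 2 / 2)| ≤ 1 := by
      rw [abs_neg, abs_of_nonneg (by positivity)]
      have := (sq_le_one_iff_abs_le_one θ).2 hθ
      linarith
    have := (abs_le.1 (Real.abs_exp_sub_one_sub_id_le h4)).2
    nlinarith
  have h5 : |θ| ^ 4 = θ ^ 4 := by rw [pow_abs, abs_of_nonneg (by positivity)]
  rw [h5] at h1
  rw [abs_le]
  constructor <;> nlinarith [pow_nonneg (sq_nonneg θ) 2]

lemma abs_prod_sub_prod_le {a b : ι → ℝ} (ha : ∀ i, |a i| ≤ 1) (hb : ∀ i, |b i| ≤ 1)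
    (s : Finset ι) : |∏ i ∈ s, a i - ∏ i ∈ s, b i| ≤ ∑ i ∈ s, |a i - b i| := by
  induction s using Finset.induction_on with
  | empty => simp
  | insert i s hi ih =>
    rw [prod_insert hi, prod_insert hi, sum_insert hi]
    have h1 : |∏ i ∈ s, a i| ≤ 1 := by
      rw [abs_prod]; exact prod_le_one (fun _ _ => abs_nonneg _) fun i _ => ha i
    calc |a i * ∏ i ∈ s, a i - b i * ∏ i ∈ s, b i|
        = |(a i - b i) * ∏ i ∈ s, a i + b i * (∏ i ∈ s, a i - ∏ i ∈ s, b i)| := by ring_nf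
      _ ≤ |a i - b i| * |∏ i ∈ s, a i| + |b i| * |∏ i ∈ s, a i - ∏ i ∈ s, b i| := by
          rw [← abs_mul, ← abs_mul]; exact abs_add_le _ _
      _ ≤ |a i - b i| * 1 + 1 * ∑ i ∈ s, |a i - b i| := by
          gcongr
          exact hb i
      _ = _ := by ring

lemma cf_zero (z : Fin r → ι → ℝ) (ξ : Fin r → ℝ) :
    cf 0 z ξ = ((∏ i, Real.cos (comb z ξ i) : ℝ) : ℂ) := by
  rw [cf, Complex.ofReal_prod]
  refine prod_congr rfl fun i _ => ?_
  simp [Complex.cosh_mul_I]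

lemma Deloc.sq_le {η : ℝ} {D : κ → ι → Bool} (hD : Deloc η D) {w : ι → ℝ} (hw : im D w = 0)
    (i : ι) : w i ^ 2 ≤ η ^ 2 * q w := by
  rcases (q_nonneg w).eq_or_lt with h | h
  · rw [q_eq_zero.1 h.symm]; simp [q]
  have hs := Real.sqrt_pos.2 h
  have := hD (fun i => (√(q w))⁻¹ * w i)
    (by rw [q_smul, inv_pow, Real.sq_sqrt h.le, inv_mul_cancel₀ h.ne'])
    (by rw [im_smul, hw]; funext; simp) i
  have h2 := pow_le_pow_left₀ (abs_nonneg _) this 2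
  rw [sq_abs, mul_pow, inv_pow, Real.sq_sqrt h.le, inv_mul_le_iff₀ h] at h2
  linarith

/-- Gaussian approximation of the characteristic function at low frequency. -/
lemma abs_cf_sub_gauss_le {η K : ℝ} {D : κ → ι → Bool} (hD : Deloc η D) (hη : η ^ 2 * K ≤ 1)
    {z : Fin r → ι → ℝ} (hz : OrthoN z) (hker : ∀ k, im D (z k) = 0) {ξ : Fin r → ℝ}
    (hξ : q ξ ≤ K) :
    |∏ i, Real.cos (comb z ξ i) - Real.exp (-(q ξ / 2))| ≤ η ^ 2 * K ^ 2 := by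
  have hq := q_comb hz ξ
  have h1 : ∀ i, comb z ξ i ^ 2 ≤ η ^ 2 * K := fun i =>
    (hD.sq_le (im_comb hker ξ) i).trans (by rw [hq]; gcongr)
  have h2 : Real.exp (-(q ξ / 2)) = ∏ i, Real.exp (-(comb z ξ i ^ 2 / 2)) := by
    rw [← Real.exp_sum, ← hq, q, sum_div, sum_neg_distrib]
  rw [h2]
  refine (abs_prod_sub_prod_le (fun i => Real.abs_cos_le_one _) (fun i => ?_) univ).trans ?_
  · rw [abs_of_pos (Real.exp_pos _), Real.exp_le_one_iff]
    have := sq_nonneg (comb z ξ i)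
    linarith
  · calc _ ≤ ∑ i, η ^ 2 * K * comb z ξ i ^ 2 := by
          refine sum_le_sum fun i _ => (abs_cos_sub_exp_le ?_).trans ?_
          · rw [← sq_le_one_iff_abs_le_one]
            exact (h1 i).trans hη
          · rw [show (4 : ℕ) = 2 + 2 from rfl, pow_add]
            exact mul_le_mul_of_nonneg_right (h1 i) (sq_nonneg _)
      _ = η ^ 2 * K * q ξ := by rw [← mul_sum, ← hq, q]
      _ ≤ η ^ 2 * K * K := by
          have : 0 ≤ K := (q_nonneg ξ).trans hξ
          gcongr
      _ = _ := by ring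

/-- The decay rate of the characteristic function. -/
noncomputable def gam' : ℝ := gam / (2 * Real.pi ^ 2)

lemma gam'_pos : 0 < gam' := by have := gam_pos; have := Real.pi_pos; unfold gam'; positivity

lemma gam'_le : gam' ≤ 1 / 2 := by
  have := Real.pi_gt_three
  rw [gam', div_le_iff₀ (by positivity), gam]
  nlinarith

lemma norm_cf_le_of_good {c : ℝ} {D : κ → ι → Bool} (hD : Good (sal ^ 2) c D)
    {z : Fin r → ι → ℝ} (hz : OrthoN z) (hker : ∀ k, im D (z k) = 0) {ξ : Fin r → ℝ}
    (hξ : q ξ ≤ Real.exp (c * Fintype.card ι)) :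
    ‖cf 0 z ξ‖ ≤ Real.exp (-(gam' * q ξ)) + Real.exp (-(sal ^ 2 * Fintype.card ι / 2)) := by
  have h1 := norm_cf_le (z0 := (0 : ι → ℝ)) (by simp [q]) z ξ
  have hpi := Real.pi_gt_three
  have hq : q (fun i => comb z ξ i / Real.pi) = q ξ / Real.pi ^ 2 := by
    have := q_smul Real.pi⁻¹ (comb z ξ)
    rw [q_comb hz] at this
    simp only [div_eq_inv_mul, this, inv_pow]
  have h2 := hD (fun i => comb z ξ i / Real.pi) (by
    have := im_smul D Real.pi⁻¹ (comb z ξ)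
    rw [im_comb hker] at this
    simp only [div_eq_inv_mul, this]
    funext; simp) (by
    rw [hq]
    refine (div_le_self (q_nonneg _) ?_).trans hξ
    nlinarith)
  refine h1.trans ?_
  have h0 : Real.exp (q (0 : ι → ℝ) / 2) = 1 := by simp [q]
  rw [h0, one_mul]
  rw [hq] at h2
  rcases min_le_iff.1 h2 with h | h
  · refine le_trans (Real.exp_le_exp.2 ?_) (le_add_of_nonneg_right (Real.exp_pos _).le)
    have : gam' * q ξ = gam * (q ξ / Real.pi ^ 2) / 2 := by
      rw [gam']; field_simp
    linarith
  · refine le_trans (Real.exp_le_exp.2 ?_) (le_add_of_nonneg_left (Real.exp_pos _).le)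
    linarith

lemma norm_smoothed_cf_sub_le {c η K b : ℝ} {D : κ → ι → Bool} (hG : Good (sal ^ 2) c D)
    (hD : Deloc η D) (hK : 0 < K) (hη : η ^ 2 * K ≤ 1) (hb : 0 < b)
    {z : Fin r → ι → ℝ} (hz : OrthoN z) (hker : ∀ k, im D (z k) = 0) (ξ : Fin r → ℝ) :
    ‖(Real.exp (-(b * q ξ)) : ℂ) * cf 0 z ξ - (Real.exp (-(1 / 2 * q ξ)) : ℂ)‖ ≤
      (η ^ 2 * K ^ 2 + b * K) * Real.exp 1 * Real.exp (-(1 / K * q ξ)) +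
      2 * Real.exp (-(gam' * K / 2)) * Real.exp (-(gam' / 2 * q ξ)) +
      (Real.exp (-(sal ^ 2 * Fintype.card ι / 2)) +
        Real.exp (-(b * Real.exp (c * Fintype.card ι) / 2))) * Real.exp (-(b / 2 * q ξ)) := by
  have hg := gam'_pos
  have hq := q_nonneg ξ
  set Q := q ξ with hQ
  rcases le_or_gt Q K with h | h
  · have h1 := abs_cf_sub_gauss_le hD hη hz hker h
    have h2 : ‖(Real.exp (-(b * Q)) : ℂ) * cf 0 z ξ - (Real.exp (-(1 / 2 * Q)) : ℂ)‖ ≤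
        η ^ 2 * K ^ 2 + b * K := by
      rw [cf_zero, ← Complex.ofReal_mul, ← Complex.ofReal_sub, Complex.norm_real, Real.norm_eq_abs]
      set p := ∏ i, Real.cos (comb z ξ i) with hp
      have hp1 : |p| ≤ 1 := by
        rw [hp, abs_prod]
        exact prod_le_one (fun _ _ => abs_nonneg _) fun _ _ => Real.abs_cos_le_one _
      have h3 : |Real.exp (-(b * Q)) - 1| ≤ b * K := by
        rw [abs_le]
        have h4 := Real.add_one_le_exp (-(b * Q))
        have h5 : Real.exp (-(b * Q)) ≤ 1 := Real.exp_le_one_iff.2 (by have := mul_nonneg hb.le hq; linarith)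
        have h6 : b * Q ≤ b * K := by gcongr
        have h7 : 0 ≤ b * K := by positivity
        constructor <;> linarith
      calc _ = |(p - Real.exp (-(Q / 2))) + (Real.exp (-(b * Q)) - 1) * p| := by
            congr 1; ring_nf
        _ ≤ |p - Real.exp (-(Q / 2))| + |Real.exp (-(b * Q)) - 1| * |p| := by
            rw [← abs_mul]; exact abs_add_le _ _
        _ ≤ η ^ 2 * K ^ 2 + b * K * 1 := by gcongr
        _ = _ := by ring
    refine h2.trans (le_trans ?_ (le_add_of_nonneg_right (by positivity)))
    refine le_trans ?_ (le_add_of_nonneg_right (by positivity))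
    rw [mul_assoc, ← Real.exp_add]
    refine le_mul_of_one_le_right (by positivity) (Real.one_le_exp ?_)
    have : 1 / K * Q ≤ 1 := by rw [one_div_mul_eq_div, div_le_one hK]; exact h
    linarith
  · have hexp : Real.exp (-(gam' * Q)) ≤ Real.exp (-(gam' * K / 2)) * Real.exp (-(gam' / 2 * Q)) := by
      rw [← Real.exp_add]
      exact Real.exp_le_exp.2 (by nlinarith)
    have hexp2 : Real.exp (-(1 / 2 * Q)) ≤ Real.exp (-(gam' * Q)) :=
      Real.exp_le_exp.2 (by nlinarith [gam'_le])
    have hb1 : Real.exp (-(b * Q)) ≤ Real.exp (-(b / 2 * Q)) :=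
      Real.exp_le_exp.2 (by nlinarith [mul_nonneg hb.le hq])
    have hmain : Real.exp (-(b * Q)) * ‖cf 0 z ξ‖ ≤ Real.exp (-(gam' * Q)) +
        (Real.exp (-(sal ^ 2 * Fintype.card ι / 2)) +
        Real.exp (-(b * Real.exp (c * Fintype.card ι) / 2))) * Real.exp (-(b / 2 * Q)) := by
      rcases le_or_gt Q (Real.exp (c * Fintype.card ι)) with h1 | h1
      · have h2 := norm_cf_le_of_good hG hz hker h1
        calc _ ≤ Real.exp (-(b * Q)) * (Real.exp (-(gam' * q ξ)) +
              Real.exp (-(sal ^ 2 * Fintype.card ι / 2))) := by gcongr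
          _ = Real.exp (-(b * Q)) * Real.exp (-(gam' * Q)) +
              Real.exp (-(sal ^ 2 * Fintype.card ι / 2)) * Real.exp (-(b * Q)) := by ring
          _ ≤ 1 * Real.exp (-(gam' * Q)) + (Real.exp (-(sal ^ 2 * Fintype.card ι / 2)) +
              Real.exp (-(b * Real.exp (c * Fintype.card ι) / 2))) * Real.exp (-(b / 2 * Q)) := by
              refine add_le_add (mul_le_mul_of_nonneg_right (Real.exp_le_one_iff.2 ?_)
                (Real.exp_pos _).le) (mul_le_mul (le_add_of_nonneg_right (Real.exp_pos _).le) hb1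
                (Real.exp_pos _).le (by positivity))
              have := mul_nonneg hb.le hq
              linarith
          _ = _ := by ring
      · have h2 : ‖cf 0 z ξ‖ ≤ 1 := by
          have := norm_cf_le_exp (0 : ι → ℝ) z ξ
          simpa [q] using this
        calc _ ≤ Real.exp (-(b * Q)) * 1 := by gcongr
          _ ≤ Real.exp (-(b * Real.exp (c * Fintype.card ι) / 2)) * Real.exp (-(b / 2 * Q)) := by
              rw [mul_one, ← Real.exp_add]
              exact Real.exp_le_exp.2 (by nlinarith)
          _ ≤ _ := by
              rw [add_mul]
              have := Real.exp_pos (-(gam' * Q))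
              have : 0 < Real.exp (-(sal ^ 2 * Fintype.card ι / 2)) * Real.exp (-(b / 2 * Q)) := by
                positivity
              linarith
    refine (norm_sub_le _ _).trans ?_
    rw [norm_mul, Complex.norm_real, Complex.norm_real, Real.norm_eq_abs, Real.norm_eq_abs,
      abs_of_pos (Real.exp_pos _), abs_of_pos (Real.exp_pos _)]
    have h3 : 0 ≤ (η ^ 2 * K ^ 2 + b * K) * Real.exp 1 * Real.exp (-(1 / K * Q)) := by positivity
    linarith

lemma integral_three_exp {x y w : ℝ} (hx : 0 < x) (hy : 0 < y) (hw : 0 < w) (a b c : ℝ) :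
    ∫ ξ : Fin r → ℝ, (a * Real.exp (-(x * q ξ)) + b * Real.exp (-(y * q ξ)) +
      c * Real.exp (-(w * q ξ))) = a * √(Real.pi / x) ^ r + b * √(Real.pi / y) ^ r +
      c * √(Real.pi / w) ^ r := by
  have i1 := (integrable_exp_neg_q (r := r) hx).const_mul a
  have i2 := (integrable_exp_neg_q (r := r) hy).const_mul b
  have i3 := (integrable_exp_neg_q (r := r) hw).const_mul c
  have h1 := integral_add (i1.add i2) i3
  have h2 := integral_add i1 i2
  simp only [Pi.add_apply] at h1
  rw [h1, h2, integral_const_mul, integral_const_mul, integral_const_mul,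
    integral_exp_neg_q, integral_exp_neg_q, integral_exp_neg_q]

lemma smoothed_density_le {c η K b : ℝ} {D : κ → ι → Bool} (hG : Good (sal ^ 2) c D)
    (hD : Deloc η D) (hK : 0 < K) (hη : η ^ 2 * K ≤ 1) (hb : 0 < b)
    {z : Fin r → ι → ℝ} (hz : OrthoN z) (hker : ∀ k, im D (z k) = 0) (y : Fin r → ℝ) :
    √(Real.pi / b) ^ r * ev (fun X : ι → Bool => 
        Real.exp (-(q (fun k => dot X (z k) - y k) / (4 * b)))) ≤
      √(2 * Real.pi) ^ r * Real.exp (-(q y / 2)) +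
      ((η ^ 2 * K ^ 2 + b * K) * Real.exp 1 * √(Real.pi * K) ^ r +
      2 * Real.exp (-(gam' * K / 2)) * √(2 * Real.pi / gam') ^ r +
      (Real.exp (-(sal ^ 2 * Fintype.card ι / 2)) +
        Real.exp (-(b * Real.exp (c * Fintype.card ι) / 2))) * √(2 * Real.pi / b) ^ r) := by
  have hg := gam'_pos
  have hpi := Real.pi_pos
  have h1 := fourier_smooth hb (0 : ι → ℝ) z y
  have h2 := integral_cexp_gauss (b := 1 / 2) (by norm_num) (fun k => -y k)
  have hi1 : Integrable fun ξ : Fin r → ℝ => Complex.exp (Complex.I * (∑ k, -y k * ξ k : ℝ)) *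
      (Real.exp (-(b * q ξ)) : ℂ) * cf 0 z ξ := by
    refine (integrable_gauss_cexp hb _).mul_bdd (c := 1)
      (continuous_cf 0 z).aestronglyMeasurable (Filter.Eventually.of_forall fun ξ => ?_)
    have := norm_cf_le_exp (0 : ι → ℝ) z ξ
    simpa [q] using this
  have hi2 := integrable_gauss_cexp (r := r) (b := 1 / 2) (by norm_num) (fun k => -y k)
  have hd : ‖((√(Real.pi / b) ^ r * ev (fun X : ι → Bool => Real.exp (dot X 0) *
        Real.exp (-(q (fun k => dot X (z k) - y k) / (4 * b)))) : ℝ) : ℂ) -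
        (√(Real.pi / (1 / 2)) ^ r * Real.exp (-(q (fun k => -y k) / (4 * (1 / 2)))) : ℝ)‖ ≤
      ∫ ξ : Fin r → ℝ, ((η ^ 2 * K ^ 2 + b * K) * Real.exp 1 * Real.exp (-(1 / K * q ξ)) +
      2 * Real.exp (-(gam' * K / 2)) * Real.exp (-(gam' / 2 * q ξ)) +
      (Real.exp (-(sal ^ 2 * Fintype.card ι / 2)) +
        Real.exp (-(b * Real.exp (c * Fintype.card ι) / 2))) * Real.exp (-(b / 2 * q ξ))) := by
    rw [h1, ← h2, ← integral_sub hi1 hi2]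
    refine norm_integral_le_of_norm_le ?_ (Filter.Eventually.of_forall fun ξ => ?_)
    · exact (((integrable_exp_neg_q (by positivity)).const_mul _).add
        ((integrable_exp_neg_q (by positivity)).const_mul _)).add
        ((integrable_exp_neg_q (by positivity)).const_mul _)
    · rw [mul_assoc, ← mul_sub, norm_mul, mul_comm Complex.I, Complex.norm_exp_ofReal_mul_I,
        one_mul]
      exact norm_smoothed_cf_sub_le hG hD hK hη hb hz hker ξ
  rw [integral_three_exp (by positivity) (by positivity) (by positivity), ← Complex.ofReal_sub,
    Complex.norm_real, Real.norm_eq_abs] at hd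
  have h3 := (abs_le.1 hd).2
  have h4 : ∀ X : ι → Bool, dot X 0 = 0 := fun X => by simp [dot]
  have h5 : q (fun k => -y k) = q y := by simp [q]
  have e1 : Real.pi / (1 / 2) = 2 * Real.pi := by ring
  have e2 : Real.pi / (1 / K) = Real.pi * K := by field_simp
  have e3 : Real.pi / (gam' / 2) = 2 * Real.pi / gam' := by field_simp
  have e4 : Real.pi / (b / 2) = 2 * Real.pi / b := by field_simp
  simp only [h4, h5, Real.exp_zero, one_mul, e1, e2, e3, e4,
    show (4 : ℝ) * (1 / 2) = 2 by norm_num] at h3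
  linarith

end Density

lemma exists_density_params (s : ℕ) {p : ℝ} (hp : 0 < p) :
    ∃ η K : ℝ, 0 < η ∧ 0 < K ∧ η ^ 2 * K ≤ 1 ∧
      2 * Real.exp (-(gam' * K / 2)) * √(2 * Real.pi / gam') ^ s ≤ p / 4 ∧
      η ^ 2 * K ^ 2 * (Real.exp 1 * √(Real.pi * K) ^ s) ≤ p / 4 := by
  have hg := gam'_pos
  have hpi := Real.pi_pos
  obtain ⟨A, hA⟩ : ∃ A, A = √(2 * Real.pi / gam') ^ s := ⟨_, rfl⟩
  have hA0 : 0 ≤ A := by rw [hA]; positivity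
  obtain ⟨K, hK⟩ : ∃ K, K = 1 + 16 * A / (gam' * p) := ⟨_, rfl⟩
  have hK0 : 0 < K := by rw [hK]; positivity
  have hK2 : 2 * Real.exp (-(gam' * K / 2)) * A ≤ p / 4 := by
    have h1 : 0 < gam' * K / 2 := by positivity
    have h2 : Real.exp (-(gam' * K / 2)) ≤ 2 / (gam' * K) := by
      rw [Real.exp_neg, show 2 / (gam' * K) = (gam' * K / 2)⁻¹ from (inv_div _ _).symm]
      refine inv_anti₀ h1 ?_
      linarith [Real.add_one_le_exp (gam' * K / 2)]
    have h3 : 16 * A ≤ gam' * p * K := by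
      rw [hK, mul_add, mul_div_cancel₀ _ (by positivity : gam' * p ≠ 0)]
      have : 0 < gam' * p := by positivity
      linarith
    calc _ ≤ 2 * (2 / (gam' * K)) * A := by gcongr
      _ ≤ p / 4 := by
        rw [← mul_div_assoc, div_mul_eq_mul_div, div_le_div_iff₀ (by positivity) (by norm_num)]
        linarith
  obtain ⟨G, hG⟩ : ∃ G, G = Real.exp 1 * √(Real.pi * K) ^ s := ⟨_, rfl⟩
  have hG0 : 0 < G := by have := Real.sqrt_pos.2 (mul_pos hpi hK0); rw [hG]; positivity
  rw [← hA]
  refine ⟨√(min (1 / K) (p / 4 / (K ^ 2 * G))), K, Real.sqrt_pos.2 (lt_min (by positivity)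
      (by positivity)), hK0, ?_, hK2, ?_⟩
  · rw [Real.sq_sqrt (le_min (by positivity) (by positivity)), ← le_div_iff₀ hK0]
    exact min_le_left _ _
  · rw [← hG, Real.sq_sqrt (le_min (by positivity) (by positivity)), mul_assoc,
        ← le_div_iff₀ (by positivity)]
    exact min_le_right _ _

/-- The smoothed law of the projection of a random sign vector is dominated by the Gaussian. -/
theorem density_bound (s : ℕ) {c : ℝ} (hc : 0 < c) {p : ℝ} (hp : 0 < p) :
    ∃ η : ℝ, 0 < η ∧ ∃ c' : ℝ, 0 < c' ∧ ∃ N0 : ℕ,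
    ∀ (ι κ : Type) [Fintype ι] [DecidableEq ι] [Fintype κ] [DecidableEq κ] (D : κ → ι → Bool),
    N0 ≤ Fintype.card ι → Good (sal ^ 2) c D → Deloc η D → ∀ z : Fin s → ι → ℝ, OrthoN z →
    (∀ k, im D (z k) = 0) → ∀ y : Fin s → ℝ,
    (√(2 * Real.pi) * Real.exp (-c' * Fintype.card ι))⁻¹ ^ s * ev (fun X : ι → Bool => 
      Real.exp (-(q (fun k => dot X (z k) - y k) / (2 * Real.exp (-c' * Fintype.card ι) ^ 2)))) ≤
      (√(2 * Real.pi))⁻¹ ^ s * Real.exp (-(q y / 2)) + p := by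
  have hs := sal_pos
  have hg := gam'_pos
  have hpi := Real.pi_pos
  obtain ⟨W, hW⟩ : ∃ W, W = √(2 * Real.pi) := ⟨_, rfl⟩
  have hW0 : 0 < W := hW ▸ Real.sqrt_pos.2 (by positivity)
  obtain ⟨p', hp'⟩ : ∃ p', p' = W ^ s * W ^ s * p := ⟨_, rfl⟩
  have hp'0 : 0 < p' := by rw [hp']; positivity
  obtain ⟨η, K, hη0, hK0, hη1, hK2, hη2⟩ := exists_density_params s hp'0
  obtain ⟨G, hG⟩ : ∃ G, G = Real.exp 1 * √(Real.pi * K) ^ s := ⟨_, rfl⟩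
  rw [← hG] at hη2
  have hG0 : 0 < G := by have := Real.sqrt_pos.2 (mul_pos hpi hK0); rw [hG]; positivity
  obtain ⟨c', hc'⟩ : ∃ c', c' = min (c / 4) (sal ^ 2 / 4 / (s + 1)) := ⟨_, rfl⟩
  have hc'0 : 0 < c' := hc' ▸ lt_min (by positivity) (by positivity)
  have hc'1 : c' ≤ c / 4 := hc' ▸ min_le_left _ _
  have hc'2 : c' * s ≤ sal ^ 2 / 4 := by
    have : c' * (s + 1) ≤ sal ^ 2 / 4 := by
      rw [← le_div_iff₀ (by positivity), hc']; exact min_le_right _ _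
    linarith
  obtain ⟨A', hA'⟩ : ∃ A', A' = 2 * √(4 * Real.pi) ^ s := ⟨_, rfl⟩
  have hev : ∀ᶠ N : ℝ in Filter.atTop, Real.exp (-(2 * c') * N) * (K * G) < p' / 4 ∧
      A' * Real.exp (-(sal ^ 2 / 4) * N) < p' / 4 ∧ 16 * sal ^ 2 / c ^ 2 ≤ N := by
    have ht : ∀ a : ℝ, 0 < a → Filter.Tendsto (fun N : ℝ => Real.exp (-a * N)) Filter.atTop (nhds 0) :=
      fun a ha => Real.tendsto_exp_atBot.comp
        (Filter.tendsto_id.const_mul_atTop_of_neg (neg_lt_zero.2 ha))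
    have t1 := (ht (2 * c') (by positivity)).mul_const (K * G)
    have t2 := (ht (sal ^ 2 / 4) (by positivity)).const_mul A'
    rw [zero_mul] at t1
    rw [mul_zero] at t2
    exact (t1.eventually_lt_const (by positivity)).and
      ((t2.eventually_lt_const (by positivity)).and (Filter.eventually_ge_atTop _))
  obtain ⟨N1, hN1⟩ := Filter.eventually_atTop.1 hev
  refine ⟨η, hη0, c', hc'0, ⌈N1⌉₊, ?_⟩
  intro ι κ _ _ _ _ D hN hGd hD z hz hker y
  obtain ⟨n1, n2, n3⟩ := hN1 (Fintype.card ι) (Nat.ceil_le.1 hN)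
  obtain ⟨N, hNdef⟩ : ∃ N : ℝ, N = (Fintype.card ι : ℝ) := ⟨_, rfl⟩
  obtain ⟨τ, hτ⟩ : ∃ τ, τ = Real.exp (-c' * N) := ⟨_, rfl⟩
  rw [← hNdef] at n1 n2 n3 ⊢
  rw [← hτ, ← hW]
  have hN0 : 0 ≤ N := hNdef ▸ Nat.cast_nonneg _
  have hτ0 : 0 < τ := hτ ▸ Real.exp_pos _
  have hτ2 : τ ^ 2 = Real.exp (-(2 * c') * N) := by
    rw [hτ, ← Real.exp_nat_mul]; congr 1; push_cast; ring
  have hτs : τ⁻¹ ^ s = Real.exp (c' * s * N) := by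
    rw [hτ, ← Real.exp_neg, ← Real.exp_nat_mul]; congr 1; ring
  have hmain := smoothed_density_le hGd hD hK0 hη1 (b := τ ^ 2 / 2) (by positivity) hz hker y
  have e1 : √(Real.pi / (τ ^ 2 / 2)) = W * τ⁻¹ := by
    rw [hW, show Real.pi / (τ ^ 2 / 2) = 2 * Real.pi / τ ^ 2 by field_simp,
      Real.sqrt_div (by positivity), Real.sqrt_sq hτ0.le, div_eq_mul_inv]
  have e2 : √(2 * Real.pi / (τ ^ 2 / 2)) = √(4 * Real.pi) * τ⁻¹ := by
    rw [show 2 * Real.pi / (τ ^ 2 / 2) = 4 * Real.pi / τ ^ 2 by field_simp; ring,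
      Real.sqrt_div (by positivity), Real.sqrt_sq hτ0.le, div_eq_mul_inv]
  have e3 : 4 * (τ ^ 2 / 2) = 2 * τ ^ 2 := by ring
  rw [e1, e2, e3, ← hW, ← hNdef] at hmain
  have hE : Real.exp (-(τ ^ 2 / 2 * Real.exp (c * N) / 2)) ≤ Real.exp (-(sal ^ 2 * N / 2)) := by
    refine Real.exp_le_exp.2 (neg_le_neg ?_)
    have h1 : (c * N / 2) ^ 2 / 2 ≤ Real.exp (c * N / 2) := by
      have := Real.quadratic_le_exp_of_nonneg (x := c * N / 2) (by positivity)
      have : 0 ≤ c * N / 2 := by positivity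
      linarith
    have h2 : Real.exp (c * N / 2) ≤ τ ^ 2 * Real.exp (c * N) := by
      rw [hτ2, ← Real.exp_add]
      exact Real.exp_le_exp.2 (by nlinarith)
    rw [div_le_iff₀ (by positivity)] at n3
    have h3 : sal ^ 2 * 16 * N ≤ c ^ 2 * N * N := by
      have := mul_le_mul_of_nonneg_right n3 hN0
      linarith
    linarith [h1.trans h2]
  have hlast : (Real.exp (-(sal ^ 2 * N / 2)) + Real.exp (-(τ ^ 2 / 2 * Real.exp (c * N) / 2))) *
      (√(4 * Real.pi) * τ⁻¹) ^ s ≤ p' / 4 := by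
    rw [mul_pow, hτs]
    calc _ ≤ (Real.exp (-(sal ^ 2 * N / 2)) + Real.exp (-(sal ^ 2 * N / 2))) *
          (√(4 * Real.pi) ^ s * Real.exp (sal ^ 2 / 4 * N)) := by gcongr
      _ = A' * (Real.exp (-(sal ^ 2 * N / 2)) * Real.exp (sal ^ 2 / 4 * N)) := by rw [hA']; ring
      _ = A' * Real.exp (-(sal ^ 2 / 4) * N) := by rw [← Real.exp_add]; congr 2; ring
      _ ≤ _ := n2.le
  have hfirst : (η ^ 2 * K ^ 2 + τ ^ 2 / 2 * K) * Real.exp 1 * √(Real.pi * K) ^ s ≤ p' / 2 := by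
    rw [mul_assoc, ← hG, add_mul]
    rw [← hτ2] at n1
    have : 0 < τ ^ 2 * (K * G) := by positivity
    linarith
  have hfin : (W * τ⁻¹) ^ s * ev (fun X : ι → Bool => 
      Real.exp (-(q (fun k => dot X (z k) - y k) / (2 * τ ^ 2)))) ≤
      W ^ s * Real.exp (-(q y / 2)) + p' := by linarith
  have hmul := mul_le_mul_of_nonneg_left hfin (by positivity : 0 ≤ W⁻¹ ^ s * W⁻¹ ^ s)
  have hWW : W⁻¹ ^ s * W ^ s = 1 := by rw [← mul_pow, inv_mul_cancel₀ hW0.ne', one_pow]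
  calc _ = W⁻¹ ^ s * (W⁻¹ ^ s * W ^ s) * τ⁻¹ ^ s * ev (fun X : ι → Bool => 
      Real.exp (-(q (fun k => dot X (z k) - y k) / (2 * τ ^ 2)))) := by
        rw [hWW, mul_inv, mul_pow]; ring
    _ ≤ W⁻¹ ^ s * W⁻¹ ^ s * (W ^ s * Real.exp (-(q y / 2)) + p') := by
        refine le_trans (le_of_eq ?_) hmul
        rw [mul_pow]; ring
    _ = W⁻¹ ^ s * (W⁻¹ ^ s * W ^ s) * Real.exp (-(q y / 2)) +
          (W⁻¹ ^ s * W ^ s) * (W⁻¹ ^ s * W ^ s) * p := by rw [hp']; ring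
    _ = _ := by rw [hWW]; ring

end LSV

namespace LSV

open Finset MeasureTheory Matrix
open scoped ENNReal

section Rotation

lemma lintegral_cons {V : Type*} [MeasureSpace V] [SigmaFinite (volume : Measure V)] {k : ℕ}
    {F : (Fin (k + 1) → V) → ℝ≥0∞} (hF : Measurable F) :
    ∫⁻ M, F M = ∫⁻ x : V, ∫⁻ H : Fin k → V, F (Fin.cons x H) := by
  have h := (volume_preserving_piFinSuccAbove (fun _ : Fin (k + 1) => V) 0).symm
  rw [← h.lintegral_comp hF]
  refine (lintegral_prod (μ := (volume : Measure V)) (ν := (volume : Measure (Fin k → V))) _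
    (hF.comp h.measurable).aemeasurable).trans ?_
  refine lintegral_congr fun x => lintegral_congr fun H => ?_
  simp [Fin.insertNthEquiv, Fin.insertNth_zero']

lemma measurePreserving_of_comp_eq {E : Type*} [NormedAddCommGroup E] [NormedSpace ℝ E]
    [MeasureSpace E] [BorelSpace E] [FiniteDimensional ℝ E]
    [(volume : Measure E).IsAddHaarMeasure] {Q : E → ℝ} (hc : Continuous Q) (h0 : Q 0 = 0)
    (hn : ∀ x, ‖x‖ ^ 2 ≤ Q x) (L : E →ₗ[ℝ] E) (hL : ∀ x, Q (L x) = Q x) :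
    MeasurePreserving L volume volume := by
  have hinj : Function.Injective L := by
    rw [injective_iff_map_eq_zero]
    intro x hx
    have h1 := hL x
    rw [hx, h0] at h1
    have h2 := hn x
    rw [← h1] at h2
    exact norm_eq_zero.1 (pow_eq_zero_iff two_ne_zero |>.1 (le_antisymm h2 (sq_nonneg _)))
  have hdet : LinearMap.det L ≠ 0 := by
    have := (LinearEquiv.ofInjectiveEndo L hinj).isUnit_det'
    exact this.ne_zero
  have hpre : L ⁻¹' {x | Q x < 1} = {x | Q x < 1} := by
    ext x
    simp [hL]
  have hvol := Measure.addHaar_preimage_linearMap volume hdet {x | Q x < 1}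
  rw [hpre] at hvol
  have hpos : (volume {x | Q x < 1} : ℝ≥0∞) ≠ 0 :=
    ((isOpen_lt hc continuous_const).measure_pos volume ⟨0, by simp [h0]⟩).ne'
  have hfin : (volume {x | Q x < 1} : ℝ≥0∞) ≠ ⊤ := by
    refine ((measure_mono fun x hx => ?_).trans_lt
      (measure_closedBall_lt_top (x := (0 : E)) (r := 1))).ne
    rw [mem_closedBall_zero_iff]
    have := hn x
    have hx : Q x < 1 := hx
    nlinarith [norm_nonneg x]
  have h1 : ENNReal.ofReal |(LinearMap.det L)⁻¹| = 1 := by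
    have := hvol.symm
    rwa [ENNReal.mul_eq_right hpos hfin] at this
  refine ⟨L.continuous_of_finiteDimensional.measurable, ?_⟩
  rw [Measure.map_linearMap_addHaar_eq_smul_addHaar volume hdet, h1, one_smul]

variable {m : ℕ}

lemma norm_sq_le_q (x : Fin m → ℝ) : ‖x‖ ^ 2 ≤ q x := by
  have h : ‖x‖ ≤ √(q x) := (pi_norm_le_iff_of_nonneg (Real.sqrt_nonneg _)).2 fun i => by
    rw [Real.norm_eq_abs]
    exact Real.abs_le_sqrt (sq_le_q x i)
  calc _ ≤ √(q x) ^ 2 := by gcongr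
    _ = _ := Real.sq_sqrt (q_nonneg x)

/-- Orthogonality of a square matrix. -/
def Orth (R : Matrix (Fin m) (Fin m) ℝ) : Prop := R * Rᵀ = 1

variable {R : Matrix (Fin m) (Fin m) ℝ}

lemma Orth.symm (hR : Orth R) : Rᵀ * R = 1 := mul_eq_one_comm.1 hR

lemma q_eq_dotProduct (x : Fin m → ℝ) : q x = x ⬝ᵥ x := by simp [q, dotProduct, sq]

lemma Orth.dotProduct_mulVec (hR : Orth R) (x y : Fin m → ℝ) : (R *ᵥ x) ⬝ᵥ (R *ᵥ y) = x ⬝ᵥ y := by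
  rw [Matrix.dotProduct_mulVec, ← mulVec_transpose, mulVec_mulVec, hR.symm, one_mulVec]

lemma Orth.q_mulVec (hR : Orth R) (x : Fin m → ℝ) : q (R *ᵥ x) = q x := by
  rw [q_eq_dotProduct, q_eq_dotProduct, hR.dotProduct_mulVec]

lemma continuous_q' : Continuous (q : (Fin m → ℝ) → ℝ) := continuous_q

lemma Orth.measurePreserving_mulVec (hR : Orth R) :
    MeasurePreserving (fun x : Fin m → ℝ => R *ᵥ x) volume volume :=
  measurePreserving_of_comp_eq continuous_q' (by simp [q]) norm_sq_le_q (Matrix.mulVecLin R)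
    hR.q_mulVec

lemma sum_q_mul {a b : ℕ} {R : Matrix (Fin a) (Fin a) ℝ} (hR : Orth R)
    (M : Matrix (Fin a) (Fin b) ℝ) : ∑ j, q ((R * M) j) = ∑ j, q (M j) := by
  have h : ∀ M : Matrix (Fin a) (Fin b) ℝ, ∑ j, q (M j) = ∑ i, q (fun j => M j i) := fun M => by
    simp only [q]
    exact sum_comm
  rw [h, h]
  refine sum_congr rfl fun i _ => ?_
  exact hR.q_mulVec fun j => M j i

/-- Left multiplication by a matrix, as a linear map on families of vectors. -/
def rmul {a b : ℕ} (R : Matrix (Fin a) (Fin a) ℝ) : (Fin a → Fin b → ℝ) →ₗ[ℝ] (Fin a → Fin b → ℝ) where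
  toFun M := fun i => (R * of M : Matrix (Fin a) (Fin b) ℝ) i
  map_add' M N := Matrix.mul_add R (of M) (of N)
  map_smul' c M := Matrix.mul_smul R c (of M)

lemma Orth.measurePreserving_mul {a b : ℕ} {R : Matrix (Fin a) (Fin a) ℝ} (hR : Orth R) :
    MeasurePreserving (rmul (b := b) R) volume volume := by
  refine measurePreserving_of_comp_eq (Q := fun M : Fin a → Fin b → ℝ => ∑ j, q (M j))
    (continuous_finsetSum _ fun j _ => continuous_q'.comp (continuous_apply j)) (by simp [q])
    (fun M => ?_) _ (fun M => sum_q_mul hR (of M))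
  have h0 : 0 ≤ ∑ j, q (M j) := sum_nonneg fun j _ => q_nonneg _
  have h : ‖M‖ ≤ √(∑ j, q (M j)) := (pi_norm_le_iff_of_nonneg (Real.sqrt_nonneg _)).2 fun i => by
    refine Real.le_sqrt_of_sq_le ((norm_sq_le_q (M i)).trans ?_)
    exact single_le_sum (f := fun j => q (M j)) (fun j _ => q_nonneg _) (mem_univ i)
  calc _ ≤ √(∑ j, q (M j)) ^ 2 := by gcongr
    _ = _ := Real.sq_sqrt h0

lemma exists_orth {k : ℕ} (g : Fin (k + 1) → ℝ) :
    ∃ R : Matrix (Fin (k + 1)) (Fin (k + 1)) ℝ, Orth R ∧ R *ᵥ g = √(q g) • Pi.single 0 1 := by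
  by_cases hg : g = 0
  · exact ⟨1, by simp [Orth], by simp [hg, q]⟩
  have hq : 0 < q g := lt_of_le_of_ne (q_nonneg g) fun h => hg (q_eq_zero.1 h.symm)
  have hs : 0 < √(q g) := Real.sqrt_pos.2 hq
  obtain ⟨z, hz, hz'⟩ := exists_orthonormal (r := k) (fun _ : Unit => g) (by simp; omega)
  have hz' : ∀ j, g ⬝ᵥ z j = 0 := fun j => hz' () j
  have hz : ∀ i j, z i ⬝ᵥ z j = if i = j then 1 else 0 := hz
  have hgg : g ⬝ᵥ g = √(q g) * √(q g) := by rw [← q_eq_dotProduct, Real.mul_self_sqrt hq.le]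
  refine ⟨of (Fin.cons ((√(q g))⁻¹ • g) z), ?_, ?_⟩
  · ext i j
    have : (of (Fin.cons ((√(q g))⁻¹ • g) z) * (of (Fin.cons ((√(q g))⁻¹ • g) z))ᵀ :
        Matrix (Fin (k + 1)) (Fin (k + 1)) ℝ) i j =
        (Fin.cons ((√(q g))⁻¹ • g) z : Fin (k + 1) → Fin (k + 1) → ℝ) i ⬝ᵥ
        (Fin.cons ((√(q g))⁻¹ • g) z : Fin (k + 1) → Fin (k + 1) → ℝ) j := rfl
    rw [this]
    refine Fin.cases ?_ (fun i => ?_) i <;> refine Fin.cases ?_ (fun j => ?_) j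
    · simp only [Fin.cons_zero, smul_dotProduct, dotProduct_smul, hgg, smul_eq_mul, one_apply_eq]
      field_simp
    · simp [hz', (Fin.succ_ne_zero j).symm]
    · simp [dotProduct_comm (z i) g, hz']
    · simp [hz, one_apply]
  · ext i
    have : (of (Fin.cons ((√(q g))⁻¹ • g) z : Fin (k + 1) → Fin (k + 1) → ℝ) *ᵥ g) i =
      (Fin.cons ((√(q g))⁻¹ • g) z : Fin (k + 1) → Fin (k + 1) → ℝ) i ⬝ᵥ g := rfl
    rw [this]
    refine Fin.cases ?_ (fun i => ?_) i
    · simp only [Fin.cons_zero, smul_dotProduct, hgg, smul_eq_mul]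
      simp only [Pi.smul_apply, Pi.single_eq_same, smul_eq_mul, mul_one]
      field_simp
    · simp [dotProduct_comm (z i) g, hz']

end Rotation

section Weights

variable {m k : ℕ}

/-- The Gaussian weight of a vector. -/
noncomputable def gw (x : Fin m → ℝ) : ℝ≥0∞ := ENNReal.ofReal (Real.exp (-(q x / 2)))

/-- The Gaussian weight of a family of vectors. -/
noncomputable def gW {a b : ℕ} (M : Fin a → Fin b → ℝ) : ℝ≥0∞ := ∏ j, gw (M j)

lemma measurable_gw : Measurable (gw : (Fin m → ℝ) → ℝ≥0∞) :=
  (Real.continuous_exp.comp (continuous_q'.div_const 2).neg).measurable.ennreal_ofReal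

lemma measurable_gW {a b : ℕ} : Measurable (gW : (Fin a → Fin b → ℝ) → ℝ≥0∞) :=
  Finset.measurable_fun_prod _ fun j _ => measurable_gw.comp (measurable_pi_apply j)

lemma gW_eq {a b : ℕ} (M : Fin a → Fin b → ℝ) :
    gW M = ENNReal.ofReal (Real.exp (-(∑ j, q (M j)) / 2)) := by
  simp only [gW, gw]
  rw [← ENNReal.ofReal_prod_of_nonneg fun _ _ => (Real.exp_pos _).le, ← Real.exp_sum,
    sum_neg_distrib, ← sum_div, neg_div]

lemma gW_cons {a b : ℕ} (x : Fin b → ℝ) (H : Fin a → Fin b → ℝ) :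
    gW (Fin.cons x H : Fin (a + 1) → Fin b → ℝ) = gw x * gW H := by
  simp [gW, Fin.prod_univ_succ]

lemma gw_cons (x : ℝ) (y : Fin k → ℝ) :
    gw (Fin.cons x y : Fin (k + 1) → ℝ) = ENNReal.ofReal (Real.exp (-(x ^ 2 / 2))) * gw y := by
  rw [gw, gw, ← ENNReal.ofReal_mul (Real.exp_pos _).le, ← Real.exp_add]
  congr 2
  simp only [q, Fin.sum_univ_succ, Fin.cons_zero, Fin.cons_succ]
  ring

lemma gw_le_one (x : Fin m → ℝ) : gw x ≤ 1 := by
  rw [gw, ← ENNReal.ofReal_one]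
  have := q_nonneg x
  exact ENNReal.ofReal_le_ofReal (Real.exp_le_one_iff.2 (by linarith))

lemma lintegral_gw : ∫⁻ x : Fin m → ℝ, gw x = ENNReal.ofReal √(2 * Real.pi) ^ m := by
  have h1 := integrable_exp_neg_q (r := m) (b := 1 / 2) (by norm_num)
  have h2 := integral_exp_neg_q (r := m) (1 / 2)
  have h3 : ∀ x : Fin m → ℝ, gw x = ENNReal.ofReal (Real.exp (-(1 / 2 * q x))) := fun x => by
    rw [gw]; congr 3; ring
  simp_rw [h3]
  rw [← ofReal_integral_eq_lintegral_ofReal h1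
    (Filter.Eventually.of_forall fun x => (Real.exp_pos _).le), h2,
    ENNReal.ofReal_pow (Real.sqrt_nonneg _)]
  congr 3
  ring

end Weights

end LSV

namespace LSV

open Finset MeasureTheory Matrix
open scoped ENNReal

section Polar

variable {k : ℕ}

/-- The radial Gaussian moments. -/
noncomputable def J (k : ℕ) : ℝ := ∫ y in Set.Ioi (0 : ℝ), y ^ k * Real.exp (-(y ^ 2 / 2))

lemma J_eq (k : ℕ) : J k = (1 / 2 : ℝ) ^ (-((k : ℝ) + 1) / 2) * (1 / 2) * Real.Gamma ((k + 1) / 2) := by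
  have h := integral_rpow_mul_exp_neg_mul_rpow (p := 2) (q := k) (b := 1 / 2) (by norm_num)
    (by have : (0 : ℝ) ≤ k := Nat.cast_nonneg k
        linarith) (by norm_num)
  rw [← h, J]
  refine setIntegral_congr_fun measurableSet_Ioi fun y _ => ?_
  simp only [Real.rpow_natCast, Real.rpow_two]
  congr 2
  ring

lemma J_pos (k : ℕ) : 0 < J k := by
  rw [J_eq]
  have : 0 < Real.Gamma (((k : ℝ) + 1) / 2) := Real.Gamma_pos_of_pos (by positivity)
  positivity

lemma J_zero : 2 * J 0 = √(2 * Real.pi) := by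
  rw [J_eq]
  simp only [Nat.cast_zero, zero_add]
  rw [Real.Gamma_one_half_eq, show (-1 / 2 : ℝ) = -(1 / 2) by norm_num,
    Real.rpow_neg (by norm_num), ← Real.sqrt_eq_rpow, Real.sqrt_mul (by norm_num),
    Real.sqrt_div (by norm_num), Real.sqrt_one]
  field_simp

lemma J_one : J 1 = 1 := by
  rw [J_eq]
  norm_num

lemma J_add_two (k : ℕ) : J (k + 2) = (k + 1) * J k := by
  rw [J_eq, J_eq]
  have h : (((k + 2 : ℕ) : ℝ) + 1) / 2 = ((k : ℝ) + 1) / 2 + 1 := by push_cast; ring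
  rw [h, Real.Gamma_add_one (by positivity), neg_div, h, neg_add, Real.rpow_add (by norm_num),
    ← neg_div, Real.rpow_neg_one]
  ring

lemma integrableOn_J (k : ℕ) :
    IntegrableOn (fun y : ℝ => y ^ k * Real.exp (-(y ^ 2 / 2))) (Set.Ioi 0) := by
  by_contra h
  have := J_pos k
  rw [J, integral_undef h] at this
  exact lt_irrefl _ this

lemma J_succ_le (k : ℕ) : J (k + 1) ≤ √(k + 1) * J k := by
  have hs : 0 < √((k : ℝ) + 1) := Real.sqrt_pos.2 (by positivity)
  have hss : √((k : ℝ) + 1) * √((k : ℝ) + 1) = k + 1 := Real.mul_self_sqrt (by positivity)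
  have h : 2 * √(k + 1) * J (k + 1) ≤ J (k + 2) + (k + 1) * J k := by
    rw [J, J, J, ← integral_const_mul, ← integral_const_mul, ← integral_add (integrableOn_J _)
      ((integrableOn_J k).const_mul _)]
    refine setIntegral_mono_on ((integrableOn_J _).const_mul _) ((integrableOn_J _).add
      ((integrableOn_J k).const_mul _)) measurableSet_Ioi fun y hy => ?_
    have hy : 0 < y := hy
    have : 0 ≤ y ^ k * Real.exp (-(y ^ 2 / 2)) * (y - √(k + 1)) ^ 2 := by positivity
    have h2 : 2 * √(k + 1) * (y ^ (k + 1) * Real.exp (-(y ^ 2 / 2))) =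
        y ^ (k + 2) * Real.exp (-(y ^ 2 / 2)) +
        √(k + 1) * √(k + 1) * (y ^ k * Real.exp (-(y ^ 2 / 2))) -
        y ^ k * Real.exp (-(y ^ 2 / 2)) * (y - √(k + 1)) ^ 2 := by ring
    rw [h2, hss]
    linarith
  rw [J_add_two] at h
  refine le_of_mul_le_mul_left (a := 2 * √(k + 1)) ?_ (by positivity)
  refine h.trans (le_of_eq ?_)
  linear_combination (-2 * J k) * hss

/-- The volume of the Euclidean unit ball. -/
noncomputable def bvol (m : ℕ) : ℝ := volume.real {x : Fin m → ℝ | q x ≤ 1}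

lemma sqrt_q_eq_norm {m : ℕ} (x : EuclideanSpace ℝ (Fin m)) : √(q x.ofLp) = ‖x‖ := by
  rw [EuclideanSpace.norm_eq]
  simp [q]

lemma bvol_eq (m : ℕ) : bvol m = volume.real (Metric.closedBall (0 : EuclideanSpace ℝ (Fin m)) 1) := by
  have h := PiLp.volume_preserving_ofLp (Fin m)
  rw [bvol, Measure.real, Measure.real, ← h.measure_preimage (measurableSet_le
    continuous_q'.measurable measurable_const).nullMeasurableSet]
  congr 2
  ext x
  rw [mem_closedBall_zero_iff, ← sqrt_q_eq_norm, Real.sqrt_le_left zero_le_one, one_pow]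
  rfl

lemma integral_polar (f : ℝ → ℝ) : ∫ x : Fin (k + 1) → ℝ, f √(q x) =
    (k + 1) * bvol (k + 1) * ∫ y in Set.Ioi (0 : ℝ), y ^ k * f y := by
  have h := PiLp.volume_preserving_ofLp (Fin (k + 1))
  rw [← h.integral_comp (MeasurableEquiv.toLp 2 (Fin (k + 1) → ℝ)).symm.measurableEmbedding]
  simp only [sqrt_q_eq_norm]
  rw [integral_fun_norm_addHaar volume f, bvol_eq, Measure.real, Measure.real,
    Measure.addHaar_unitClosedBall_eq_addHaar_unitBall]
  simp [mul_assoc]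

lemma bvol_mul_J (k : ℕ) : (k + 1) * bvol (k + 1) * J k = √(2 * Real.pi) ^ (k + 1) := by
  have h1 := integral_exp_neg_q (r := k + 1) (1 / 2)
  have h2 := integral_polar (k := k) fun y => Real.exp (-(y ^ 2 / 2))
  rw [J, ← h2, show 2 * Real.pi = Real.pi / (1 / 2) by ring, ← h1]
  congr 1
  funext x
  rw [Real.sq_sqrt (q_nonneg x)]
  congr 1
  ring

lemma lintegral_sqrt_q (k : ℕ) : ENNReal.ofReal (J k) *
    ∫⁻ x : Fin (k + 1) → ℝ, gw x * ENNReal.ofReal √(q x) =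
    ENNReal.ofReal (√(2 * Real.pi) ^ (k + 1) * J (k + 1)) := by
  have h2 := integral_polar (k := k) fun y => Real.exp (-(y ^ 2 / 2)) * y
  have h3 : ∫ y in Set.Ioi (0 : ℝ), y ^ k * (Real.exp (-(y ^ 2 / 2)) * y) = J (k + 1) := by
    rw [J]
    congr 1
    funext y
    ring
  have hb : 0 < bvol (k + 1) := by
    have h := bvol_mul_J k
    have : 0 < √(2 * Real.pi) ^ (k + 1) := pow_pos (Real.sqrt_pos.2 (by positivity)) _
    rw [← h] at this
    by_contra hn
    rw [not_lt] at hn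
    have h1 := J_pos k
    have : (k + 1) * bvol (k + 1) * J k ≤ 0 :=
      mul_nonpos_of_nonpos_of_nonneg (mul_nonpos_of_nonneg_of_nonpos (by positivity) hn) h1.le
    linarith
  have h4 : Integrable fun x : Fin (k + 1) → ℝ => Real.exp (-(√(q x) ^ 2 / 2)) * √(q x) := by
    by_contra hn
    rw [integral_undef hn, h3] at h2
    have := J_pos (k + 1)
    have : 0 < (k + 1) * bvol (k + 1) * J (k + 1) := by positivity
    linarith
  have h5 : ∫⁻ x : Fin (k + 1) → ℝ, gw x * ENNReal.ofReal √(q x) =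
      ENNReal.ofReal ((k + 1) * bvol (k + 1) * J (k + 1)) := by
    rw [← h3, ← h2, ofReal_integral_eq_lintegral_ofReal h4
      (Filter.Eventually.of_forall fun x => by positivity)]
    refine lintegral_congr fun x => ?_
    rw [ENNReal.ofReal_mul (Real.exp_pos _).le, gw, Real.sq_sqrt (q_nonneg x)]
  rw [h5, ← ENNReal.ofReal_mul (J_pos k).le, ← bvol_mul_J]
  congr 1
  ring

end Polar

section Det

variable {k : ℕ}

/-- The Gaussian integral of the absolute determinant. -/
noncomputable def dint (m : ℕ) : ℝ≥0∞ :=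
  ∫⁻ M : Fin m → Fin m → ℝ, ENNReal.ofReal |(of M).det| * gW M

lemma measurable_absdet {m : ℕ} :
    Measurable fun M : Fin m → Fin m → ℝ => ENNReal.ofReal |(of M).det| := by
  have : Continuous fun M : Fin m → Fin m → ℝ => |(of M).det| :=
    (continuous_id.matrix_det (n := Fin m) (R := ℝ) (A := fun M : Matrix (Fin m) (Fin m) ℝ => M)).abs
  exact this.measurable.ennreal_ofReal

lemma measurable_dint_integrand (m : ℕ) : Measurable fun M : Fin m → Fin m → ℝ =>
    ENNReal.ofReal |(of M).det| * gW M := measurable_absdet.mul measurable_gW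

lemma det_cons_single (c : ℝ) (H : Fin k → Fin (k + 1) → ℝ) :
    (of (Fin.cons (c • Pi.single 0 1) H : Fin (k + 1) → Fin (k + 1) → ℝ)).det =
      c * (of fun i j => H i (Fin.succ j)).det := by
  rw [det_succ_row_zero, Finset.sum_eq_single 0]
  · simp only [Fin.val_zero, pow_zero, one_mul, of_apply, Fin.cons_zero, Pi.smul_apply,
      Pi.single_eq_same, smul_eq_mul, mul_one]
    congr 2
  · intro j _ hj
    simp [hj]
  · simp

lemma lintegral_minor : ∫⁻ H : Fin k → Fin (k + 1) → ℝ,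
    ENNReal.ofReal |(of fun i j => H i (Fin.succ j)).det| * gW H =
    ENNReal.ofReal √(2 * Real.pi) ^ k * dint k := by
  let e1 : (Fin k → Fin (k + 1) → ℝ) → (Fin k → ℝ × (Fin k → ℝ)) := fun H i =>
    MeasurableEquiv.piFinSuccAbove (fun _ : Fin (k + 1) => ℝ) 0 (H i)
  have m1 : MeasurePreserving e1 volume volume := volume_preserving_pi fun _ : Fin k =>
    volume_preserving_piFinSuccAbove (fun _ : Fin (k + 1) => ℝ) 0
  have m2 := measurePreserving_arrowProdEquivProdArrow ℝ (Fin k → ℝ) (Fin k)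
    (fun _ => volume) (fun _ => volume)
  have m3 := m2.comp m1
  let F : (Fin k → ℝ) × (Fin k → Fin k → ℝ) → ℝ≥0∞ := fun p =>
    gw p.1 * (ENNReal.ofReal |(of p.2).det| * gW p.2)
  have hF : Measurable F := (measurable_gw.comp measurable_fst).mul
    ((measurable_absdet.comp measurable_snd).mul (measurable_gW.comp measurable_snd))
  have h := m3.lintegral_comp hF
  have h2 : ∫⁻ p, F p ∂((Measure.pi fun _ : Fin k => (volume : Measure ℝ)).prod
      (Measure.pi fun _ : Fin k => (volume : Measure (Fin k → ℝ)))) =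
      ENNReal.ofReal √(2 * Real.pi) ^ k * dint k := by
    refine (lintegral_prod_mul measurable_gw.aemeasurable
      (measurable_dint_integrand k).aemeasurable).trans ?_
    rw [← lintegral_gw]
    rfl
  rw [← h2, ← h]
  refine lintegral_congr fun H => ?_
  have hg : gW H = gw (fun i => H i 0) * gW fun i j => H i (Fin.succ j) := by
    simp only [gW_eq, gw]
    rw [← ENNReal.ofReal_mul (Real.exp_pos _).le, ← Real.exp_add]
    congr 2
    simp only [q, Fin.sum_univ_succ, sum_add_distrib]
    ring
  rw [hg, ← mul_assoc, mul_comm (ENNReal.ofReal _), mul_assoc]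
  rfl

lemma gW_mulVec {a m : ℕ} {R : Matrix (Fin m) (Fin m) ℝ} (hR : Orth R) (H : Fin a → Fin m → ℝ) :
    gW (fun i => R *ᵥ H i) = gW H := by
  simp [gW, gw, hR.q_mulVec]

lemma Orth.abs_det {m : ℕ} {R : Matrix (Fin m) (Fin m) ℝ} (hR : Orth R) : |R.det| = 1 := by
  have h := congrArg det (show R * Rᵀ = 1 from hR)
  rw [det_mul, det_transpose, det_one] at h
  have : |R.det| * |R.det| = 1 := by rw [abs_mul_abs_self, h]
  nlinarith [abs_nonneg R.det]

lemma lintegral_det_cons (g : Fin (k + 1) → ℝ) : ∫⁻ H : Fin k → Fin (k + 1) → ℝ,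
    ENNReal.ofReal |(of (Fin.cons g H : Fin (k + 1) → Fin (k + 1) → ℝ)).det| * gW H =
    ENNReal.ofReal √(q g) * (ENNReal.ofReal √(2 * Real.pi) ^ k * dint k) := by
  obtain ⟨R, hR, hRg⟩ := exists_orth g
  have hmp : MeasurePreserving (fun (H : Fin k → Fin (k + 1) → ℝ) i => R *ᵥ H i) volume volume :=
    volume_preserving_pi fun _ => hR.measurePreserving_mulVec
  have hm : Measurable fun H : Fin k → Fin (k + 1) → ℝ =>
      ENNReal.ofReal |(of fun i j => H i (Fin.succ j)).det| * gW H := by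
    refine Measurable.mul ?_ measurable_gW
    exact measurable_absdet.comp (measurable_pi_lambda _ fun i => measurable_pi_lambda _ fun j =>
      (measurable_pi_apply (Fin.succ j)).comp (measurable_pi_apply i))
  rw [← lintegral_minor, ← lintegral_const_mul _ hm, ← hmp.lintegral_comp (hm.const_mul _)]
  refine lintegral_congr fun H => ?_
  rw [gW_mulVec hR, ← mul_assoc, ← ENNReal.ofReal_mul (Real.sqrt_nonneg _)]
  congr 2
  have h1 : of (Fin.cons g H : Fin (k + 1) → Fin (k + 1) → ℝ) * Rᵀ =
      of (Fin.cons (√(q g) • Pi.single 0 1) fun i => R *ᵥ H i) := by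
    ext i j
    rw [← hRg]
    have : (of (Fin.cons g H : Fin (k + 1) → Fin (k + 1) → ℝ) * Rᵀ) i j =
      (R *ᵥ (Fin.cons g H : Fin (k + 1) → Fin (k + 1) → ℝ) i) j := by
      simp [Matrix.mul_apply, mulVec, dotProduct, mul_comm]
    rw [this]
    refine Fin.cases ?_ (fun i => ?_) i <;> rfl
  have h2 := congrArg (fun A => |det A|) h1
  simp only [det_mul, det_transpose, abs_mul, hR.abs_det, mul_one, det_cons_single] at h2
  rw [h2, abs_of_nonneg (Real.sqrt_nonneg _)]

lemma dint_succ (k : ℕ) : dint (k + 1) = (∫⁻ x : Fin (k + 1) → ℝ, gw x * ENNReal.ofReal √(q x)) *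
    (ENNReal.ofReal √(2 * Real.pi) ^ k * dint k) := by
  rw [dint, lintegral_cons (measurable_dint_integrand (k + 1))]
  have h : ∀ g : Fin (k + 1) → ℝ, ∫⁻ H : Fin k → Fin (k + 1) → ℝ,
      ENNReal.ofReal |(of (Fin.cons g H : Fin (k + 1) → Fin (k + 1) → ℝ)).det| *
        gW (Fin.cons g H : Fin (k + 1) → Fin (k + 1) → ℝ) =
      gw g * ENNReal.ofReal √(q g) * (ENNReal.ofReal √(2 * Real.pi) ^ k * dint k) := fun g => by
    rw [mul_assoc, ← lintegral_det_cons, ← lintegral_const_mul']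
    · refine lintegral_congr fun H => ?_
      rw [gW_cons]
      ring
    · exact ENNReal.ofReal_ne_top
  simp only [h]
  exact lintegral_mul_const _ (measurable_gw.mul continuous_q'.sqrt.measurable.ennreal_ofReal)

lemma dint_eq (k : ℕ) : ENNReal.ofReal √(2 * Real.pi) * dint k =
    2 * ENNReal.ofReal √(2 * Real.pi) ^ (k ^ 2) * ENNReal.ofReal (J k) := by
  induction k with
  | zero =>
    have : dint 0 = 1 := by
      have h : ∀ M : Fin 0 → Fin 0 → ℝ, ENNReal.ofReal |(of M).det| * gW M = 1 := fun M => by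
        simp [gW]
      simp only [dint, h]
      simp [volume_pi]
    rw [this, ← J_zero, ENNReal.ofReal_mul (by norm_num)]
    simp
  | succ k ih =>
    have hJ : ENNReal.ofReal (J k) ≠ 0 := by simpa using J_pos k
    rw [dint_succ]
    have h := lintegral_sqrt_q k
    rw [ENNReal.ofReal_mul (by positivity), ENNReal.ofReal_pow (Real.sqrt_nonneg _)] at h
    calc _ = (∫⁻ x : Fin (k + 1) → ℝ, gw x * ENNReal.ofReal √(q x)) *
          ENNReal.ofReal √(2 * Real.pi) ^ k * (ENNReal.ofReal √(2 * Real.pi) * dint k) := by ring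
      _ = 2 * ENNReal.ofReal √(2 * Real.pi) ^ (k + k ^ 2) * (ENNReal.ofReal (J k) *
          ∫⁻ x : Fin (k + 1) → ℝ, gw x * ENNReal.ofReal √(q x)) := by rw [ih]; ring
      _ = _ := by rw [h]; ring

end Det

end LSV

namespace LSV

open Finset MeasureTheory Matrix
open scoped ENNReal

section Near

variable {m k : ℕ}

/-- The direction `g` is nearly minimized by the row combinations of `M`. -/
def Near (K t : ℝ) (M : Fin m → Fin m → ℝ) (g : Fin m → ℝ) : Prop :=
  (of M).det ≠ 0 ∧ ∃ y, (of M * (of M)ᵀ) *ᵥ y = g ∧ q g * q y ≤ K * (y ⬝ᵥ g) ^ 2 ∧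
    q g ≤ K * t ^ 2 * (y ⬝ᵥ g)

/-- The rows of `M` have a unit combination of norm at most `t`. -/
def Esm (t : ℝ) (M : Fin m → Fin m → ℝ) : Prop := ∃ x, q x = 1 ∧ q (x ᵥ* of M) ≤ t ^ 2

lemma q_smul' (c : ℝ) (x : Fin m → ℝ) : q (c • x) = c ^ 2 * q x := q_smul c x

lemma measurableSet_near (K t : ℝ) :
    MeasurableSet {p : (Fin m → Fin m → ℝ) × (Fin m → ℝ) | Near K t p.1 p.2} := by
  have hA : Continuous fun p : (Fin m → Fin m → ℝ) × (Fin m → ℝ) => of p.1 := continuous_fst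
  have hG : Continuous fun p : (Fin m → Fin m → ℝ) × (Fin m → ℝ) => of p.1 * (of p.1)ᵀ :=
    hA.matrix_mul hA.matrix_transpose
  have hy : Continuous fun p : (Fin m → Fin m → ℝ) × (Fin m → ℝ) =>
      (of p.1 * (of p.1)ᵀ).adjugate *ᵥ p.2 := hG.matrix_adjugate.matrix_mulVec continuous_snd
  have hd := hy.dotProduct continuous_snd
  have hset : {p : (Fin m → Fin m → ℝ) × (Fin m → ℝ) | Near K t p.1 p.2} =
      {p | (of p.1).det ≠ 0} ∩
      ({p | q p.2 * q ((of p.1 * (of p.1)ᵀ).adjugate *ᵥ p.2) ≤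
        K * (((of p.1 * (of p.1)ᵀ).adjugate *ᵥ p.2) ⬝ᵥ p.2) ^ 2} ∩
      {p | (of p.1 * (of p.1)ᵀ).det * q p.2 ≤
        K * t ^ 2 * (((of p.1 * (of p.1)ᵀ).adjugate *ᵥ p.2) ⬝ᵥ p.2)}) := by
    ext ⟨M, g⟩
    change Near K t M g ↔ (of M).det ≠ 0 ∧ (q g * q ((of M * (of M)ᵀ).adjugate *ᵥ g) ≤
        K * (((of M * (of M)ᵀ).adjugate *ᵥ g) ⬝ᵥ g) ^ 2 ∧ (of M * (of M)ᵀ).det * q g ≤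
        K * t ^ 2 * (((of M * (of M)ᵀ).adjugate *ᵥ g) ⬝ᵥ g))
    rw [Near]
    refine and_congr_right fun hdet => ?_
    generalize hB : of M * (of M)ᵀ = B
    have hD : 0 < B.det := by
      rw [← hB, det_mul, det_transpose]
      exact mul_self_pos.2 hdet
    constructor
    · rintro ⟨y, rfl, h1, h2⟩
      rw [mulVec_mulVec, adjugate_mul, smul_mulVec, one_mulVec, q_smul', smul_dotProduct,
        smul_eq_mul]
      constructor
      · nlinarith [mul_le_mul_of_nonneg_left h1 (sq_nonneg B.det)]
      · nlinarith [mul_le_mul_of_nonneg_left h2 hD.le]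
    · rintro ⟨h1, h2⟩
      refine ⟨B.det⁻¹ • (B.adjugate *ᵥ g), ?_, ?_, ?_⟩
      · rw [mulVec_smul, mulVec_mulVec, mul_adjugate, smul_mulVec, one_mulVec, smul_smul,
          inv_mul_cancel₀ hD.ne', one_smul]
      · rw [q_smul', smul_dotProduct, smul_eq_mul]
        have := mul_le_mul_of_nonneg_left h1 (sq_nonneg B.det⁻¹)
        linarith
      · rw [smul_dotProduct, smul_eq_mul]
        have := mul_le_mul_of_nonneg_left h2 (inv_nonneg.2 hD.le)
        rw [← mul_assoc, inv_mul_cancel₀ hD.ne', one_mul] at this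
        linarith
  rw [hset]
  refine ((isOpen_ne_fun hA.matrix_det continuous_const).measurableSet).inter
    (IsClosed.measurableSet ?_ |>.inter (IsClosed.measurableSet ?_))
  · exact isClosed_le ((continuous_q'.comp continuous_snd).mul (continuous_q'.comp hy))
      (continuous_const.mul (hd.pow 2))
  · exact isClosed_le (hG.matrix_det.mul (continuous_q'.comp continuous_snd))
      (continuous_const.mul hd)

lemma isCompact_sphere_q : IsCompact {x : Fin m → ℝ | q x = 1} := by
  refine (isCompact_closedBall (0 : Fin m → ℝ) 1).of_isClosed_subset
    (isClosed_eq continuous_q' continuous_const) fun x hx => ?_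
  have h := norm_sq_le_q x
  rw [show q x = 1 from hx] at h
  rw [mem_closedBall_zero_iff]
  nlinarith [norm_nonneg x]

lemma continuous_q_vecMul : Continuous fun p : (Fin m → ℝ) × (Fin m → Fin m → ℝ) =>
    q (p.1 ᵥ* of p.2) := by
  refine continuous_q'.comp ?_
  exact Continuous.matrix_vecMul (B := fun p : (Fin m → ℝ) × (Fin m → Fin m → ℝ) => of p.2)
    continuous_fst continuous_snd

lemma isClosed_esm (t : ℝ) : IsClosed {M : Fin m → Fin m → ℝ | Esm t M} := by
  have : CompactSpace {x : Fin m → ℝ // q x = 1} := isCompact_iff_compactSpace.1 isCompact_sphere_q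
  have h : IsClosed {p : {x : Fin m → ℝ // q x = 1} × (Fin m → Fin m → ℝ) |
      q ((p.1 : Fin m → ℝ) ᵥ* of p.2) ≤ t ^ 2} :=
    isClosed_le (continuous_q_vecMul.comp (continuous_subtype_val.prodMap continuous_id))
      continuous_const
  convert isClosedMap_snd_of_compactSpace _ h using 1
  ext M
  constructor
  · rintro ⟨x, hx, hM⟩
    exact ⟨(⟨x, hx⟩, M), hM, rfl⟩
  · rintro ⟨⟨⟨x, hx⟩, M'⟩, hM, rfl⟩
    exact ⟨x, hx, hM⟩

lemma exists_minimizer (A : Matrix (Fin m) (Fin m) ℝ) {x : Fin m → ℝ} (hx : q x = 1) :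
    ∃ v, q v = 1 ∧ q (v ᵥ* A) ≤ q (x ᵥ* A) ∧ ∀ y, q (v ᵥ* A) * q y ≤ q (y ᵥ* A) := by
  have hc : Continuous fun y : Fin m → ℝ => q (y ᵥ* A) :=
    continuous_q_vecMul.comp (continuous_id.prodMk (continuous_const (y := (A : Fin m → Fin m → ℝ))))
  obtain ⟨v, hv, hmin⟩ := isCompact_sphere_q.exists_isMinOn ⟨x, hx⟩ hc.continuousOn
  refine ⟨v, hv, hmin hx, fun y => ?_⟩
  by_cases hy : y = 0
  · simp [hy, q]
  have hq : 0 < q y := lt_of_le_of_ne (q_nonneg y) fun h => hy (q_eq_zero.1 h.symm)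
  have h1 : q ((√(q y))⁻¹ • y) = 1 := by
    rw [q_smul', inv_pow, Real.sq_sqrt hq.le, inv_mul_cancel₀ hq.ne']
  have h2 : q (v ᵥ* A) ≤ q (((√(q y))⁻¹ • y) ᵥ* A) := hmin h1
  rw [smul_vecMul, q_smul', inv_pow, Real.sq_sqrt hq.le] at h2
  calc _ ≤ (q y)⁻¹ * q (y ᵥ* A) * q y := by gcongr
    _ = _ := by field_simp

lemma near_of_esm {K t : ℝ} (hK : 0 ≤ K) {M : Fin m → Fin m → ℝ} (hM : Esm t M)
    (hdet : (of M).det ≠ 0) : ∃ v, q v = 1 ∧ ∀ g, q g ≤ K * (g ⬝ᵥ v) ^ 2 → Near K t M g := by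
  obtain ⟨x, hx, hxM⟩ := hM
  obtain ⟨v, hv, hvx, hmin⟩ := exists_minimizer (of M) hx
  refine ⟨v, hv, fun g hg => ⟨hdet, ?_⟩⟩
  generalize of M = A at *
  have hu : IsUnit (A * Aᵀ).det := by
    rw [det_mul, det_transpose]
    exact (mul_ne_zero hdet hdet).isUnit
  refine ⟨(A * Aᵀ)⁻¹ *ᵥ g, ?_, ?_⟩
  · rw [mulVec_mulVec, mul_nonsing_inv _ hu, one_mulVec]
  generalize hy : (A * Aᵀ)⁻¹ *ᵥ g = y
  have hyg : (A * Aᵀ) *ᵥ y = g := by rw [← hy, mulVec_mulVec, mul_nonsing_inv _ hu, one_mulVec]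
  have h0 : ∀ u, u ⬝ᵥ g = (u ᵥ* A) ⬝ᵥ (y ᵥ* A) := fun u => by
    rw [← hyg, ← mulVec_mulVec, mulVec_transpose, Matrix.dotProduct_mulVec]
  have hp : y ⬝ᵥ g = q (y ᵥ* A) := by rw [h0, q_eq_dotProduct]
  have hcs : (g ⬝ᵥ v) ^ 2 ≤ q (v ᵥ* A) * q (y ᵥ* A) := by
    rw [dotProduct_comm, h0]
    exact sq_sum_mul_le _ _
  rw [hp]
  have hm := hmin y
  have q1 := q_nonneg y
  have q2 := q_nonneg (y ᵥ* A)
  have q3 := q_nonneg (v ᵥ* A)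
  constructor
  · calc q g * q y ≤ K * (q (v ᵥ* A) * q (y ᵥ* A)) * q y := by gcongr; exact hg.trans (by gcongr)
      _ = K * (q (y ᵥ* A) * (q (v ᵥ* A) * q y)) := by ring
      _ ≤ K * (q (y ᵥ* A) * q (y ᵥ* A)) := by gcongr
      _ = _ := by ring
  · calc q g ≤ K * (q (v ᵥ* A) * q (y ᵥ* A)) := hg.trans (by gcongr)
      _ ≤ K * (t ^ 2 * q (y ᵥ* A)) := by gcongr; exact hvx.trans hxM
      _ = _ := by ring

lemma Near.rotate {K t c : ℝ} {M : Fin m → Fin m → ℝ} {g e : Fin m → ℝ} (h : Near K t M g)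
    {R : Matrix (Fin m) (Fin m) ℝ} (hR : Orth R) (hc : c ≠ 0) (hg : R *ᵥ g = c • e) :
    Near K t (rmul R M) e := by
  obtain ⟨h1, y, h2, h3, h4⟩ := h
  have hRM : of (rmul R M) = R * of M := rfl
  have hge : g ⬝ᵥ y = c * (e ⬝ᵥ (R *ᵥ y)) := by
    rw [← hR.dotProduct_mulVec, hg, smul_dotProduct, smul_eq_mul]
  have hq : q g = c ^ 2 * q e := by rw [← hR.q_mulVec, hg, q_smul']
  rw [dotProduct_comm, hge, hq] at h3 h4
  have hc2 : 0 < c ^ 2 := by positivity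
  refine ⟨?_, c⁻¹ • (R *ᵥ y), ?_, ?_, ?_⟩
  · rw [hRM, det_mul]
    refine mul_ne_zero (fun h => ?_) h1
    have := hR.abs_det
    simp [h] at this
  · rw [hRM, transpose_mul, mulVec_smul, mulVec_mulVec]
    have : R * of M * ((of M)ᵀ * Rᵀ) * R = R * (of M * (of M)ᵀ) := by
      rw [Matrix.mul_assoc, Matrix.mul_assoc, Matrix.mul_assoc, hR.symm, Matrix.mul_one]
    rw [this, ← mulVec_mulVec, h2, hg, smul_smul, inv_mul_cancel₀ hc, one_smul]
  · rw [q_smul', hR.q_mulVec, smul_dotProduct, smul_eq_mul, dotProduct_comm]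
    have h5 := mul_le_mul_of_nonneg_left h3 (sq_nonneg c⁻¹)
    have h6 := mul_le_mul_of_nonneg_left h5 (sq_nonneg c⁻¹)
    have e1 : c⁻¹ ^ 2 * (c⁻¹ ^ 2 * (c ^ 2 * q e * q y)) = q e * (c⁻¹ ^ 2 * q y) := by field_simp
    have e2 : c⁻¹ ^ 2 * (c⁻¹ ^ 2 * (K * (c * (e ⬝ᵥ R *ᵥ y)) ^ 2)) =
      K * (c⁻¹ * (e ⬝ᵥ R *ᵥ y)) ^ 2 := by field_simp
    rwa [e1, e2] at h6
  · rw [smul_dotProduct, smul_eq_mul, dotProduct_comm]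
    have h5 := mul_le_mul_of_nonneg_left h4 (sq_nonneg c⁻¹)
    have e1 : c⁻¹ ^ 2 * (c ^ 2 * q e) = q e := by field_simp
    have e2 : c⁻¹ ^ 2 * (K * t ^ 2 * (c * (e ⬝ᵥ R *ᵥ y))) = K * t ^ 2 * (c⁻¹ * (e ⬝ᵥ R *ᵥ y)) := by
      field_simp
    rwa [e1, e2] at h5

end Near

end LSV

namespace LSV

open Finset MeasureTheory Matrix
open scoped ENNReal Pointwise

section Slab

variable {k : ℕ}

lemma vecMul_cons (c : Fin (k + 1) → ℝ) (x : Fin (k + 1) → ℝ) (H : Fin k → Fin (k + 1) → ℝ) :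
    c ᵥ* of (Fin.cons x H : Fin (k + 1) → Fin (k + 1) → ℝ) = c 0 • x + ∑ j, c j.succ • H j := by
  ext i
  simp [vecMul, dotProduct, Fin.sum_univ_succ]

lemma mulVec_cons_zero (u x : Fin (k + 1) → ℝ) (H : Fin k → Fin (k + 1) → ℝ) :
    (of (Fin.cons x H : Fin (k + 1) → Fin (k + 1) → ℝ) *ᵥ u) 0 = x ⬝ᵥ u := rfl

lemma mulVec_cons_succ (u x : Fin (k + 1) → ℝ) (H : Fin k → Fin (k + 1) → ℝ) (j : Fin k) :
    (of (Fin.cons x H : Fin (k + 1) → Fin (k + 1) → ℝ) *ᵥ u) j.succ = H j ⬝ᵥ u := rfl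

lemma exists_coeff_of_near {K t : ℝ} {x u : Fin (k + 1) → ℝ}
    {H : Fin k → Fin (k + 1) → ℝ} (hu : q u = 1) (hH : ∀ j, H j ⬝ᵥ u = 0)
    (h : Near K t (Fin.cons x H : Fin (k + 1) → Fin (k + 1) → ℝ) (Pi.single 0 1)) :
    ∃ c : Fin (k + 1) → ℝ, c 0 ^ 2 ≤ K * t ^ 2 ∧ q (fun j : Fin k => c j.succ) ≤ K - 1 ∧
      c ᵥ* of (Fin.cons u H : Fin (k + 1) → Fin (k + 1) → ℝ) = x := by
  obtain ⟨hdet, y, hy, h1, h2⟩ := h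
  have hqe : q (Pi.single 0 1 : Fin (k + 1) → ℝ) = 1 := by simp [q_eq_dotProduct]
  rw [hqe, dotProduct_single_one] at h1 h2
  rw [one_mul] at h1
  obtain ⟨A, hA⟩ : ∃ A, A = of (Fin.cons x H : Fin (k + 1) → Fin (k + 1) → ℝ) := ⟨_, rfl⟩
  obtain ⟨X, hX⟩ : ∃ X, X = y ᵥ* A := ⟨_, rfl⟩
  rw [← hA] at hdet hy
  have hAX : A *ᵥ X = Pi.single 0 1 := by
    rw [hX, ← mulVec_transpose, mulVec_mulVec, hy]
  have hyX : y 0 = q X := by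
    rw [q_eq_dotProduct]
    nth_rw 1 [hX]
    rw [← Matrix.dotProduct_mulVec, hAX, dotProduct_single_one]
  have hxX : x ⬝ᵥ X = 1 := by
    rw [← mulVec_cons_zero X x H, ← hA, hAX, Pi.single_eq_same]
  have hu' : A *ᵥ u = (x ⬝ᵥ u) • Pi.single 0 1 := by
    ext i
    refine Fin.cases ?_ (fun j => ?_) i
    · rw [hA, mulVec_cons_zero]
      simp
    · rw [hA, mulVec_cons_succ, hH]
      simp
  obtain ⟨s, hs⟩ : ∃ s, s = x ⬝ᵥ u := ⟨_, rfl⟩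
  rw [← hs] at hu'
  have huX : u = s • X := by
    by_contra hne
    refine hdet (exists_mulVec_eq_zero_iff.1 ⟨u - s • X, sub_ne_zero.2 hne, ?_⟩)
    rw [mulVec_sub, mulVec_smul, hu', hAX, sub_self]
  have hsy : s ^ 2 * y 0 = 1 := by rw [hyX, ← q_smul', ← huX, hu]
  have hy0 : 0 < y 0 := by
    refine lt_of_le_of_ne (hyX ▸ q_nonneg X) fun h => ?_
    rw [← h, mul_zero] at hsy
    exact zero_ne_one hsy
  have hs0 : s ≠ 0 := by
    rintro rfl
    simp at hsy
  refine ⟨Fin.cons s fun j => -(y j.succ / y 0), ?_, ?_, ?_⟩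
  · rw [Fin.cons_zero]
    have : s ^ 2 * 1 ≤ s ^ 2 * (K * t ^ 2 * y 0) := by gcongr
    calc s ^ 2 ≤ s ^ 2 * (K * t ^ 2 * y 0) := by linarith
      _ = K * t ^ 2 * (s ^ 2 * y 0) := by ring
      _ = _ := by rw [hsy, mul_one]
  · simp only [Fin.cons_succ, q, neg_sq, div_pow]
    rw [← sum_div, div_le_iff₀ (by positivity)]
    rw [q, Fin.sum_univ_succ] at h1
    linarith
  · rw [vecMul_cons]
    simp only [Fin.cons_zero, Fin.cons_succ, neg_smul, sum_neg_distrib]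
    have e1 : X = y 0 • x + ∑ j : Fin k, y j.succ • H j := by rw [hX, hA, vecMul_cons]
    have e2 : ∑ j : Fin k, (y j.succ / y 0) • H j = (y 0)⁻¹ • (X - y 0 • x) := by
      rw [e1, add_sub_cancel_left, smul_sum]
      refine sum_congr rfl fun j _ => ?_
      rw [smul_smul, div_eq_inv_mul]
    rw [e2, huX, smul_sub, smul_smul, smul_smul, inv_mul_cancel₀ hy0.ne', one_smul, ← sq,
      eq_inv_of_mul_eq_one_left hsy]
    abel

lemma det_cons_eq {u : Fin (k + 1) → ℝ} {H : Fin k → Fin (k + 1) → ℝ} (hu : q u = 1)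
    (hH : ∀ j, H j ⬝ᵥ u = 0) (g : Fin (k + 1) → ℝ) :
    (of (Fin.cons g H : Fin (k + 1) → Fin (k + 1) → ℝ)).det =
      (g ⬝ᵥ u) * (of (Fin.cons u H : Fin (k + 1) → Fin (k + 1) → ℝ)).det := by
  have hup : ∀ x : Fin (k + 1) → ℝ, of (Fin.cons x H : Fin (k + 1) → Fin (k + 1) → ℝ) =
      (of (Fin.cons u H : Fin (k + 1) → Fin (k + 1) → ℝ)).updateRow 0 x := fun x => by
    ext i j
    refine Fin.cases ?_ (fun i => ?_) i
    · simp
    · simp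
  have h0 : (of (Fin.cons (g - (g ⬝ᵥ u) • u) H : Fin (k + 1) → Fin (k + 1) → ℝ)).det = 0 := by
    refine exists_mulVec_eq_zero_iff.1 ⟨u, ?_, ?_⟩
    · rintro rfl
      simp [q] at hu
    ext i
    refine Fin.cases ?_ (fun j => ?_) i
    · rw [mulVec_cons_zero, sub_dotProduct, smul_dotProduct, ← q_eq_dotProduct, hu]
      simp
    · rw [mulVec_cons_succ, hH]
      simp
  have h1 := det_updateRow_add (of (Fin.cons u H : Fin (k + 1) → Fin (k + 1) → ℝ)) 0
    (g - (g ⬝ᵥ u) • u) ((g ⬝ᵥ u) • u)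
  rw [sub_add_cancel, ← hup, ← hup, h0, zero_add, det_updateRow_smul, ← hup] at h1
  exact h1

lemma lintegral_abs_exp :
    ∫⁻ a : ℝ, ENNReal.ofReal (Real.exp (-(a ^ 2 / 2)) * |a|) = 2 := by
  have hf : Integrable fun a : ℝ => Real.exp (-(a ^ 2 / 2)) * |a| := by
    have := (integrable_mul_exp_neg_mul_sq (b := 1 / 2) (by norm_num)).abs
    refine this.congr (Filter.Eventually.of_forall fun a => ?_)
    simp only [abs_mul, Real.abs_exp]
    rw [mul_comm, neg_mul, show 1 / 2 * a ^ 2 = a ^ 2 / 2 by ring]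
  rw [← ofReal_integral_eq_lintegral_ofReal hf (Filter.Eventually.of_forall fun a => by positivity)]
  have h := integral_comp_abs (f := fun a : ℝ => Real.exp (-(a ^ 2 / 2)) * a)
  simp only [sq_abs] at h
  rw [h]
  have h1 := J_one
  simp only [J, pow_one] at h1
  simp_rw [mul_comm (Real.exp _)]
  rw [h1]
  norm_num

lemma lintegral_abs_dotProduct {u : Fin (k + 1) → ℝ} (hu : q u = 1) :
    ∫⁻ g : Fin (k + 1) → ℝ, gw g * ENNReal.ofReal |g ⬝ᵥ u| =
      2 * ENNReal.ofReal √(2 * Real.pi) ^ k := by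
  obtain ⟨R, hR, hRu⟩ := exists_orth u
  rw [hu, Real.sqrt_one, one_smul] at hRu
  have hm : Measurable fun g : Fin (k + 1) → ℝ => gw g * ENNReal.ofReal |g 0| :=
    measurable_gw.mul (measurable_pi_apply 0).abs.ennreal_ofReal
  have h1 : ∀ g : Fin (k + 1) → ℝ, gw g * ENNReal.ofReal |g ⬝ᵥ u| =
      gw (R *ᵥ g) * ENNReal.ofReal |(R *ᵥ g) 0| := fun g => by
    rw [← hR.dotProduct_mulVec, hRu, dotProduct_single_one, gw, gw, hR.q_mulVec]
  simp only [h1]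
  rw [hR.measurePreserving_mulVec.lintegral_comp hm, lintegral_cons hm]
  have h2 : ∀ a : ℝ, ∫⁻ b : Fin k → ℝ, gw (Fin.cons a b : Fin (k + 1) → ℝ) *
      ENNReal.ofReal |(Fin.cons a b : Fin (k + 1) → ℝ) 0| =
      ENNReal.ofReal (Real.exp (-(a ^ 2 / 2)) * |a|) * ENNReal.ofReal √(2 * Real.pi) ^ k :=
    fun a => by
    rw [← lintegral_gw, ← lintegral_const_mul _ measurable_gw]
    refine lintegral_congr fun b => ?_
    rw [gw_cons, Fin.cons_zero, ENNReal.ofReal_mul (Real.exp_pos _).le]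
    ring
  simp only [h2]
  rw [lintegral_mul_const _ (by fun_prop), lintegral_abs_exp]

lemma volume_cons {S : Set (Fin (k + 1) → ℝ)} (hS : MeasurableSet S) :
    volume S = ∫⁻ a : ℝ, volume {b : Fin k → ℝ | (Fin.cons a b : Fin (k + 1) → ℝ) ∈ S} := by
  rw [← lintegral_indicator_one hS, lintegral_cons (measurable_one.indicator hS)]
  refine lintegral_congr fun a => ?_
  have hc : Measurable fun b : Fin k → ℝ => (Fin.cons a b : Fin (k + 1) → ℝ) := by
    refine measurable_pi_lambda _ fun i => ?_
    refine Fin.cases ?_ (fun j => ?_) i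
    · simp
    · simpa using measurable_pi_apply j
  exact lintegral_indicator_one (hc hS)

/-- The volume of the Euclidean unit ball. -/
noncomputable def uvol (m : ℕ) : ℝ≥0∞ := volume {x : Fin m → ℝ | q x ≤ 1}

lemma uvol_ne_top (m : ℕ) : uvol m ≠ ∞ := by
  refine ne_top_of_le_ne_top (b := volume (Metric.closedBall (0 : Fin m → ℝ) 1))
    measure_closedBall_lt_top.ne (measure_mono fun x hx => ?_)
  have h := norm_sq_le_q x
  have hx : q x ≤ 1 := hx
  rw [mem_closedBall_zero_iff]
  nlinarith [norm_nonneg x]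

lemma uvol_ne_zero (m : ℕ) : uvol m ≠ 0 := by
  have h : 0 < volume {x : Fin m → ℝ | q x < 1} :=
    (isOpen_lt continuous_q' continuous_const).measure_pos _ ⟨0, by simp [q]⟩
  exact (h.trans_le (measure_mono fun x hx => show q x ≤ 1 from le_of_lt hx)).ne'

lemma volume_q_le {m : ℕ} {r : ℝ} (hr : 0 < r) :
    volume {x : Fin m → ℝ | q x ≤ r ^ 2} = ENNReal.ofReal (r ^ m) * uvol m := by
  have h : {x : Fin m → ℝ | q x ≤ r ^ 2} = r • {x : Fin m → ℝ | q x ≤ 1} := by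
    ext x
    rw [Set.mem_smul_set_iff_inv_smul_mem₀ hr.ne']
    change q x ≤ r ^ 2 ↔ q (r⁻¹ • x) ≤ 1
    rw [q_smul', inv_pow, inv_mul_le_iff₀ (by positivity), mul_one]
  rw [h, Measure.addHaar_smul, uvol]
  simp [abs_of_pos hr]

lemma volume_box {a r : ℝ} (ha : 0 ≤ a) (hr : 0 < r) :
    volume {c : Fin (k + 1) → ℝ | c 0 ^ 2 ≤ a ^ 2 ∧ q (fun j : Fin k => c j.succ) ≤ r ^ 2} =
      ENNReal.ofReal (2 * a) * (ENNReal.ofReal (r ^ k) * uvol k) := by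
  rw [volume_cons]
  · simp only [Set.mem_ofPred_eq, Fin.cons_zero, Fin.cons_succ]
    have h : ∀ x : ℝ, volume {b : Fin k → ℝ | x ^ 2 ≤ a ^ 2 ∧ q (fun j => b j) ≤ r ^ 2} =
        (Set.Icc (-a) a).indicator (fun _ => ENNReal.ofReal (r ^ k) * uvol k) x := fun x => by
      by_cases hx : x ∈ Set.Icc (-a) a
      · have : x ^ 2 ≤ a ^ 2 := sq_le_sq' hx.1 hx.2
        rw [Set.indicator_of_mem hx, ← volume_q_le hr]
        simp [this]
      · have : ¬ x ^ 2 ≤ a ^ 2 := fun h => hx (abs_le.1 (abs_le_of_sq_le_sq h ha))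
        rw [Set.indicator_of_notMem hx]
        simp [this]
    simp only [h]
    rw [lintegral_indicator_const measurableSet_Icc, Real.volume_Icc, mul_comm]
    congr 2
    ring
  · have h1 : Continuous fun c : Fin (k + 1) → ℝ => c 0 ^ 2 := by fun_prop
    have h2 : Continuous fun c : Fin (k + 1) → ℝ => q (fun j : Fin k => c j.succ) :=
      continuous_q'.comp (by fun_prop)
    exact ((isClosed_le h1 continuous_const).inter (isClosed_le h2 continuous_const)).measurableSet

lemma volume_near_le {κ t : ℝ} (hκ : 0 < κ) (ht : 0 ≤ t) (H : Fin k → Fin (k + 1) → ℝ) :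
    volume {x : Fin (k + 1) → ℝ | Near (1 + κ ^ 2) t (Fin.cons x H : Fin (k + 1) → Fin (k + 1) → ℝ)
      (Pi.single 0 1)} * (2 * ENNReal.ofReal √(2 * Real.pi) ^ k) ≤
    ENNReal.ofReal (2 * (√(1 + κ ^ 2) * t)) * (ENNReal.ofReal (κ ^ k) * uvol k) *
      ∫⁻ x : Fin (k + 1) → ℝ, gw x *
        ENNReal.ofReal |(of (Fin.cons x H : Fin (k + 1) → Fin (k + 1) → ℝ)).det| := by
  obtain ⟨z, hz, hz'⟩ := exists_orthonormal (r := 1) H (by simp)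
  have hu : q (z 0) = 1 := by
    have := hz 0 0
    simpa [q, sq] using this
  have hH : ∀ j, H j ⬝ᵥ z 0 = 0 := fun j => hz' j 0
  generalize z 0 = u at hu hH
  have hK : (0 : ℝ) ≤ 1 + κ ^ 2 := by positivity
  have hF : ∫⁻ x : Fin (k + 1) → ℝ, gw x *
      ENNReal.ofReal |(of (Fin.cons x H : Fin (k + 1) → Fin (k + 1) → ℝ)).det| =
      2 * ENNReal.ofReal √(2 * Real.pi) ^ k *
        ENNReal.ofReal |(of (Fin.cons u H : Fin (k + 1) → Fin (k + 1) → ℝ)).det| := by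
    rw [← lintegral_abs_dotProduct hu, ← lintegral_mul_const' _ _ ENNReal.ofReal_ne_top]
    refine lintegral_congr fun x => ?_
    rw [det_cons_eq hu hH x, abs_mul, ENNReal.ofReal_mul (abs_nonneg _), mul_assoc]
  have hle : volume {x : Fin (k + 1) → ℝ | Near (1 + κ ^ 2) t
      (Fin.cons x H : Fin (k + 1) → Fin (k + 1) → ℝ) (Pi.single 0 1)} ≤
      ENNReal.ofReal |(of (Fin.cons u H : Fin (k + 1) → Fin (k + 1) → ℝ)).det| *
      (ENNReal.ofReal (2 * (√(1 + κ ^ 2) * t)) * (ENNReal.ofReal (κ ^ k) * uvol k)) := by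
    rw [← volume_box (by positivity) hκ]
    have hd : (of (Fin.cons u H : Fin (k + 1) → Fin (k + 1) → ℝ)).det =
        LinearMap.det (vecMulLinear (of (Fin.cons u H : Fin (k + 1) → Fin (k + 1) → ℝ))) := by
      rw [← det_transpose, ← LinearMap.det_toLin']
      congr 1
      ext x : 2
      simp [toLin'_apply]
    rw [hd, ← Measure.addHaar_image_linearMap]
    refine measure_mono fun x hx => ?_
    obtain ⟨c, hc0, hc1, hc⟩ := exists_coeff_of_near hu hH hx
    refine ⟨c, ⟨?_, ?_⟩, hc⟩
    · rw [mul_pow, Real.sq_sqrt hK]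
      exact hc0
    · linarith
  rw [hF]
  calc _ ≤ _ := mul_le_mul_left hle _
    _ = _ := by ring

end Slab

end LSV

namespace LSV

open Finset MeasureTheory Matrix
open scoped ENNReal

section Gauss

variable {k : ℕ}

/-- The Gaussian weight of the families near to `g`. -/
noncomputable def nearW {m : ℕ} (K t : ℝ) (g : Fin m → ℝ) : ℝ≥0∞ :=
  ∫⁻ M : Fin m → Fin m → ℝ, {M | Near K t M g}.indicator gW M

lemma measurableSet_near_left {m : ℕ} (K t : ℝ) (g : Fin m → ℝ) :
    MeasurableSet {M : Fin m → Fin m → ℝ | Near K t M g} :=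
  (measurable_id.prodMk measurable_const) (measurableSet_near K t)

lemma nearW_single_le {κ t : ℝ} (hκ : 0 < κ) (ht : 0 ≤ t) :
    nearW (1 + κ ^ 2) t (Pi.single 0 1 : Fin (k + 1) → ℝ) *
      (2 * ENNReal.ofReal √(2 * Real.pi) ^ k) ≤
    ENNReal.ofReal (2 * (√(1 + κ ^ 2) * t)) * (ENNReal.ofReal (κ ^ k) * uvol k) *
      dint (k + 1) := by
  obtain ⟨S, hS⟩ : ∃ S, S = {M : Fin (k + 1) → Fin (k + 1) → ℝ |
    Near (1 + κ ^ 2) t M (Pi.single 0 1)} := ⟨_, rfl⟩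
  have hSm : MeasurableSet S := by
    rw [hS]
    exact measurableSet_near_left _ _ _
  have hcons : Measurable fun p : (Fin (k + 1) → ℝ) × (Fin k → Fin (k + 1) → ℝ) =>
      (Fin.cons p.1 p.2 : Fin (k + 1) → Fin (k + 1) → ℝ) := by
    refine measurable_pi_lambda _ fun i => ?_
    refine Fin.cases ?_ (fun j => ?_) i
    · simpa using measurable_fst
    · exact (measurable_pi_apply j).comp measurable_snd
  have hx : ∀ H : Fin k → Fin (k + 1) → ℝ, Measurable fun x : Fin (k + 1) → ℝ =>
      (Fin.cons x H : Fin (k + 1) → Fin (k + 1) → ℝ) := fun H =>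
    hcons.comp (measurable_id.prodMk measurable_const)
  have h1 : nearW (1 + κ ^ 2) t (Pi.single 0 1 : Fin (k + 1) → ℝ) ≤
      ∫⁻ H : Fin k → Fin (k + 1) → ℝ, gW H *
        volume {x : Fin (k + 1) → ℝ | (Fin.cons x H : Fin (k + 1) → Fin (k + 1) → ℝ) ∈ S} := by
    rw [nearW, ← hS, lintegral_cons (measurable_gW.indicator hSm), lintegral_lintegral_swap]
    · refine lintegral_mono fun H => ?_
      refine (lintegral_mono (g := fun x => gW H * {x : Fin (k + 1) → ℝ |
        (Fin.cons x H : Fin (k + 1) → Fin (k + 1) → ℝ) ∈ S}.indicator 1 x) fun x => ?_).trans ?_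
      · by_cases hm : (Fin.cons x H : Fin (k + 1) → Fin (k + 1) → ℝ) ∈ S
        · dsimp only
          rw [Set.indicator_of_mem hm, Set.indicator_of_mem (by exact hm), gW_cons, mul_comm]
          exact mul_le_mul_right (gw_le_one x) _
        · rw [Set.indicator_of_notMem hm]
          exact zero_le
      · refine (lintegral_const_mul _ (measurable_one.indicator (hx H hSm))).trans_le ?_
        rw [lintegral_indicator_one (hx H hSm)]
        exact le_rfl
    · exact ((measurable_gW.indicator hSm).comp hcons).aemeasurable
  calc _ ≤ (∫⁻ H : Fin k → Fin (k + 1) → ℝ, gW H *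
        volume {x : Fin (k + 1) → ℝ | (Fin.cons x H : Fin (k + 1) → Fin (k + 1) → ℝ) ∈ S}) *
        (2 * ENNReal.ofReal √(2 * Real.pi) ^ k) := mul_le_mul_left h1 _
    _ = ∫⁻ H : Fin k → Fin (k + 1) → ℝ, gW H *
        (volume {x : Fin (k + 1) → ℝ | (Fin.cons x H : Fin (k + 1) → Fin (k + 1) → ℝ) ∈ S} *
        (2 * ENNReal.ofReal √(2 * Real.pi) ^ k)) := by
      rw [← lintegral_mul_const']
      · simp only [mul_assoc]
      · exact ENNReal.mul_ne_top (by simp) (ENNReal.pow_ne_top ENNReal.ofReal_ne_top)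
    _ ≤ ∫⁻ H : Fin k → Fin (k + 1) → ℝ, ENNReal.ofReal (2 * (√(1 + κ ^ 2) * t)) *
        (ENNReal.ofReal (κ ^ k) * uvol k) * ∫⁻ x : Fin (k + 1) → ℝ,
          ENNReal.ofReal |(of (Fin.cons x H : Fin (k + 1) → Fin (k + 1) → ℝ)).det| *
            gW (Fin.cons x H : Fin (k + 1) → Fin (k + 1) → ℝ) := by
      refine lintegral_mono fun H => ?_
      have h2 := mul_le_mul_right (volume_near_le hκ ht H) (gW H)
      refine (le_of_eq ?_).trans (h2.trans (le_of_eq ?_))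
      · rw [hS]
        rfl
      · rw [mul_left_comm, ← lintegral_const_mul']
        · congr 1
          refine lintegral_congr fun x => ?_
          rw [gW_cons]
          ring
        · rw [gW_eq]
          exact ENNReal.ofReal_ne_top
    _ = _ := by
      rw [lintegral_const_mul', dint, lintegral_cons (measurable_dint_integrand _),
        lintegral_lintegral_swap]
      · exact ((measurable_dint_integrand (k + 1)).comp
          (hcons.comp measurable_swap)).aemeasurable
      · exact ENNReal.mul_ne_top ENNReal.ofReal_ne_top
          (ENNReal.mul_ne_top ENNReal.ofReal_ne_top (uvol_ne_top _))

lemma nearW_le {K t : ℝ} {g : Fin (k + 1) → ℝ} (hg : g ≠ 0) :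
    nearW K t g ≤ nearW K t (Pi.single 0 1 : Fin (k + 1) → ℝ) := by
  obtain ⟨R, hR, hRg⟩ := exists_orth g
  have hq : 0 < q g := lt_of_le_of_ne (q_nonneg g) fun h => hg (q_eq_zero.1 h.symm)
  have hc : √(q g) ≠ 0 := (Real.sqrt_pos.2 hq).ne'
  rw [nearW, nearW, ← (hR.measurePreserving_mul (b := k + 1)).lintegral_comp
    (measurable_gW.indicator (measurableSet_near_left K t (Pi.single 0 1)))]
  refine lintegral_mono fun M => ?_
  by_cases hM : Near K t M g
  · rw [Set.indicator_of_mem (show M ∈ {M | Near K t M g} from hM), Set.indicator_of_mem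
      (show rmul R M ∈ {M | Near K t M (Pi.single 0 1)} from hM.rotate hR hc hRg),
      gW_eq, gW_eq]
    have := sum_q_mul hR (of M)
    refine le_of_eq ?_
    congr 4
    exact this.symm
  · rw [Set.indicator_of_notMem (show M ∉ {M | Near K t M g} from hM)]
    exact zero_le

lemma volume_det_eq_zero {m : ℕ} : volume {M : Fin m → Fin m → ℝ | (of M).det = 0} = 0 := by
  have hcont : Continuous fun M : Fin m → Fin m → ℝ => (of M).det :=
    (continuous_id.matrix_det (n := Fin m) (R := ℝ) (A := fun M : Matrix (Fin m) (Fin m) ℝ => M))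
  have hS : MeasurableSet {M : Fin m → Fin m → ℝ | (of M).det = 0} :=
    (isClosed_eq hcont continuous_const).measurableSet
  obtain ⟨S, hSd⟩ : ∃ S, S = {M : Fin m → Fin m → ℝ | (of M).det = 0} := ⟨_, rfl⟩
  rw [← hSd] at hS ⊢
  obtain ⟨I, hI⟩ : ∃ I : Fin m → Fin m → ℝ, I = fun i => (1 : Matrix (Fin m) (Fin m) ℝ) i :=
    ⟨_, rfl⟩
  have hadd : Measurable fun p : ℝ × (Fin m → Fin m → ℝ) => p.2 + p.1 • I := by fun_prop
  have h1 : ∀ x : ℝ, volume {M : Fin m → Fin m → ℝ | M + x • I ∈ S} = volume S := fun x =>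
    measure_preimage_add_right volume (x • I) S
  have h2 : ∀ M : Fin m → Fin m → ℝ, volume {x : ℝ | M + x • I ∈ S} = 0 := fun M => by
    refine Set.Finite.measure_zero (Set.Finite.subset
      ((-(of M : Matrix (Fin m) (Fin m) ℝ)).charpoly.roots.toFinset.finite_toSet) fun x hx => ?_) _
    rw [hSd] at hx
    have hx : (of (M + x • I)).det = 0 := hx
    simp only [mem_coe, Multiset.mem_toFinset]
    rw [Polynomial.mem_roots (charpoly_monic _).ne_zero, Polynomial.IsRoot, eval_charpoly, ← hx]
    congr 1
    ext i j
    simp [hI, Matrix.one_apply, scalar_apply, diagonal_apply, add_comm]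
  have h3 : ∫⁻ x : ℝ, ∫⁻ M : Fin m → Fin m → ℝ, S.indicator (1 : (Fin m → Fin m → ℝ) → ℝ≥0∞) (M + x • I) = 0 := by
    rw [lintegral_lintegral_swap]
    · have : ∀ M : Fin m → Fin m → ℝ, ∫⁻ x : ℝ, S.indicator (1 : (Fin m → Fin m → ℝ) → ℝ≥0∞) (M + x • I) = 0 :=
        fun M => by
        rw [← h2 M]
        have hm : Measurable fun x : ℝ => M + x • I := by fun_prop
        exact lintegral_indicator_one (hm hS)
      simp [this]
    · exact ((measurable_one.indicator hS).comp hadd).aemeasurable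
  have h4 : ∀ x : ℝ, ∫⁻ M : Fin m → Fin m → ℝ, S.indicator (1 : (Fin m → Fin m → ℝ) → ℝ≥0∞) (M + x • I) =
      volume S := fun x => by
    rw [← h1 x]
    have hm : Measurable fun M : Fin m → Fin m → ℝ => M + x • I := by fun_prop
    exact lintegral_indicator_one (hm hS)
  simp only [h4, lintegral_const, Real.volume_univ] at h3
  exact (mul_eq_zero.1 h3).resolve_right (by simp)

lemma lintegral_Ioc_abs_pow (k : ℕ) {κ a : ℝ} (hκ : 0 < κ) (ha : 0 < a) :
    ENNReal.ofReal (2 * κ ^ k * a ^ (k + 1) / (k + 1)) ≤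
      ∫⁻ x in Set.Icc (-a) a, ENNReal.ofReal ((κ * |x|) ^ k) := by
  have hi : IntegrableOn (fun x : ℝ => (κ * |x|) ^ k) (Set.Icc (-a) a) :=
    (by fun_prop : Continuous fun x : ℝ => (κ * |x|) ^ k).integrableOn_Icc
  rw [← ofReal_integral_eq_lintegral_ofReal hi (Filter.Eventually.of_forall fun x => by positivity)]
  refine ENNReal.ofReal_le_ofReal (le_of_eq ?_)
  have hc : Continuous fun x : ℝ => (κ * |x|) ^ k := by fun_prop
  rw [integral_Icc_eq_integral_Ioc, ← intervalIntegral.integral_of_le (by linarith),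
    ← intervalIntegral.integral_add_adjacent_intervals (b := 0) (hc.intervalIntegrable _ _)
      (hc.intervalIntegrable _ _)]
  have h1 : ∫ x in (0 : ℝ)..a, (κ * |x|) ^ k = κ ^ k * (a ^ (k + 1) / (k + 1)) := by
    rw [intervalIntegral.integral_congr (g := fun x => κ ^ k * x ^ k) fun x hx => ?_]
    · rw [intervalIntegral.integral_const_mul, integral_pow]
      simp
    · rw [Set.uIcc_of_le ha.le] at hx
      simp only
      rw [abs_of_nonneg hx.1, mul_pow]
  have h2 := intervalIntegral.integral_comp_neg (a := 0) (b := a) fun x : ℝ => (κ * |x|) ^ k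
  simp only [abs_neg, neg_zero] at h2
  rw [← h2, h1]
  ring

/-- The vectors of the unit ball in the double cone around `v`. -/
def coneS {m : ℕ} (K : ℝ) (v : Fin m → ℝ) : Set (Fin m → ℝ) :=
  {g | q g ≤ 1 ∧ q g ≤ K * (g ⬝ᵥ v) ^ 2}

lemma measurableSet_coneS {m : ℕ} (K : ℝ) (v : Fin m → ℝ) : MeasurableSet (coneS K v) := by
  have h : Continuous fun g : Fin m → ℝ => K * (g ⬝ᵥ v) ^ 2 :=
    continuous_const.mul ((continuous_id.dotProduct continuous_const).pow 2)
  exact ((isClosed_le continuous_q' continuous_const).inter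
    (isClosed_le continuous_q' h)).measurableSet

lemma le_volume_coneS {κ : ℝ} (hκ : 0 < κ) {v : Fin (k + 1) → ℝ} (hv : q v = 1) :
    ENNReal.ofReal (2 * κ ^ k * (√(1 + κ ^ 2))⁻¹ ^ (k + 1) / (k + 1)) * uvol k ≤
      volume (coneS (1 + κ ^ 2) v) := by
  obtain ⟨R, hR, hRv⟩ := exists_orth v
  rw [hv, Real.sqrt_one, one_smul] at hRv
  have h1 : coneS (1 + κ ^ 2) v = (fun x => R *ᵥ x) ⁻¹' coneS (1 + κ ^ 2) (Pi.single 0 1) := by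
    ext g
    change (q g ≤ 1 ∧ q g ≤ (1 + κ ^ 2) * (g ⬝ᵥ v) ^ 2) ↔
      (q (R *ᵥ g) ≤ 1 ∧ q (R *ᵥ g) ≤ (1 + κ ^ 2) * ((R *ᵥ g) ⬝ᵥ Pi.single 0 1) ^ 2)
    rw [← hRv, hR.dotProduct_mulVec, hR.q_mulVec]
  rw [h1, hR.measurePreserving_mulVec.measure_preimage
    (measurableSet_coneS _ _).nullMeasurableSet, volume_cons (measurableSet_coneS _ _)]
  obtain ⟨a, ha⟩ : ∃ a, a = (√(1 + κ ^ 2))⁻¹ := ⟨_, rfl⟩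
  have hs : 0 < √(1 + κ ^ 2) := Real.sqrt_pos.2 (by positivity)
  have ha0 : 0 < a := by rw [ha]; positivity
  have ha2 : (1 + κ ^ 2) * a ^ 2 = 1 := by
    rw [ha, inv_pow, Real.sq_sqrt (by positivity), mul_inv_cancel₀ (by positivity)]
  rw [← ha]
  refine (mul_le_mul_left (lintegral_Ioc_abs_pow k hκ ha0) _).trans ?_
  rw [← lintegral_mul_const' _ _ (uvol_ne_top k), ← lintegral_indicator measurableSet_Icc]
  refine lintegral_mono_ae ?_
  filter_upwards [Measure.ae_ne volume (0 : ℝ)] with x hx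
  by_cases hxa : x ∈ Set.Icc (-a) a
  · rw [Set.indicator_of_mem hxa, ← volume_q_le (by positivity)]
    refine measure_mono fun b hb => ?_
    have hb : q b ≤ (κ * |x|) ^ 2 := hb
    rw [mul_pow, sq_abs] at hb
    have hx2 : x ^ 2 ≤ a ^ 2 := sq_le_sq' hxa.1 hxa.2
    have hq : q (Fin.cons x b : Fin (k + 1) → ℝ) = x ^ 2 + q b := by
      simp [q, Fin.sum_univ_succ]
    have h2 : x ^ 2 + q b ≤ (1 + κ ^ 2) * x ^ 2 := by linarith
    refine ⟨?_, ?_⟩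
    · rw [hq]
      exact h2.trans ((mul_le_mul_of_nonneg_left hx2 (by positivity)).trans_eq ha2)
    · rw [hq, dotProduct_single_one, Fin.cons_zero]
      exact h2
  · rw [Set.indicator_of_notMem hxa]
    exact zero_le

lemma lintegral_esm_mul_le {K t : ℝ} (hK : 0 ≤ K) {β : ℝ≥0∞}
    (hβ : ∀ v : Fin (k + 1) → ℝ, q v = 1 → β ≤ volume (coneS K v)) :
    (∫⁻ M in {M : Fin (k + 1) → Fin (k + 1) → ℝ | Esm t M}, gW M) * β ≤
      uvol (k + 1) * nearW K t (Pi.single 0 1 : Fin (k + 1) → ℝ) := by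
  have hE : MeasurableSet {M : Fin (k + 1) → Fin (k + 1) → ℝ | Esm t M} :=
    (isClosed_esm t).measurableSet
  have hB : MeasurableSet {x : Fin (k + 1) → ℝ | q x ≤ 1} :=
    (isClosed_le continuous_q' continuous_const).measurableSet
  rw [← lintegral_mul_const _ measurable_gW]
  have h1 : ∫⁻ M in {M : Fin (k + 1) → Fin (k + 1) → ℝ | Esm t M}, gW M * β ≤
      ∫⁻ M : Fin (k + 1) → Fin (k + 1) → ℝ, ∫⁻ g in {x : Fin (k + 1) → ℝ | q x ≤ 1},
        {M | Near K t M g}.indicator gW M := by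
    rw [← lintegral_indicator hE]
    refine lintegral_mono_ae ?_
    filter_upwards [measure_eq_zero_iff_ae_notMem.1 (volume_det_eq_zero (m := k + 1))] with M hM
    by_cases hEM : Esm t M
    · rw [Set.indicator_of_mem (show M ∈ {M | Esm t M} from hEM)]
      obtain ⟨v, hv, hnear⟩ := near_of_esm hK hEM hM
      calc gW M * β ≤ gW M * volume (coneS K v) := mul_le_mul_right (hβ v hv) _
        _ = ∫⁻ g in coneS K v, gW M := by rw [setLIntegral_const]
        _ = ∫⁻ g in coneS K v, {M | Near K t M g}.indicator gW M := by
          refine setLIntegral_congr_fun (measurableSet_coneS K v) fun g hg => ?_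
          rw [Set.indicator_of_mem (show M ∈ {M | Near K t M g} from hnear g hg.2)]
        _ ≤ _ := lintegral_mono_set fun g hg => hg.1
    · rw [Set.indicator_of_notMem (show M ∉ {M | Esm t M} from hEM)]
      exact zero_le
  refine h1.trans ?_
  rw [lintegral_lintegral_swap]
  · calc _ ≤ ∫⁻ g in {x : Fin (k + 1) → ℝ | q x ≤ 1},
          nearW K t (Pi.single 0 1 : Fin (k + 1) → ℝ) := by
          refine lintegral_mono_ae (ae_restrict_of_ae ?_)
          filter_upwards [Measure.ae_ne volume (0 : Fin (k + 1) → ℝ)] with g hg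
          exact nearW_le hg
      _ = _ := by rw [setLIntegral_const, uvol, mul_comm]
  · have : (Function.uncurry fun (M : Fin (k + 1) → Fin (k + 1) → ℝ) (g : Fin (k + 1) → ℝ) =>
        {M | Near K t M g}.indicator gW M) =
        {p : (Fin (k + 1) → Fin (k + 1) → ℝ) × (Fin (k + 1) → ℝ) | Near K t p.1 p.2}.indicator
          fun p => gW p.1 := by
      ext ⟨M, g⟩
      rfl
    rw [this]
    exact ((measurable_gW.comp measurable_fst).indicator (measurableSet_near K t)).aemeasurable

lemma lintegral_gW {a b : ℕ} : ∫⁻ M : Fin a → Fin b → ℝ, gW M =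
    ENNReal.ofReal √(2 * Real.pi) ^ (b * a) := by
  induction a with
  | zero =>
    have h : ∀ M : Fin 0 → Fin b → ℝ, gW M = 1 := fun M => by simp [gW]
    simp only [h]
    simp [volume_pi]
  | succ a ih =>
    rw [lintegral_cons measurable_gW]
    simp only [gW_cons, lintegral_const_mul _ measurable_gW, ih]
    rw [lintegral_mul_const _ measurable_gw, lintegral_gw]
    ring

/-- The Gaussian measure of the matrices with least singular value at most `t`. -/
theorem lintegral_esm_le {t : ℝ} (ht : 0 ≤ t) :
    ∫⁻ M in {M : Fin (k + 1) → Fin (k + 1) → ℝ | Esm t M}, gW M ≤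
      ENNReal.ofReal (√(k + 1) * t * √(2 * Real.pi) ^ (k + 1) ^ 2) := by
  obtain ⟨P, hP⟩ : ∃ P, P = ∫⁻ M in {M : Fin (k + 1) → Fin (k + 1) → ℝ | Esm t M}, gW M :=
    ⟨_, rfl⟩
  have hPtop : P ≠ ∞ := by
    refine ne_top_of_le_ne_top ?_ (hP.trans_le (setLIntegral_le_lintegral _ _))
    rw [lintegral_gW]
    exact ENNReal.pow_ne_top ENNReal.ofReal_ne_top
  rw [← hP, ← ENNReal.ofReal_toReal hPtop]
  refine ENNReal.ofReal_le_ofReal ?_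
  have key : ∀ κ : ℝ, 0 < κ → P.toReal * (√(1 + κ ^ 2))⁻¹ ^ (k + 1) ≤
      √(1 + κ ^ 2) * (√(k + 1) * t * √(2 * Real.pi) ^ (k + 1) ^ 2) := fun κ hκ => by
    have h1 := lintegral_esm_mul_le (t := t) (by positivity) fun v hv => le_volume_coneS (k := k) hκ hv
    rw [← hP] at h1
    have h2 := nearW_single_le (k := k) hκ ht
    have h3 := dint_eq (k + 1)
    have hw : 0 < √(2 * Real.pi) := Real.sqrt_pos.2 (by positivity)
    have hNtop : nearW (1 + κ ^ 2) t (Pi.single 0 1 : Fin (k + 1) → ℝ) ≠ ∞ := by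
      refine ne_top_of_le_ne_top ?_ (lintegral_mono fun M => Set.indicator_le_self _ gW M)
      rw [lintegral_gW]
      exact ENNReal.pow_ne_top ENNReal.ofReal_ne_top
    have hDtop : dint (k + 1) ≠ ∞ := by
      intro h
      rw [h, ENNReal.mul_top (by simpa using hw)] at h3
      exact ENNReal.mul_ne_top (ENNReal.mul_ne_top (by simp) (ENNReal.pow_ne_top
        ENNReal.ofReal_ne_top)) ENNReal.ofReal_ne_top h3.symm
    rw [← ENNReal.ofReal_toReal hDtop] at h2 h3
    rw [← ENNReal.ofReal_toReal hNtop] at h1 h2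
    rw [← ENNReal.ofReal_toReal (uvol_ne_top k)] at h1 h2
    rw [← ENNReal.ofReal_toReal (uvol_ne_top (k + 1))] at h1
    rw [← ENNReal.ofReal_toReal hPtop] at h1
    obtain ⟨a, ha⟩ : ∃ a, a = (√(1 + κ ^ 2))⁻¹ ^ (k + 1) := ⟨_, rfl⟩
    have hb := bvol_mul_J k
    have hbv : bvol (k + 1) = (uvol (k + 1)).toReal := rfl
    rw [hbv] at hb
    have hk0 : (0 : ℝ) < (uvol k).toReal := ENNReal.toReal_pos (uvol_ne_zero k) (uvol_ne_top k)
    have hk1 : (0 : ℝ) ≤ (uvol (k + 1)).toReal := ENNReal.toReal_nonneg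
    have hN0 : (0 : ℝ) ≤ (nearW (1 + κ ^ 2) t (Pi.single 0 1 : Fin (k + 1) → ℝ)).toReal :=
      ENNReal.toReal_nonneg
    have hD0 : (0 : ℝ) ≤ (dint (k + 1)).toReal := ENNReal.toReal_nonneg
    have hP0 : (0 : ℝ) ≤ P.toReal := ENNReal.toReal_nonneg
    rw [← ha] at h1 ⊢
    have ha0 : 0 < a := by rw [ha]; positivity
    generalize (uvol k).toReal = U at *
    generalize (uvol (k + 1)).toReal = U' at *
    generalize (nearW (1 + κ ^ 2) t (Pi.single 0 1 : Fin (k + 1) → ℝ)).toReal = N at *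
    generalize (dint (k + 1)).toReal = D at *
    generalize P.toReal = p at *
    obtain ⟨s, hs⟩ : ∃ s, s = √(1 + κ ^ 2) := ⟨_, rfl⟩
    have hs0 : 0 < s := by rw [hs]; exact Real.sqrt_pos.2 (by positivity)
    rw [← hs] at h2 ⊢
    have hJ := J_succ_le k
    have hJ1 := J_pos (k + 1)
    have hJ0 := J_pos k
    generalize √(2 * Real.pi) = w at *
    have h2e : (2 : ℝ≥0∞) = ENNReal.ofReal 2 := by norm_num
    rw [h2e, ← ENNReal.ofReal_pow hw.le, ← ENNReal.ofReal_mul (by positivity),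
      ← ENNReal.ofReal_mul hN0, ← ENNReal.ofReal_mul (by positivity),
      ← ENNReal.ofReal_mul (by positivity), ← ENNReal.ofReal_mul (by positivity),
      ENNReal.ofReal_le_ofReal_iff (by positivity)] at h2
    rw [← ENNReal.ofReal_mul (by positivity), ← ENNReal.ofReal_mul hP0, ← ENNReal.ofReal_mul hk1,
      ENNReal.ofReal_le_ofReal_iff (by positivity)] at h1
    rw [h2e, ← ENNReal.ofReal_pow hw.le, ← ENNReal.ofReal_mul (by positivity),
      ← ENNReal.ofReal_mul (by positivity), ← ENNReal.ofReal_mul (by positivity),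
      ENNReal.ofReal_eq_ofReal_iff (by positivity) (by positivity)] at h3
    have hk : (0 : ℝ) < k + 1 := by positivity
    have h4 : p * a * w ^ k ≤ (k + 1) * U' * t * s * D / 2 := by
      have e1 : p * (2 * κ ^ k * a / (k + 1) * U) * (2 * w ^ k) ≤
          U' * (2 * (s * t) * (κ ^ k * U) * D) :=
        (mul_le_mul_of_nonneg_right h1 (by positivity)).trans
          ((mul_assoc _ _ _).trans_le (mul_le_mul_of_nonneg_left h2 hk1))
      have e2 : (0 : ℝ) < 4 * κ ^ k * U / (k + 1) := by positivity
      refine le_of_mul_le_mul_left ?_ e2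
      calc _ = p * (2 * κ ^ k * a / (k + 1) * U) * (2 * w ^ k) := by ring
        _ ≤ _ := e1
        _ = _ := by field_simp; ring
    have h5 : p * a * J k ≤ t * s * w ^ (k + 1) ^ 2 * J (k + 1) := by
      have e2 : 0 < w ^ (k + 1) := by positivity
      refine le_of_mul_le_mul_left ?_ e2
      calc _ = p * a * w ^ k * (w * J k) := by ring
        _ ≤ (k + 1) * U' * t * s * D / 2 * (w * J k) := by gcongr
        _ = ((k + 1) * U' * J k) * t * s / 2 * (w * D) := by ring
        _ = _ := by rw [hb, h3]; ring
    refine le_of_mul_le_mul_right (h5.trans ?_) hJ0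
    calc _ ≤ t * s * w ^ (k + 1) ^ 2 * (√(k + 1) * J k) := by gcongr
      _ = _ := by ring
  have hlim : ∀ f : ℝ → ℝ, Continuous f → Filter.Tendsto f (nhdsWithin 0 (Set.Ioi 0)) (nhds (f 0)) :=
    fun f hf => hf.continuousAt.tendsto.mono_left nhdsWithin_le_nhds
  have hpos : ∀ κ : ℝ, √(1 + κ ^ 2) ≠ 0 := fun κ => (Real.sqrt_pos.2 (by positivity)).ne'
  have h1 := hlim (fun κ => P.toReal * (√(1 + κ ^ 2))⁻¹ ^ (k + 1))
    (continuous_const.mul ((Continuous.inv₀ (by fun_prop) hpos).pow _))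
  have h2 := hlim (fun κ => √(1 + κ ^ 2) * (√(k + 1) * t * √(2 * Real.pi) ^ (k + 1) ^ 2))
    (by fun_prop)
  have h3 := le_of_tendsto_of_tendsto h1 h2 (eventually_mem_nhdsWithin.mono fun κ hκ => key κ hκ)
  simpa using h3

end Gauss

end LSV

namespace LSV

open Finset MeasureTheory Matrix
open scoped ENNReal

section Tail

variable {Ω : Type*} [Fintype Ω] [Nonempty Ω] {s : ℕ}

/-- The vector `M i` is nearly orthogonal to the unit vectors normal to the other rows. -/
def RowSmall (ρ : ℝ) (M : Fin s → Fin s → ℝ) (i : Fin s) : Prop :=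
  ∀ h, q h = 1 → (∀ j, j ≠ i → M j ⬝ᵥ h = 0) → |M i ⬝ᵥ h| ≤ ρ

lemma exists_rowSmall {t : ℝ} (ht : 0 ≤ t) {M : Fin s → Fin s → ℝ} (hM : Esm t M) :
    ∃ i, RowSmall (√s * t) M i := by
  obtain ⟨x, hx, hxM⟩ := hM
  obtain ⟨i, hi⟩ : ∃ i, 1 ≤ s * x i ^ 2 := by
    by_contra! hcon
    have hs : s ≠ 0 := by
      rintro rfl
      simp [q] at hx
    have h1 : ∑ i, (s : ℝ) * x i ^ 2 < ∑ _i : Fin s, (1 : ℝ) :=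
      sum_lt_sum_of_nonempty (univ_nonempty_iff.2 ⟨⟨0, Nat.pos_of_ne_zero hs⟩⟩) fun i _ => hcon i
    rw [← mul_sum] at h1
    change (s : ℝ) * q x < _ at h1
    simp [hx] at h1
  refine ⟨i, fun h hh hj => abs_le_of_sq_le_sq ?_ (by positivity)⟩
  have h1 : (x ᵥ* of M) ⬝ᵥ h = x i * (M i ⬝ᵥ h) := by
    rw [← Matrix.dotProduct_mulVec, dotProduct, Finset.sum_eq_single i]
    · rfl
    · intro j _ hji
      change x j * (M j ⬝ᵥ h) = 0
      rw [hj j hji, mul_zero]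
    · simp
  have h2 : ((x ᵥ* of M) ⬝ᵥ h) ^ 2 ≤ q (x ᵥ* of M) * q h := sq_sum_mul_le _ _
  rw [h1, hh, mul_one, mul_pow] at h2
  rw [mul_pow, Real.sq_sqrt (Nat.cast_nonneg _)]
  calc (M i ⬝ᵥ h) ^ 2 ≤ (s * x i ^ 2) * (M i ⬝ᵥ h) ^ 2 := le_mul_of_one_le_left (sq_nonneg _) hi
    _ = s * (x i ^ 2 * (M i ⬝ᵥ h) ^ 2) := by ring
    _ ≤ s * t ^ 2 := by gcongr; exact h2.trans hxM

lemma ev_fin_one (f : Ω → ℝ) : ev (fun d : Fin 1 → Ω => f (d 0)) = ev f :=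
  ev_equiv (Equiv.funUnique (Fin 1) Ω) f

lemma ev_eval (j : Fin s) (f : Ω → ℝ) : ev (fun X : Fin s → Ω => f (X j)) = ev f := by
  have hτ : Function.Injective fun _ : Fin 1 => j := Function.injective_of_subsingleton _
  rw [ev_resample _ hτ]
  have h : ∀ (D : Fin s → Ω) (d : Fin 1 → Ω), Function.extend (fun _ : Fin 1 => j) d D j = d 0 :=
    fun D d => hτ.extend_apply d D 0
  simp only [h, ev_fin_one, ev_const]

open Classical in
lemma ev_esm_le {t B B0 : ℝ} (ht : 0 ≤ t) (hB : 0 ≤ B) (hB0 : 0 ≤ B0) (Y : Ω → Fin s → ℝ)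
    {φ : Ω → ℝ} (hφ : ∀ ω, 0 ≤ φ ω)
    (h1 : ∀ h, q h = 1 → ev (fun ω => φ ω * if |Y ω ⬝ᵥ h| ≤ √s * t then 1 else 0) ≤ B)
    (h2 : ∀ h, q h = 1 → ev (fun ω => if |Y ω ⬝ᵥ h| ≤ √s * t then (1 : ℝ) else 0) ≤ B0)
    (j : Fin s) : ev (fun X : Fin s → Ω => φ (X j) * if Esm t (fun i => Y (X i)) then 1 else 0) ≤
      s * (B + ev φ * B0) := by
  have hs : 1 ≤ s := j.pos
  calc _ ≤ ev (fun X : Fin s → Ω => ∑ i, φ (X j) *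
        if RowSmall (√s * t) (fun i => Y (X i)) i then 1 else 0) := by
        refine ev_mono fun X => ?_
        have h0 : ∀ i : Fin s, 0 ≤ φ (X j) *
          if RowSmall (√s * t) (fun i => Y (X i)) i then (1 : ℝ) else 0 := fun i =>
          mul_nonneg (hφ _) (by split_ifs <;> norm_num)
        by_cases hE : Esm t (fun i => Y (X i))
        · obtain ⟨i, hi⟩ := exists_rowSmall ht hE
          refine le_trans ?_ (single_le_sum (fun i _ => h0 i) (mem_univ i))
          simp [hE, hi]
        · simpa [hE] using sum_nonneg fun i _ => h0 i
    _ = ∑ i, ev (fun X : Fin s → Ω => φ (X j) *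
        if RowSmall (√s * t) (fun i => Y (X i)) i then 1 else 0) := ev_sum _ _
    _ ≤ ∑ _i : Fin s, (B + ev φ * B0) := by
        refine sum_le_sum fun i _ => ?_
        have hτ : Function.Injective fun _ : Fin 1 => i := Function.injective_of_subsingleton _
        rw [ev_resample _ hτ, ← ev_eval j φ, ← ev_mul_const, ← ev_const (Ω := Fin s → Ω) B,
          ← ev_add]
        refine ev_mono fun D => ?_
        obtain ⟨z, hz, hz'⟩ := exists_orthonormal (r := 1) (fun j : {j // j ≠ i} => Y (D j))
          (by simp; omega)
        obtain ⟨h, hh⟩ : ∃ h, h = z 0 := ⟨_, rfl⟩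
        have hq : q h = 1 := by rw [hh, hz.q_eq_one]
        have horth : ∀ j, j ≠ i → Y (D j) ⬝ᵥ h = 0 := fun j hj => by
          rw [hh]
          exact hz' ⟨j, hj⟩ 0
        have hei : ∀ d : Fin 1 → Ω, Function.extend (fun _ : Fin 1 => i) d D i = d 0 :=
          fun d => hτ.extend_apply d D 0
        have hej : ∀ d : Fin 1 → Ω, ∀ j, j ≠ i → Function.extend (fun _ : Fin 1 => i) d D j = D j :=
          fun d j hj => Function.extend_apply' _ _ _ fun ⟨_, h⟩ => hj h.symm
        have hind : ∀ d : Fin 1 → Ω, (if RowSmall (√s * t)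
            (fun l => Y (Function.extend (fun _ : Fin 1 => i) d D l)) i then (1 : ℝ) else 0) ≤
            if |Y (d 0) ⬝ᵥ h| ≤ √s * t then 1 else 0 := fun d => by
          by_cases hR : RowSmall (√s * t)
            (fun l => Y (Function.extend (fun _ : Fin 1 => i) d D l)) i
          · have := hR h hq fun l hl => by
              dsimp only
              rw [hej d l hl, horth l hl]
            dsimp only at this
            rw [hei] at this
            rw [if_pos this]
            split_ifs ; norm_num
          · rw [if_neg hR]
            split_ifs <;> norm_num
        by_cases hji : j = i
        · subst hji
          simp only [hei]
          calc _ ≤ ev (fun d : Fin 1 → Ω => φ (d 0) *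
                if |Y (d 0) ⬝ᵥ h| ≤ √s * t then 1 else 0) :=
                ev_mono fun d => mul_le_mul_of_nonneg_left (hind d) (hφ _)
            _ ≤ B := (ev_fin_one _).trans_le (h1 h hq)
            _ ≤ _ := le_add_of_nonneg_right (mul_nonneg (hφ _) hB0)
        · simp only [hej _ j hji]
          calc _ ≤ ev (fun d : Fin 1 → Ω => φ (D j) *
                if |Y (d 0) ⬝ᵥ h| ≤ √s * t then 1 else 0) :=
                ev_mono fun d => mul_le_mul_of_nonneg_left (hind d) (hφ _)
            _ = φ (D j) * ev (fun d : Fin 1 → Ω => if |Y (d 0) ⬝ᵥ h| ≤ √s * t then (1 : ℝ) else 0) :=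
                ev_const_mul _ _
            _ ≤ φ (D j) * B0 := by
                refine mul_le_mul_of_nonneg_left ?_ (hφ _)
                exact (ev_fin_one fun ω => if |Y ω ⬝ᵥ h| ≤ √s * t then (1 : ℝ) else 0).trans_le
                  (h2 h hq)
            _ ≤ _ := le_add_of_nonneg_left hB
    _ = _ := by
        rw [sum_const, card_univ, Fintype.card_fin, nsmul_eq_mul]

end Tail

section Kernel

/-- The coordinates of the columns in the frame `z`. -/
def coord {ι : Type*} [Fintype ι] {s : ℕ} (z : Fin s → ι → ℝ) (X : ι → Bool) : Fin s → ℝ :=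
  fun l => dot X (z l)

lemma coord_dotProduct {ι : Type*} [Fintype ι] [DecidableEq ι] {s : ℕ} (z : Fin s → ι → ℝ)
    (X : ι → Bool) (h : Fin s → ℝ) : coord z X ⬝ᵥ h = dot X (comb z h) := by
  rw [dot_comb, dotProduct]
  exact sum_congr rfl fun l _ => mul_comm _ _

/-- The weight dominating the indicator of large coordinates. -/
noncomputable def wt {ι : Type*} [Fintype ι] {s : ℕ} (R : ℝ) (z : Fin s → ι → ℝ) (X : ι → Bool) : ℝ :=
  Real.exp (-R) * ∑ l, (Real.exp (dot X (z l)) + Real.exp (dot X fun i => -1 * z l i))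

variable {ι : Type*} [Fintype ι] [DecidableEq ι] {s : ℕ}

lemma wt_nonneg (R : ℝ) (z : Fin s → ι → ℝ) (X : ι → Bool) : 0 ≤ wt R z X := by
  unfold wt
  positivity

lemma one_le_wt {R : ℝ} {z : Fin s → ι → ℝ} {X : ι → Bool} 
    (h : s * R ^ 2 < q (coord z X)) : 1 ≤ wt R z X := by
  obtain ⟨l, hl⟩ : ∃ l, R ^ 2 < coord z X l ^ 2 := by
    by_contra! hcon
    refine h.not_ge ((sum_le_sum fun l _ => hcon l).trans_eq ?_)
    simp
  have h1 : R < |dot X (z l)| := lt_of_pow_lt_pow_left₀ 2 (abs_nonneg _) (by rwa [sq_abs])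
  have h2 : Real.exp R ≤ Real.exp (dot X (z l)) + Real.exp (dot X fun i => -1 * z l i) := by
    rw [dot_smul]
    rcases lt_abs.1 h1 with h | h
    · exact (Real.exp_le_exp.2 h.le).trans (le_add_of_nonneg_right (Real.exp_nonneg _))
    · refine le_trans (Real.exp_le_exp.2 ?_) (le_add_of_nonneg_left (Real.exp_nonneg _))
      linarith
  calc (1 : ℝ) = Real.exp (-R) * Real.exp R := by rw [← Real.exp_add]; simp
    _ ≤ _ := by
      refine mul_le_mul_of_nonneg_left (h2.trans ?_) (Real.exp_nonneg _)
      exact single_le_sum (f := fun l => Real.exp (dot X (z l)) +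
        Real.exp (dot X fun i => -1 * z l i)) (fun l _ => by positivity) (mem_univ l)

end Kernel

end LSV

namespace LSV

open Finset MeasureTheory Matrix
open scoped ENNReal

lemma proj_small_ball {c : ℝ} (hc : 0 < c) : ∃ C : ℝ, 0 < C ∧ ∃ c' : ℝ, 0 < c' ∧ ∃ N0 : ℕ,
    ∀ (ι κ : Type) [Fintype ι] [DecidableEq ι] [Fintype κ] [DecidableEq κ] (D : κ → ι → Bool),
    N0 ≤ Fintype.card ι → Good (sal ^ 2) c D → ∀ (s : ℕ) (z : Fin s → ι → ℝ), OrthoN z →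
    (∀ k, im D (z k) = 0) → ∀ h, q h = 1 → ∀ z0, q z0 ≤ 1 → ∀ ρ,
    Real.exp (-c' * Fintype.card ι) ≤ ρ →
    ev (fun X => Real.exp (dot X z0) * if |coord z X ⬝ᵥ h| ≤ ρ then 1 else 0) ≤ C * ρ := by
  obtain ⟨C, hC, c', hc', N0, H⟩ := kernel_small_ball 1 hc
  refine ⟨C + 1, by positivity, c', hc', N0, ?_⟩
  intro ι κ _ _ _ _ D hN hG s z hz hk h hh z0 hz0 ρ hρ
  have hOh : OrthoN fun _ : Fin 1 => h := fun k l => by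
    rw [if_pos (Subsingleton.elim k l), ← hh]
    exact sum_congr rfl fun i _ => (sq _).symm
  have h1 := H ι κ D hN hG (fun _ => comb z h) (hz.comb hOh) (fun _ => im_comb hk h) z0 hz0
    (fun _ => ρ) (fun _ => hρ) (fun X => |coord z X ⬝ᵥ h| ≤ ρ) fun X hX _ => by
      rwa [← coord_dotProduct]
  refine h1.trans ?_
  rw [Fin.prod_univ_one]
  linarith

lemma pr_esm_le (k : ℕ) {c : ℝ} (hc : 0 < c) : ∃ C : ℝ, 0 < C ∧ ∃ c' : ℝ, 0 < c' ∧ ∃ N0 : ℕ,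
    ∀ (ι κ : Type) [Fintype ι] [DecidableEq ι] [Fintype κ] [DecidableEq κ] (D : κ → ι → Bool),
    N0 ≤ Fintype.card ι → Good (sal ^ 2) c D → ∀ z : Fin (k + 1) → ι → ℝ, OrthoN z →
    (∀ k, im D (z k) = 0) → ∀ t, Real.exp (-c' * Fintype.card ι) ≤ t →
    pr (fun X : Fin (k + 1) → ι → Bool => Esm t fun j => coord z (X j)) ≤ C * t := by
  classical
  obtain ⟨C, hC, c', hc', N0, H⟩ := proj_small_ball hc
  refine ⟨(k + 1) * (C * √(k + 1) + C * √(k + 1)), by positivity, c', hc', N0, ?_⟩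
  intro ι κ _ _ _ _ D hN hG z hz hk t ht
  have ht0 : 0 ≤ t := (Real.exp_nonneg _).trans ht
  have hρ : t ≤ √((k + 1 : ℕ) : ℝ) * t := le_mul_of_one_le_left ht0 (by
    rw [Real.one_le_sqrt]; push_cast; linarith [k.cast_nonneg (α := ℝ)])
  have h1 : ∀ h, q h = 1 → ev (fun X => if |coord z X ⬝ᵥ h| ≤ √((k + 1 : ℕ) : ℝ) * t
      then (1 : ℝ) else 0) ≤ C * (√((k + 1 : ℕ) : ℝ) * t) := fun h hh => by
    have := H ι κ D hN hG _ z hz hk h hh (fun _ => 0) (by simp [q]) _ (ht.trans hρ)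
    simpa [dot] using this
  have h2 := ev_esm_le (φ := fun _ => (1 : ℝ)) ht0 (B := C * (√((k + 1 : ℕ) : ℝ) * t))
    (by positivity) (by positivity) (coord z) (fun _ => zero_le_one)
    (fun h hh => by simpa only [one_mul] using h1 h hh) h1 0
  rw [pr_eq_ev]
  simp only [one_mul, ev_const] at h2
  refine h2.trans_eq ?_
  push_cast
  ring

lemma ev_wt_le {ι : Type*} [Fintype ι] [DecidableEq ι] {s : ℕ} (R : ℝ) {z : Fin s → ι → ℝ}
    {f : (ι → Bool) → ℝ} {B : ℝ} (hz : OrthoN z)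
    (h : ∀ z0, q z0 = 1 → ev (fun X => Real.exp (dot X z0) * f X) ≤ B) :
    ev (fun X => wt R z X * f X) ≤ Real.exp (-R) * (s * (2 * B)) := by
  have h1 : ∀ X, wt R z X * f X = Real.exp (-R) * ∑ l, (Real.exp (dot X (z l)) * f X +
      Real.exp (dot X fun i => -1 * z l i) * f X) := fun X => by
    simp only [wt, mul_assoc, sum_mul, add_mul]
  simp only [h1, ev_const_mul]
  refine mul_le_mul_of_nonneg_left ?_ (Real.exp_nonneg _)
  rw [ev_sum]
  calc _ ≤ ∑ _l : Fin s, (B + B) := by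
        refine sum_le_sum fun l _ => ?_
        rw [ev_add]
        refine add_le_add (h _ (hz.q_eq_one l)) (h _ ?_)
        rw [q_smul, hz.q_eq_one l]
        norm_num
    _ = _ := by
      rw [sum_const, card_univ, Fintype.card_fin, nsmul_eq_mul]
      ring

lemma pr_esm_tail (k : ℕ) {c : ℝ} (hc : 0 < c) {η : ℝ} (hη : 0 < η) :
    ∃ R : ℝ, 0 < R ∧ ∃ c' : ℝ, 0 < c' ∧ ∃ N0 : ℕ,
    ∀ (ι κ : Type) [Fintype ι] [DecidableEq ι] [Fintype κ] [DecidableEq κ] (D : κ → ι → Bool),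
    N0 ≤ Fintype.card ι → Good (sal ^ 2) c D → ∀ z : Fin (k + 1) → ι → ℝ, OrthoN z →
    (∀ k, im D (z k) = 0) → ∀ t, Real.exp (-c' * Fintype.card ι) ≤ t →
    pr (fun X : Fin (k + 1) → ι → Bool => (Esm t fun j => coord z (X j)) ∧
      ∃ j, R ^ 2 < q (coord z (X j))) ≤ η * t := by
  classical
  obtain ⟨C, hC, c', hc', N0, H⟩ := proj_small_ball hc
  obtain ⟨s, hs⟩ : ∃ s : ℝ, s = ((k + 1 : ℕ) : ℝ) := ⟨_, rfl⟩
  have hs1 : 1 ≤ s := by rw [hs]; push_cast; linarith [k.cast_nonneg (α := ℝ)]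
  have hs0 : 0 < s := by linarith
  obtain ⟨K, hK⟩ : ∃ K, K = s * (s * (s * (2 * (C * √s)) + s * (2 * Real.exp (1 / 2)) * (C * √s))) :=
    ⟨_, rfl⟩
  have hK0 : 0 < K := by rw [hK]; positivity
  obtain ⟨R, hR⟩ : ∃ R, R = Real.log (K / η + 1) := ⟨_, rfl⟩
  have hR0 : 0 < R := by
    rw [hR]
    exact Real.log_pos (by have := div_pos hK0 hη; linarith)
  have hRK : Real.exp (-R) * K ≤ η := by
    rw [hR, Real.exp_neg, Real.exp_log (by positivity), inv_mul_le_iff₀ (by positivity)]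
    rw [add_mul, div_mul_cancel₀ _ hη.ne']
    linarith
  refine ⟨√s * R, by positivity, c', hc', N0, ?_⟩
  intro ι κ _ _ _ _ D hN hG z hz hk t ht
  have ht0 : 0 ≤ t := (Real.exp_nonneg _).trans ht
  have hρ : t ≤ √s * t := le_mul_of_one_le_left ht0 (by rwa [Real.one_le_sqrt])
  have hproj : ∀ h, q h = 1 → ∀ z0, q z0 ≤ 1 → ev (fun X => Real.exp (dot X z0) *
      if |coord z X ⬝ᵥ h| ≤ √s * t then 1 else 0) ≤ C * (√s * t) := fun h hh z0 hz0 =>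
    H ι κ D hN hG _ z hz hk h hh z0 hz0 _ (ht.trans hρ)
  have hB0 : ∀ h, q h = 1 → ev (fun X => if |coord z X ⬝ᵥ h| ≤ √s * t
      then (1 : ℝ) else 0) ≤ C * (√s * t) := fun h hh => by
    simpa [dot] using hproj h hh (fun _ => 0) (by simp [q])
  have hB : ∀ h, q h = 1 → ev (fun X => wt R z X * if |coord z X ⬝ᵥ h| ≤ √s * t
      then (1 : ℝ) else 0) ≤ Real.exp (-R) * (s * (2 * (C * (√s * t)))) := fun h hh => by
    rw [hs]
    refine ev_wt_le R hz fun z0 hz0 => ?_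
    rw [← hs]
    exact hproj h hh z0 hz0.le
  have hwt : ev (wt R z) ≤ Real.exp (-R) * (s * (2 * Real.exp (1 / 2))) := by
    have := ev_wt_le (f := fun _ => 1) (B := Real.exp (1 / 2)) R hz fun z0 hz0 => by
      simp only [mul_one]
      exact (ev_exp_dot_le z0).trans_eq (by rw [hz0])
    simpa only [mul_one, ← hs] using this
  have h2 : ∀ j, ev (fun X : Fin (k + 1) → ι → Bool => wt R z (X j) *
      if Esm t (fun j => coord z (X j)) then 1 else 0) ≤
      s * (Real.exp (-R) * (s * (2 * (C * (√s * t)))) + ev (wt R z) * (C * (√s * t))) := fun j => by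
    rw [hs] at hB hB0 ⊢
    exact ev_esm_le ht0 (by positivity) (by positivity) (coord z) (wt_nonneg R z) hB hB0 j
  calc _ ≤ ev (fun X : Fin (k + 1) → ι → Bool => ∑ j, wt R z (X j) *
        if Esm t (fun j => coord z (X j)) then 1 else 0) := by
        have h0 : ∀ (X : Fin (k + 1) → ι → Bool) j, 0 ≤ wt R z (X j) *
            if Esm t (fun j => coord z (X j)) then (1 : ℝ) else 0 := fun X j =>
          mul_nonneg (wt_nonneg _ _ _) (by split_ifs <;> norm_num)
        refine pr_le_ev (fun X => sum_nonneg fun j _ => h0 X j) fun X ⟨hE, j, hj⟩ => ?_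
        refine le_trans ?_ (single_le_sum (fun j _ => h0 X j) (mem_univ j))
        rw [if_pos hE, mul_one]
        refine one_le_wt ?_
        rw [← hs]
        rwa [mul_pow, Real.sq_sqrt hs0.le] at hj
    _ = ∑ j, ev (fun X : Fin (k + 1) → ι → Bool => wt R z (X j) *
        if Esm t (fun j => coord z (X j)) then 1 else 0) := ev_sum _ _
    _ ≤ ∑ _j : Fin (k + 1), s * (Real.exp (-R) * (s * (2 * (C * (√s * t)))) +
          Real.exp (-R) * (s * (2 * Real.exp (1 / 2))) * (C * (√s * t))) := by
        refine sum_le_sum fun j _ => (h2 j).trans ?_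
        gcongr
    _ = Real.exp (-R) * K * t := by
        rw [sum_const, card_univ, Fintype.card_fin, nsmul_eq_mul, ← hs, hK]
        ring
    _ ≤ η * t := by gcongr

end LSV

namespace LSV

open Finset MeasureTheory Matrix Filter Topology
open scoped ENNReal

lemma q_vecMul_le {m : ℕ} (x : Fin m → ℝ) (A : Fin m → Fin m → ℝ) :
    q (x ᵥ* of A) ≤ q x * ∑ j, q (A j) := by
  have h : ∑ j, q (A j) = ∑ i, ∑ j, A j i ^ 2 := sum_comm
  rw [h, mul_sum]
  exact sum_le_sum fun i _ => sq_sum_mul_le x fun j => A j i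

lemma Esm.perturb {m : ℕ} {t ρ : ℝ} {Y M : Fin m → Fin m → ℝ} (ht : 0 ≤ t) (hρ : 0 ≤ ρ)
    (h : Esm t Y) (hM : ∑ j, q (fun i => M j i - Y j i) ≤ ρ ^ 2) : Esm (t + ρ) M := by
  obtain ⟨x, hx, hxY⟩ := h
  refine ⟨x, hx, ?_⟩
  have h1 : q (x ᵥ* of fun j i => M j i - Y j i) ≤ ρ ^ 2 := by
    refine (q_vecMul_le _ _).trans ?_
    rwa [hx, one_mul]
  have h2 : x ᵥ* of M = fun i => (x ᵥ* of Y) i + (x ᵥ* of fun j i => M j i - Y j i) i := by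
    funext i
    simp only [vecMul, dotProduct, ← sum_add_distrib, of_apply]
    exact sum_congr rfl fun j _ => by ring
  rw [← Real.sqrt_le_left (by positivity), h2]
  refine (sqrt_q_add_le _ _).trans (add_le_add ?_ ?_)
  · rwa [Real.sqrt_le_left ht]
  · rwa [Real.sqrt_le_left hρ]

lemma lintegral_affine {a b : ℕ} {τ : ℝ} (hτ : 0 < τ) (Y : Fin a → Fin b → ℝ)
    {F : (Fin a → Fin b → ℝ) → ℝ≥0∞} (hF : Measurable F) :
    ∫⁻ M : Fin a → Fin b → ℝ, F (τ⁻¹ • (M - Y)) = ENNReal.ofReal (τ ^ (a * b)) * ∫⁻ M, F M := by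
  rw [lintegral_sub_right_eq_self (fun M => F (τ⁻¹ • M)) Y]
  have h : Measurable fun M : Fin a → Fin b → ℝ => τ⁻¹ • M := measurable_const_smul _
  rw [← lintegral_map hF h, Measure.map_addHaar_smul _ (inv_ne_zero hτ.ne'), lintegral_smul_measure,
    smul_eq_mul]
  congr 2
  rw [Module.finrank_pi_fintype]
  simp [abs_of_pos hτ]

lemma exists_ball_mass {a b : ℕ} {θ : ℝ} (hθ : θ < 1) :
    ∃ r : ℝ, 0 < r ∧ ENNReal.ofReal (θ * √(2 * Real.pi) ^ (b * a)) ≤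
      ∫⁻ M in {M : Fin a → Fin b → ℝ | ∑ j, q (M j) ≤ r ^ 2}, gW M := by
  obtain ⟨μ, hμ⟩ : ∃ μ : Measure (Fin a → Fin b → ℝ), μ = volume.withDensity gW := ⟨_, rfl⟩
  obtain ⟨B, hB⟩ : ∃ B : ℕ → Set (Fin a → Fin b → ℝ), 
      B = fun n : ℕ => {M | ∑ j, q (M j) ≤ (n : ℝ) ^ 2} :=
    ⟨_, rfl⟩
  have hmono : Monotone B := by
    rw [hB]
    intro m n hmn M hM
    have hM' : ∑ j, q (M j) ≤ (m : ℝ) ^ 2 := hM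
    refine hM'.trans ?_
    gcongr
  have hU : ⋃ n, B n = Set.univ := by
    rw [hB]
    refine Set.eq_univ_of_forall fun M => Set.mem_iUnion.2 ?_
    obtain ⟨n, hn⟩ := exists_nat_ge (√(∑ j, q (M j)))
    exact ⟨n, (Real.sqrt_le_left (Nat.cast_nonneg n)).1 hn⟩
  have hT := tendsto_measure_iUnion_atTop (μ := μ) hmono
  have hlt : ENNReal.ofReal (θ * √(2 * Real.pi) ^ (b * a)) < μ (⋃ n, B n) := by
    rw [hU, hμ, withDensity_apply _ MeasurableSet.univ, setLIntegral_univ, lintegral_gW,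
      ← ENNReal.ofReal_pow (by positivity)]
    have : 0 < √(2 * Real.pi) ^ (b * a) := by positivity
    rw [ENNReal.ofReal_lt_ofReal_iff this]
    nlinarith
  obtain ⟨n, hn, hn1⟩ := ((hT.eventually (lt_mem_nhds hlt)).and (eventually_ge_atTop 1)).exists
  refine ⟨n, by exact_mod_cast hn1, hn.le.trans_eq ?_⟩
  have hm : MeasurableSet (B n) := by
    rw [hB]
    exact (isClosed_le (continuous_finsetSum _ fun j _ => continuous_q'.comp (continuous_apply j))
      continuous_const).measurableSet
  rw [Function.comp_apply, hμ, withDensity_apply _ hm, hB]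

lemma ofReal_pr_mul_le {Ω α : Type*} [Fintype Ω] [MeasurableSpace α] (μ : Measure α) (E : Ω → Prop)
    (m : ℝ≥0∞) {f : Ω → α → ℝ} (hf : ∀ ω a, 0 ≤ f ω a) (hm : ∀ ω, Measurable (f ω))
    (h : ∀ ω, E ω → m ≤ ∫⁻ a, ENNReal.ofReal (f ω a) ∂μ) :
    ENNReal.ofReal (pr E) * m ≤ ∫⁻ a, ENNReal.ofReal (ev fun ω => f ω a) ∂μ := by
  classical
  have h1 : ∀ a, ENNReal.ofReal (ev fun ω => f ω a) =
      ∑ ω, ENNReal.ofReal (1 / Fintype.card Ω) * ENNReal.ofReal (f ω a) := fun a => by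
    rw [ev, div_eq_mul_one_div, mul_comm, mul_sum,
      ENNReal.ofReal_sum_of_nonneg fun ω _ => mul_nonneg (by positivity) (hf ω a)]
    exact sum_congr rfl fun ω _ => ENNReal.ofReal_mul (by positivity)
  have h2 : ENNReal.ofReal (pr E) = ∑ ω, ENNReal.ofReal (1 / Fintype.card Ω) * if E ω then 1 else 0 := by
    rw [pr_eq_ev, ev, div_eq_mul_one_div, mul_comm, mul_sum, ENNReal.ofReal_sum_of_nonneg]
    · refine sum_congr rfl fun ω _ => ?_
      split_ifs <;> simp
    · intro ω _
      split_ifs <;> positivity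
  simp only [h1]
  rw [lintegral_finsetSum _ fun ω _ => (hm ω).ennreal_ofReal.const_mul _, h2, sum_mul]
  refine sum_le_sum fun ω _ => ?_
  rw [lintegral_const_mul _ (hm ω).ennreal_ofReal, mul_assoc]
  gcongr
  split_ifs with hE
  · rw [one_mul]
    exact h ω hE
  · simp

lemma pr_esm_trunc_le {Ω : Type*} [Fintype Ω] {k : ℕ} {τ η R r t : ℝ} (Y : Ω → Fin (k + 1) → ℝ)
    (hτ : 0 < τ) (hη : 0 ≤ η) (hR : 0 ≤ R) (hr : 0 ≤ r) (ht : 0 ≤ t) (hτr : τ * r ≤ 1)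
    (hY : ∀ y, q y ≤ (R + 1) ^ 2 → ev (fun ω => Real.exp (-(q (fun l => Y ω l - y l) / (2 * τ ^ 2)))) ≤
      (1 + η) * τ ^ (k + 1) * Real.exp (-(q y / 2)))
    (hmass : ENNReal.ofReal ((1 - η) * √(2 * Real.pi) ^ ((k + 1) * (k + 1))) ≤
      ∫⁻ M in {M : Fin (k + 1) → Fin (k + 1) → ℝ | ∑ j, q (M j) ≤ r ^ 2}, gW M) :
    pr (fun X : Fin (k + 1) → Ω => (Esm t fun j => Y (X j)) ∧ ∀ j, q (Y (X j)) ≤ R ^ 2) * (1 - η) ≤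
      (1 + η) ^ (k + 1) * (√(k + 1) * (t + τ * r)) := by
  classical
  obtain ⟨w, hw⟩ : ∃ w, w = √(2 * Real.pi) ^ ((k + 1) * (k + 1)) := ⟨_, rfl⟩
  have hw0 : 0 < w := by rw [hw]; positivity
  rw [← hw] at hmass
  obtain ⟨S, hS⟩ : ∃ S : Set (Fin (k + 1) → Fin (k + 1) → ℝ),
    S = {M | Esm (t + τ * r) M ∧ ∀ j, q (M j) ≤ (R + 1) ^ 2} := ⟨_, rfl⟩
  obtain ⟨E, hE⟩ : ∃ E : (Fin (k + 1) → Ω) → Prop,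
    E = fun X => (Esm t fun j => Y (X j)) ∧ ∀ j, q (Y (X j)) ≤ R ^ 2 := ⟨_, rfl⟩
  obtain ⟨f, hf⟩ : ∃ f : (Fin (k + 1) → Ω) → (Fin (k + 1) → Fin (k + 1) → ℝ) → ℝ,
    f = fun X M => ∏ j, Real.exp (-(q (fun l => Y (X j) l - M j l) / (2 * τ ^ 2))) := ⟨_, rfl⟩
  have hf0 : ∀ X M, 0 ≤ f X M := fun X M => by rw [hf]; positivity
  have hfm : ∀ X, Measurable (f X) := fun X => by
    rw [hf]
    refine Continuous.measurable (continuous_finsetProd _ fun j _ => Real.continuous_exp.comp ?_)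
    refine Continuous.neg (Continuous.div_const (continuous_q'.comp ?_) _)
    fun_prop
  have hfg : ∀ X M, ENNReal.ofReal (f X M) = gW (τ⁻¹ • (M - fun j => Y (X j))) := fun X M => by
    rw [hf, ENNReal.ofReal_prod_of_nonneg fun _ _ => Real.exp_nonneg _]
    refine prod_congr rfl fun j _ => ?_
    unfold gw
    congr 2
    rw [Pi.smul_apply, q_smul']
    have : q ((M - fun j => Y (X j)) j) = q fun l => Y (X j) l - M j l :=
      sum_congr rfl fun l _ => by simp only [Pi.sub_apply]; ring
    rw [this]
    field_simp
  have hlow : ∀ X, E X → ENNReal.ofReal (τ ^ ((k + 1) * (k + 1))) * ENNReal.ofReal ((1 - η) * w) ≤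
      ∫⁻ M in S, ENNReal.ofReal (f X M) := fun X hX => by
    rw [hE] at hX
    obtain ⟨B, hB⟩ : ∃ B : Set (Fin (k + 1) → Fin (k + 1) → ℝ), B = {M | ∑ j, q (M j) ≤ r ^ 2} :=
      ⟨_, rfl⟩
    have hBm : MeasurableSet B := by
      rw [hB]
      exact (isClosed_le (continuous_finsetSum _ fun j _ => continuous_q'.comp (continuous_apply j))
        continuous_const).measurableSet
    rw [← hB, ← lintegral_indicator hBm] at hmass
    have hTm : Measurable fun M : Fin (k + 1) → Fin (k + 1) → ℝ => τ⁻¹ • (M - fun j => Y (X j)) := by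
      fun_prop
    have hsub : (fun M : Fin (k + 1) → Fin (k + 1) → ℝ => τ⁻¹ • (M - fun j => Y (X j))) ⁻¹' B ⊆ S := by
      intro M hM
      have hM1 : ∑ j, q (fun i => M j i - Y (X j) i) ≤ (τ * r) ^ 2 := by
        rw [hB] at hM
        have hM2 : ∑ j, q ((τ⁻¹ • (M - fun j => Y (X j))) j) ≤ r ^ 2 := hM
        simp only [Pi.smul_apply, q_smul', ← mul_sum] at hM2
        rw [inv_pow, inv_mul_le_iff₀ (by positivity), ← mul_pow] at hM2
        exact hM2
      rw [hS]
      refine ⟨hX.1.perturb ht (by positivity) hM1, fun j => ?_⟩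
      have h1 : q (fun i => M j i - Y (X j) i) ≤ 1 ^ 2 :=
        (single_le_sum (f := fun j => q fun i => M j i - Y (X j) i) (fun _ _ => q_nonneg _)
          (mem_univ j)).trans (hM1.trans (by gcongr))
      have h2 : M j = fun i => Y (X j) i + (M j i - Y (X j) i) := by
        funext i
        ring
      rw [← Real.sqrt_le_left (by positivity), h2]
      refine (sqrt_q_add_le _ _).trans (add_le_add ?_ ?_)
      · rw [Real.sqrt_le_left hR]
        exact hX.2 j
      · rwa [Real.sqrt_le_left zero_le_one]
    calc _ ≤ ENNReal.ofReal (τ ^ ((k + 1) * (k + 1))) * ∫⁻ M, B.indicator gW M := by gcongr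
      _ = ∫⁻ M : Fin (k + 1) → Fin (k + 1) → ℝ, B.indicator gW (τ⁻¹ • (M - fun j => Y (X j))) :=
        (lintegral_affine hτ _ (measurable_gW.indicator hBm)).symm
      _ = ∫⁻ M in (fun M : Fin (k + 1) → Fin (k + 1) → ℝ => τ⁻¹ • (M - fun j => Y (X j))) ⁻¹' B,
            ENNReal.ofReal (f X M) := by
        rw [← lintegral_indicator (hTm hBm)]
        refine lintegral_congr fun M => ?_
        simp only [Set.indicator, Set.mem_preimage, hfg]
      _ ≤ _ := lintegral_mono_set hsub
  have hup : ∀ M ∈ S, ENNReal.ofReal (ev fun X => f X M) ≤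
      ENNReal.ofReal (((1 + η) * τ ^ (k + 1)) ^ (k + 1)) * gW M := fun M hM => by
    rw [hS] at hM
    have h1 : ev (fun X => f X M) ≤ ∏ j, ((1 + η) * τ ^ (k + 1) * Real.exp (-(q (M j) / 2))) := by
      rw [hf, ev_pi_prod fun j ω => Real.exp (-(q (fun l => Y ω l - M j l) / (2 * τ ^ 2)))]
      exact prod_le_prod (fun j _ => ev_nonneg fun _ => Real.exp_nonneg _) fun j _ => hY _ (hM.2 j)
    refine (ENNReal.ofReal_le_ofReal h1).trans_eq ?_
    rw [prod_mul_distrib, prod_const, card_univ, Fintype.card_fin, ENNReal.ofReal_mul (by positivity),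
      ENNReal.ofReal_prod_of_nonneg fun _ _ => Real.exp_nonneg _]
    rfl
  have hmain := ofReal_pr_mul_le (volume.restrict S) E _ hf0 hfm hlow
  have hfin : ENNReal.ofReal (pr E) * (ENNReal.ofReal (τ ^ ((k + 1) * (k + 1))) *
      ENNReal.ofReal ((1 - η) * w)) ≤ ENNReal.ofReal (((1 + η) * τ ^ (k + 1)) ^ (k + 1)) *
        ENNReal.ofReal (√(k + 1) * (t + τ * r) * w) := by
    refine hmain.trans ((setLIntegral_mono (measurable_gW.const_mul _) hup).trans ?_)
    rw [lintegral_const_mul _ measurable_gW]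
    gcongr
    rw [hw, ← sq]
    refine (lintegral_mono_set ?_).trans (lintegral_esm_le (by positivity))
    rw [hS]
    exact fun M hM => hM.1
  rw [← ENNReal.ofReal_mul (by positivity), ← ENNReal.ofReal_mul (pr_nonneg _),
    ← ENNReal.ofReal_mul (by positivity), ENNReal.ofReal_le_ofReal_iff (by positivity)] at hfin
  rw [hE] at hfin
  refine le_of_mul_le_mul_right ?_ (show 0 < τ ^ ((k + 1) * (k + 1)) * w by positivity)
  rw [mul_pow, ← pow_mul] at hfin
  linarith

end LSV

namespace LSV

open Finset MeasureTheory Filter Topology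

lemma exists_nat_exp_le (K : ℝ) {c η : ℝ} (hc : 0 < c) (hη : 0 < η) :
    ∃ N0 : ℕ, ∀ N : ℕ, N0 ≤ N → K * Real.exp (-c * N) ≤ η := by
  have h : Tendsto (fun N : ℕ => K * Real.exp (-c * N)) atTop (𝓝 (K * 0)) := by
    refine Tendsto.const_mul K (Real.tendsto_exp_atBot.comp ?_)
    exact tendsto_natCast_atTop_atTop.const_mul_atTop_of_neg (neg_lt_zero.2 hc)
  rw [mul_zero] at h
  exact eventually_atTop.1 (h.eventually (ge_mem_nhds hη))

lemma exists_loss (k : ℕ) {η : ℝ} (hη : 0 < η) :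
    ∃ a : ℝ, 0 < a ∧ a < 1 ∧ a + (1 + a) ^ (k + 2) / (1 - a) ≤ 1 + η := by
  have h : Tendsto (fun a : ℝ => a + (1 + a) ^ (k + 2) / (1 - a)) (𝓝[>] 0) (𝓝 1) := by
    have h0 : ContinuousAt (fun a : ℝ => a + (1 + a) ^ (k + 2) / (1 - a)) 0 := by
      refine ContinuousAt.add continuousAt_id (ContinuousAt.div ?_ ?_ (by norm_num))
      · fun_prop
      · fun_prop
    have h1 := h0.tendsto.mono_left (nhdsWithin_le_nhds (s := Set.Ioi 0))
    simpa using h1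
  have h2 := h.eventually (ge_mem_nhds (show (1 : ℝ) < 1 + η by linarith))
  obtain ⟨a, ha, ha'⟩ := (h2.and (Ioo_mem_nhdsGT zero_lt_one)).exists
  exact ⟨a, ha'.1, ha'.2, ha⟩

theorem pr_esm_le_of_deloc (k : ℕ) {c : ℝ} (hc : 0 < c) {η : ℝ} (hη : 0 < η) :
    ∃ η0 : ℝ, 0 < η0 ∧ ∃ c' : ℝ, 0 < c' ∧ ∃ N0 : ℕ,
    ∀ (ι κ : Type) [Fintype ι] [DecidableEq ι] [Fintype κ] [DecidableEq κ] (D : κ → ι → Bool),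
    N0 ≤ Fintype.card ι → Good (sal ^ 2) c D → Deloc η0 D → ∀ z : Fin (k + 1) → ι → ℝ, OrthoN z →
    (∀ k, im D (z k) = 0) → ∀ t, Real.exp (-c' * Fintype.card ι) ≤ t →
    pr (fun X : Fin (k + 1) → ι → Bool => Esm t fun j => coord z (X j)) ≤ (1 + η) * √(k + 1) * t := by
  obtain ⟨a, ha, ha1, haη⟩ := exists_loss k hη
  obtain ⟨R, hR, cT, hcT, NT, HT⟩ := pr_esm_tail k hc ha
  obtain ⟨r, hr, hmass⟩ := exists_ball_mass (a := k + 1) (b := k + 1) (show 1 - a < 1 by linarith)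
  obtain ⟨p, hp⟩ : ∃ p, p = a * ((√(2 * Real.pi))⁻¹ ^ (k + 1) * Real.exp (-((R + 1) ^ 2 / 2))) :=
    ⟨_, rfl⟩
  have hp0 : 0 < p := by rw [hp]; positivity
  obtain ⟨η0, hη0, c', hc', Nd, Hd⟩ := density_bound (k + 1) hc hp0
  obtain ⟨N1, H1⟩ := exists_nat_exp_le r (half_pos hc') ha
  refine ⟨η0, hη0, min cT (c' / 2), by positivity, max NT (max Nd N1), ?_⟩
  intro ι κ _ _ _ _ D hN hG hDl z hz hk t ht
  obtain ⟨N, hN'⟩ : ∃ N, N = Fintype.card ι := ⟨_, rfl⟩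
  obtain ⟨τ, hτ⟩ : ∃ τ, τ = Real.exp (-c' * N) := ⟨_, rfl⟩
  have hτ0 : 0 < τ := by rw [hτ]; positivity
  have ht0 : 0 ≤ t := (Real.exp_nonneg _).trans ht
  rw [max_le_iff, max_le_iff] at hN
  have hexp : ∀ b, min cT (c' / 2) ≤ b → Real.exp (-b * Fintype.card ι) ≤ t := fun b hb => by
    refine le_trans (Real.exp_le_exp.2 ?_) ht
    gcongr
  have hhalf : Real.exp (-(c' / 2) * N) ≤ t := by rw [hN']; exact hexp _ (min_le_right _ _)
  have hτsq : τ = Real.exp (-(c' / 2) * N) * Real.exp (-(c' / 2) * N) := by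
    rw [hτ, ← Real.exp_add]
    congr 1
    ring
  have hτr : τ * r ≤ a * Real.exp (-(c' / 2) * N) := by
    have := H1 N (hN'.symm ▸ hN.2.2)
    rw [hτsq]
    nlinarith [Real.exp_pos (-(c' / 2) * N)]
  have hY : ∀ y, q y ≤ (R + 1) ^ 2 → ev (fun X => Real.exp (-(q (fun l => coord z X l - y l) /
      (2 * τ ^ 2)))) ≤ (1 + a) * τ ^ (k + 1) * Real.exp (-(q y / 2)) := fun y hy => by
    have h := Hd ι κ D hN.2.1 hG hDl z hz hk y
    rw [← hN', ← hτ] at h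
    have hpe : p ≤ a * ((√(2 * Real.pi))⁻¹ ^ (k + 1) * Real.exp (-(q y / 2))) := by
      rw [hp]
      gcongr
    have hs : 0 < (√(2 * Real.pi)) ^ (k + 1) := by positivity
    have h2 := h.trans (add_le_add_right hpe _)
    rw [mul_inv, mul_pow, inv_pow, inv_pow, mul_assoc, inv_mul_le_iff₀ hs,
      inv_mul_le_iff₀ (by positivity)] at h2
    refine h2.trans_eq ?_
    field_simp
  have hE := pr_esm_trunc_le (coord z) hτ0 ha.le hR.le hr.le ht0
    (hτr.trans (mul_le_one₀ ha1.le (Real.exp_nonneg _) (Real.exp_le_one_iff.2 (by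
      have : 0 ≤ c' / 2 * N := by positivity
      linarith)))) hY hmass
  have hs1 : 1 ≤ √((k : ℝ) + 1) := by
    rw [Real.one_le_sqrt]
    linarith [k.cast_nonneg (α := ℝ)]
  have hE' : pr (fun X : Fin (k + 1) → ι → Bool => (Esm t fun j => coord z (X j)) ∧
      ∀ j, q (coord z (X j)) ≤ R ^ 2) ≤ (1 + a) ^ (k + 2) / (1 - a) * (√(k + 1) * t) := by
    rw [div_mul_eq_mul_div, le_div_iff₀ (by linarith)]
    refine hE.trans ?_
    calc _ ≤ (1 + a) ^ (k + 1) * (√(k + 1) * (t + a * t)) := by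
          have : τ * r ≤ a * t := hτr.trans (by gcongr)
          gcongr
      _ = _ := by ring
  calc _ ≤ pr (fun X : Fin (k + 1) → ι → Bool => ((Esm t fun j => coord z (X j)) ∧
        ∃ j, R ^ 2 < q (coord z (X j))) ∨ ((Esm t fun j => coord z (X j)) ∧
        ∀ j, q (coord z (X j)) ≤ R ^ 2)) := by
        refine pr_mono fun X hX => ?_
        by_cases h : ∃ j, R ^ 2 < q (coord z (X j))
        · exact Or.inl ⟨hX, h⟩
        · push Not at h
          exact Or.inr ⟨hX, h⟩
    _ ≤ a * t + (1 + a) ^ (k + 2) / (1 - a) * (√(k + 1) * t) :=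
      (pr_or_le _ _).trans (add_le_add (HT ι κ D hN.1 hG z hz hk t (hexp _ (min_le_left _ _))) hE')
    _ ≤ a * (√(k + 1) * t) + (1 + a) ^ (k + 2) / (1 - a) * (√(k + 1) * t) := by
      gcongr
      exact le_mul_of_one_le_left ht0 hs1
    _ = (a + (1 + a) ^ (k + 2) / (1 - a)) * (√(k + 1) * t) := by ring
    _ ≤ _ := by
      rw [mul_assoc]
      gcongr

end LSV

namespace LSV

open Finset Matrix

lemma bessel {ι : Type*} [Fintype ι] [DecidableEq ι] {r : ℕ} {z : Fin r → ι → ℝ} (hz : OrthoN z)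
    (w : ι → ℝ) : ∑ l, (∑ i, w i * z l i) ^ 2 ≤ q w := by
  obtain ⟨ξ, hξ⟩ : ∃ ξ : Fin r → ℝ, ξ = fun l => ∑ i, w i * z l i := ⟨_, rfl⟩
  have h1 : ∑ i, w i * comb z ξ i = q ξ := by
    simp only [comb, mul_sum, q]
    rw [sum_comm]
    refine sum_congr rfl fun l _ => ?_
    rw [sq]
    nth_rw 3 [hξ]
    rw [mul_sum]
    exact sum_congr rfl fun i _ => by ring
  have h2 : (∑ i, w i * comb z ξ i) ^ 2 ≤ q w * q (comb z ξ) := sq_sum_mul_le _ _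
  rw [h1, q_comb hz] at h2
  have h3 : q ξ ≤ q w := by
    rcases (q_nonneg ξ).eq_or_lt with h | h
    · rw [← h]
      exact q_nonneg w
    · rw [sq] at h2
      exact le_of_mul_le_mul_right h2 h
  rwa [hξ] at h3

/-- A vector with mass on the range of `τ` is nearly annihilated by the columns `D`. -/
def SubSmall {m s : ℕ} (τ : Fin s → Fin m) (t : ℝ) (D : Fin m → Fin m → Bool) : Prop :=
  ∃ v : Fin m → ℝ, 0 < ∑ a, v (τ a) ^ 2 ∧ q (tr D v) ≤ t ^ 2 * ∑ a, v (τ a) ^ 2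

lemma SubSmall.esm {m s : ℕ} {τ : Fin s → Fin m} (hτ : Function.Injective τ) {t : ℝ}
    {D : Fin m → Fin m → Bool} (h : SubSmall τ t D) {z : Fin s → Fin m → ℝ} (hz : OrthoN z)
    (hk : ∀ l k, (∀ a, τ a ≠ k) → dot (D k) (z l) = 0) :
    Esm t fun a => coord z (D (τ a)) := by
  obtain ⟨v, hv, hvt⟩ := h
  obtain ⟨Q, hQ⟩ : ∃ Q, Q = ∑ a, v (τ a) ^ 2 := ⟨_, rfl⟩
  rw [← hQ] at hv hvt
  have h1 : (fun a => v (τ a)) ᵥ* of (fun a => coord z (D (τ a))) =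
      fun l => ∑ i, tr D v i * z l i := by
    funext l
    rw [sum_tr_mul]
    refine Fintype.sum_of_injective τ hτ _ _ (fun k hk' => ?_) fun a => rfl
    rw [hk l k fun a ha => hk' ⟨a, ha⟩, mul_zero]
  have h2 : q ((fun a => v (τ a)) ᵥ* of (fun a => coord z (D (τ a)))) ≤ t ^ 2 * Q := by
    rw [h1]
    exact (bessel hz _).trans hvt
  refine ⟨(√Q)⁻¹ • fun a => v (τ a), ?_, ?_⟩
  · rw [q_smul', inv_pow, Real.sq_sqrt hv.le, inv_mul_eq_one₀ hv.ne', hQ]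
    rfl
  · rw [smul_vecMul, q_smul', inv_pow, Real.sq_sqrt hv.le, inv_mul_le_iff₀ hv, mul_comm]
    exact h2

theorem pr_subSmall_le (k : ℕ) {η : ℝ} (hη : 0 < η) : ∃ c : ℝ, 0 < c ∧ ∃ N0 : ℕ, ∀ m : ℕ, N0 ≤ m →
    ∀ τ : Fin (k + 1) → Fin m, Function.Injective τ → ∀ t, Real.exp (-c * m) ≤ t →
    pr (SubSmall τ t) ≤ (1 + η) * √(k + 1) * t := by
  classical
  obtain ⟨c, hc, N1, H1⟩ := pr_not_nice (k + 1)
  obtain ⟨C, hC, c2, hc2, N2, H2⟩ := pr_esm_le k hc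
  have hη3 : 0 < η / 3 := by positivity
  obtain ⟨η0, hη0, c3, hc3, N3, H3⟩ := pr_esm_le_of_deloc k hc hη3
  obtain ⟨N4, H4⟩ := pr_not_deloc (k + 1) hη0 (div_pos hη3 hC)
  obtain ⟨N5, H5⟩ := exists_nat_exp_le 1 (half_pos hc) hη3
  refine ⟨min (c / 2) (min c2 c3), by positivity, max (max N1 N2) (max (max N3 N4) N5), ?_⟩
  intro m hm τ hτ t ht
  simp only [max_le_iff] at hm
  obtain ⟨⟨hm1, hm2⟩, ⟨hm3, hm4⟩, hm5⟩ := hm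
  have ht0 : 0 ≤ t := (Real.exp_nonneg _).trans ht
  have hexp : ∀ b, min (c / 2) (min c2 c3) ≤ b → Real.exp (-b * m) ≤ t := fun b hb => by
    refine le_trans (Real.exp_le_exp.2 ?_) ht
    gcongr
  have hcm : Real.exp (-c * m) ≤ η / 3 * t := by
    have h : Real.exp (-c * m) = Real.exp (-(c / 2) * m) * Real.exp (-(c / 2) * m) := by
      rw [← Real.exp_add]
      congr 1
      ring
    rw [h]
    have h5 := H5 m hm5
    rw [one_mul] at h5
    exact mul_le_mul h5 (hexp _ (min_le_left _ _)) (Real.exp_nonneg _) hη3.le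
  have hs1 : 1 ≤ √((k : ℝ) + 1) := by
    rw [Real.one_le_sqrt]
    linarith [k.cast_nonneg (α := ℝ)]
  have hcard : Fintype.card {i : Fin m // ∀ a, τ a ≠ i} + (k + 1) = Fintype.card (Fin m) := by
    have h1 : Fintype.card {i : Fin m // ∃ a, τ a = i} = k + 1 := by
      have h := (Fintype.card_congr (Equiv.ofInjective τ hτ)).symm.trans (Fintype.card_fin (k + 1))
      refine Eq.trans ?_ h
      exact Fintype.card_congr (Equiv.refl _)
    have h2 := Fintype.card_subtype_compl fun i : Fin m => ∃ a, τ a = i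
    have h3 := Fintype.card_subtype_le fun i : Fin m => ∃ a, τ a = i
    have h4 : Fintype.card {i : Fin m // ∀ a, τ a ≠ i} =
        Fintype.card {i : Fin m // ¬ ∃ a, τ a = i} := by
      simp only [not_exists, ne_eq]
    omega
  obtain ⟨g, hg⟩ : ∃ g : ({i : Fin m // ∀ a, τ a ≠ i} → Fin m → Bool) → ℝ, g = fun D =>
    (if ¬ Nice c D then 1 else 0) + C * t * (if ¬ Deloc η0 D then 1 else 0) +
      (1 + η / 3) * √(k + 1) * t := ⟨_, rfl⟩
  have hmain : pr (SubSmall τ t) ≤ ev fun D : Fin m → Fin m → Bool =>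
      g fun i : {i : Fin m // ∀ a, τ a ≠ i} => D i := by
    refine pr_resample_le τ hτ _ _ fun D => ?_
    obtain ⟨D', hD'⟩ : ∃ D' : {i : Fin m // ∀ a, τ a ≠ i} → Fin m → Bool,
      D' = fun i => D i.1 := ⟨_, rfl⟩
    obtain ⟨z, hz, hk⟩ := exists_frame D' hcard.le
    have hsub : pr (fun d : Fin (k + 1) → Fin m → Bool => SubSmall τ t (Function.extend τ d D)) ≤
        pr fun d : Fin (k + 1) → Fin m → Bool => Esm t fun a => coord z (d a) := by
      refine pr_mono fun d hd => ?_
      have := hd.esm hτ hz fun l i hi => by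
        rw [Function.extend_apply' _ _ _ fun ⟨a, ha⟩ => hi a ha]
        have := congrFun (hk l) ⟨i, hi⟩
        rwa [hD'] at this
      simpa only [hτ.extend_apply] using this
    refine hsub.trans ?_
    rw [hg, ← hD']
    have hpos : 0 ≤ (1 + η / 3) * √(k + 1) * t := by positivity
    have hpos2 : 0 ≤ C * t := by positivity
    by_cases hN : Nice c D'
    · by_cases hDl : Deloc η0 D'
      · have := H3 (Fin m) _ D' (by simpa using hm3) hN.2.2 hDl z hz hk t
          (by simpa using hexp c3 ((min_le_right _ _).trans (min_le_right _ _)))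
        simpa [hN, hDl] using this
      · have := H2 (Fin m) _ D' (by simpa using hm2) hN.2.2 z hz hk t
          (by simpa using hexp c2 ((min_le_right _ _).trans (min_le_left _ _)))
        simp only [hN, hDl, not_true_eq_false, not_false_eq_true, if_true, if_false]
        linarith
    · have := pr_le_one fun d : Fin (k + 1) → Fin m → Bool => Esm t fun a => coord z (d a)
      simp only [hN, not_false_eq_true, if_true]
      split_ifs <;> linarith
  refine hmain.trans ?_
  rw [ev_restrict (fun i => ∀ a, τ a ≠ i) g, hg, ev_add, ev_add, ev_const_mul, ev_const, ← pr_eq_ev,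
    ← pr_eq_ev]
  have h1 := H1 (Fin m) {i : Fin m // ∀ a, τ a ≠ i} hcard (by simpa using hm1)
  have h4 := H4 (Fin m) {i : Fin m // ∀ a, τ a ≠ i} hcard (by simpa using hm4)
  rw [Fintype.card_fin] at h1
  have h4' : C * t * pr (fun D : {i : Fin m // ∀ a, τ a ≠ i} → Fin m → Bool => ¬ Deloc η0 D) ≤
      η / 3 * t := by
    calc _ ≤ C * t * (η / 3 / C) := by gcongr
      _ = _ := by field_simp
  have h5 : t ≤ √(k + 1) * t := le_mul_of_one_le_left ht0 hs1
  nlinarith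

end LSV

namespace LSV

open Finset

lemma sum_odd (n : ℕ) : ∑ j ∈ range n, (2 * (j : ℝ) + 1) = (n : ℝ) ^ 2 := by
  induction n with
  | zero => simp
  | succ n ih =>
    rw [sum_range_succ, ih]
    push_cast
    ring

lemma layer_le {L n : ℕ} {x : ℝ} (hx : x ≤ n) :
    (if (L : ℝ) ≤ x then x ^ 2 else 0) ≤
      ∑ j ∈ range (n + 1), (2 * (j : ℝ) + 1) * if ((max j L : ℕ) : ℝ) ≤ x then 1 else 0 := by
  have h0 : ∀ j : ℕ, 0 ≤ (2 * (j : ℝ) + 1) * if ((max j L : ℕ) : ℝ) ≤ x then (1 : ℝ) else 0 :=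
    fun j => mul_nonneg (by positivity) (by split_ifs <;> norm_num)
  split_ifs with h
  · have hx0 : 0 ≤ x := (Nat.cast_nonneg L).trans h
    have hf : ⌊x⌋₊ ≤ n := by
      rw [← Nat.floor_natCast (R := ℝ) n]
      exact Nat.floor_le_floor hx
    calc x ^ 2 ≤ ((⌊x⌋₊ + 1 : ℕ) : ℝ) ^ 2 := by
          have := (Nat.lt_floor_add_one x).le
          push_cast
          gcongr
      _ = ∑ j ∈ range (⌊x⌋₊ + 1), (2 * (j : ℝ) + 1) := (sum_odd _).symm
      _ ≤ ∑ j ∈ range (⌊x⌋₊ + 1), (2 * (j : ℝ) + 1) * if ((max j L : ℕ) : ℝ) ≤ x then 1 else 0 := by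
        refine sum_le_sum fun j hj => ?_
        have hj' : (j : ℝ) ≤ x :=
          (Nat.cast_le.2 (Nat.lt_succ_iff.1 (mem_range.1 hj))).trans (Nat.floor_le hx0)
        rw [if_pos (by push_cast; exact max_le hj' h), mul_one]
      _ ≤ _ := sum_le_sum_of_subset_of_nonneg (range_mono (by omega)) fun j _ _ => h0 j
  · exact sum_nonneg fun j _ => h0 j

lemma sum_div_max_le {L : ℕ} (hL : 0 < L) (n : ℕ) :
    ∑ j ∈ range n, (2 * (j : ℝ) + 1) / ((max j L : ℕ) : ℝ) ^ 3 ≤ 7 / (L : ℝ) := by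
  have hL' : (0 : ℝ) < L := Nat.cast_pos.2 hL
  have h : ∀ M : ℕ, ∑ j ∈ range (L + M), (2 * (j : ℝ) + 1) / ((max j L : ℕ) : ℝ) ^ 3 ≤
      7 / (L : ℝ) - 6 / ((L : ℝ) + M) := by
    intro M
    induction M with
    | zero =>
      rw [add_zero, Nat.cast_zero, add_zero]
      have h1 : ∑ j ∈ range L, (2 * (j : ℝ) + 1) / ((max j L : ℕ) : ℝ) ^ 3 =
          ∑ j ∈ range L, (2 * (j : ℝ) + 1) / (L : ℝ) ^ 3 :=
        sum_congr rfl fun j hj => by rw [max_eq_right (mem_range.1 hj).le]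
      rw [h1, ← sum_div, sum_odd]
      refine le_of_eq ?_
      field_simp
      norm_num
    | succ M ih =>
      rw [← add_assoc, sum_range_succ, max_eq_left (Nat.le_add_right L M)]
      have hL1 : (1 : ℝ) ≤ L := by exact_mod_cast hL
      obtain ⟨x, hx⟩ : ∃ x : ℝ, x = (L : ℝ) + M := ⟨_, rfl⟩
      have hx1 : 1 ≤ x := by
        rw [hx]
        linarith [M.cast_nonneg (α := ℝ)]
      rw [Nat.cast_add, Nat.cast_succ, ← add_assoc, ← hx]
      rw [← hx] at ih
      have h2 : (2 * x + 1) / x ^ 3 ≤ 6 / x - 6 / (x + 1) := by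
        rw [div_sub_div _ _ (by positivity) (by positivity), div_le_div_iff₀ (by positivity)
          (by positivity)]
        nlinarith [mul_nonneg (sub_nonneg.2 hx1) (sub_nonneg.2 hx1), pow_pos (zero_lt_one.trans_le hx1) 2,
          mul_nonneg (sub_nonneg.2 hx1) (sq_nonneg x)]
      linarith
  calc _ ≤ ∑ j ∈ range (L + n), (2 * (j : ℝ) + 1) / ((max j L : ℕ) : ℝ) ^ 3 :=
        sum_le_sum_of_subset_of_nonneg (range_mono (by omega)) fun j _ _ => by positivity
    _ ≤ 7 / (L : ℝ) - 6 / ((L : ℝ) + n) := h n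
    _ ≤ 7 / (L : ℝ) := sub_le_self _ (by positivity)

lemma exists_nat_sq_mul_exp_le {c η : ℝ} (hc : 0 < c) (hη : 0 < η) :
    ∃ N0 : ℕ, ∀ N : ℕ, N0 ≤ N → ((N : ℝ) + 1) ^ 2 * Real.exp (-c * N) ≤ η := by
  obtain ⟨N0, H⟩ := exists_nat_exp_le (8 / c ^ 2 * Real.exp (c / 2)) (half_pos hc) hη
  refine ⟨N0, fun N hN => le_trans ?_ (H N hN)⟩
  have h1 := Real.quadratic_le_exp_of_nonneg (show 0 ≤ c / 2 * ((N : ℝ) + 1) by positivity)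
  have h2 : ((N : ℝ) + 1) ^ 2 ≤ 8 / c ^ 2 * Real.exp (c / 2 * (N + 1)) := by
    rw [div_mul_eq_mul_div, le_div_iff₀ (by positivity)]
    have : 0 ≤ c / 2 * ((N : ℝ) + 1) := by positivity
    nlinarith
  calc _ ≤ 8 / c ^ 2 * Real.exp (c / 2 * (N + 1)) * Real.exp (-c * N) := by gcongr
    _ = 8 / c ^ 2 * (Real.exp (c / 2 * (N + 1)) * Real.exp (-c * N)) := by ring
    _ = 8 / c ^ 2 * (Real.exp (c / 2) * Real.exp (-(c / 2) * N)) := by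
      rw [← Real.exp_add, ← Real.exp_add]
      congr 2
      ring
    _ ≤ _ := by rw [mul_assoc]

/-- The unit vector `v` certifies that the matrix with columns `D` is nearly singular. -/
def NearNull {m : ℕ} (ε : ℝ) (D : Fin m → Fin m → Bool) (v : Fin m → ℝ) : Prop :=
  q v = 1 ∧ q (tr D v) ≤ (ε / √m) ^ 2

theorem pr_heavy_le {η δ : ℝ} (hη : 0 < η) (hδ : 0 < δ) : ∃ L : ℝ, 0 < L ∧ ∃ c : ℝ, 0 < c ∧
    ∃ N0 : ℕ, ∀ m : ℕ, N0 ≤ m → ∀ ε : ℝ, ε ≤ 1 → Real.exp (-c * m) ≤ ε →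
    pr (fun D : Fin m → Fin m → Bool => ∃ v, NearNull ε D v ∧
      η < ∑ i, if L / √m ≤ |v i| then v i ^ 2 else 0) ≤ δ * ε := by
  classical
  obtain ⟨C, hC, c, hc, N1, H1⟩ := pr_tail_square
  obtain ⟨L, hL⟩ := exists_nat_gt (8 * C / (η * δ))
  have hL0 : (0 : ℝ) < L := lt_trans (by positivity) hL
  have hLn : 0 < L := Nat.cast_pos.1 hL0
  have hL1 : (1 : ℝ) ≤ L := by exact_mod_cast hLn
  obtain ⟨N2, H2⟩ := exists_nat_sq_mul_exp_le (half_pos hc) (show 0 < 1 / (L : ℝ) by positivity)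
  refine ⟨L, hL0, c / 2, half_pos hc, max N1 (max N2 L), ?_⟩
  intro m hm ε hε1 hε
  simp only [max_le_iff] at hm
  obtain ⟨hm1, hm2, hmL⟩ := hm
  have hε0 : 0 < ε := (Real.exp_pos _).trans_le hε
  have hm0 : (0 : ℝ) < m := by exact_mod_cast hLn.trans_le hmL
  have hm11 : (1 : ℝ) ≤ m := by exact_mod_cast hLn.trans_le hmL
  have hsm : 0 < √(m : ℝ) := Real.sqrt_pos.2 hm0
  have hee : Real.exp (-c * m) = Real.exp (-(c / 2) * m) * Real.exp (-(c / 2) * m) := by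
    rw [← Real.exp_add]
    congr 1
    ring
  have hsq : ((m : ℝ) + 1) ^ 2 * Real.exp (-c * m) ≤ ε / L := by
    rw [hee, ← mul_assoc]
    calc _ ≤ 1 / (L : ℝ) * ε := mul_le_mul (H2 m hm2) hε (Real.exp_nonneg _) (by positivity)
      _ = _ := by ring
  have hcond : ∀ ℓ : ℝ, 0 < ℓ → ℓ ≤ m → Real.exp (-c * m) ≤ ε / ℓ := fun ℓ hℓ hℓm => by
    rw [le_div_iff₀ hℓ]
    have h1 : ε / L ≤ ε := div_le_self hε0.le hL1
    have h2 : ℓ ≤ ((m : ℝ) + 1) ^ 2 := by nlinarith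
    have h3 := Real.exp_pos (-c * m)
    nlinarith
  obtain ⟨T, hT⟩ : ∃ T : Fin m → ℕ → (Fin m → Fin m → Bool) → Prop,
      T = fun i (ℓ : ℕ) D =>
    ∃ v : Fin m → ℝ, q v = 1 ∧ q (tr D v) ≤ (ε / √m) ^ 2 ∧ (ℓ : ℝ) / √m ≤ |v i| := ⟨_, rfl⟩
  have hTp : ∀ i (j : ℕ), j ∈ range (m + 1) → pr (T i (max j L)) ≤
      C * (ε / ((max j L : ℕ) : ℝ) ^ 3 + Real.exp (-c * m)) := fun i j hj => by
    have hjm : max j L ≤ m := max_le (Nat.lt_succ_iff.1 (mem_range.1 hj)) hmL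
    have hpos : (0 : ℝ) < ((max j L : ℕ) : ℝ) := Nat.cast_pos.2 (lt_max_of_lt_right hLn)
    have h := H1 (Fin m) (Fin m) rfl (by simpa using hm1) i ε ((max j L : ℕ) : ℝ) hpos hε1
    rw [Fintype.card_fin] at h
    rw [hT]
    exact h (hcond _ hpos (by exact_mod_cast hjm))
  obtain ⟨Z, hZ⟩ : ∃ Z : (Fin m → Fin m → Bool) → ℝ, Z = fun D => ∑ i : Fin m, 1 / (m : ℝ) *
    ∑ j ∈ range (m + 1), (2 * (j : ℝ) + 1) * if T i (max j L) D then 1 else 0 := ⟨_, rfl⟩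
  have hZ0 : ∀ D, 0 ≤ Z D := fun D => by
    rw [hZ]
    refine sum_nonneg fun i _ => mul_nonneg (by positivity) (sum_nonneg fun j _ => ?_)
    exact mul_nonneg (by positivity) (by split_ifs <;> norm_num)
  have hZv : ∀ D v, NearNull ε D v → (∑ i, if L / √m ≤ |v i| then v i ^ 2 else 0) ≤ Z D := by
    intro D v hv
    rw [hZ]
    refine sum_le_sum fun i _ => ?_
    have hvi : √m * |v i| ≤ m := by
      have h1 : |v i| ≤ 1 := by
        rw [← sq_le_one_iff_abs_le_one, ← hv.1]
        exact sq_le_q v i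
      calc √m * |v i| ≤ √m * √m := by
            gcongr
            exact h1.trans (Real.one_le_sqrt.2 hm11)
        _ = m := Real.mul_self_sqrt hm0.le
    have h2 := layer_le (L := L) hvi
    have h3 : ∀ ℓ : ℝ, ℓ / √m ≤ |v i| ↔ ℓ ≤ √m * |v i| := fun ℓ => by
      rw [div_le_iff₀ hsm, mul_comm]
    calc (if L / √m ≤ |v i| then v i ^ 2 else 0) =
          1 / (m : ℝ) * if (L : ℝ) ≤ √m * |v i| then (√m * |v i|) ^ 2 else 0 := by
          simp only [h3]
          split_ifs
          · rw [mul_pow, Real.sq_sqrt hm0.le, sq_abs]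
            field_simp
          · simp
      _ ≤ _ := by
        refine mul_le_mul_of_nonneg_left (h2.trans ?_) (by positivity)
        refine sum_le_sum fun j _ => mul_le_mul_of_nonneg_left ?_ (by positivity)
        by_cases h4 : ((max j L : ℕ) : ℝ) ≤ √m * |v i|
        · have : T i (max j L) D := by
            rw [hT]
            exact ⟨v, hv.1, hv.2, (h3 _).2 h4⟩
          rw [if_pos h4, if_pos this]
        · rw [if_neg h4]
          split_ifs <;> norm_num
  have hEZ : ev Z ≤ 8 * C * ε / L := by
    have h1 : ev Z = ∑ i : Fin m, 1 / (m : ℝ) *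
        ∑ j ∈ range (m + 1), (2 * (j : ℝ) + 1) * pr (T i (max j L)) := by
      rw [hZ, ev_sum]
      refine sum_congr rfl fun i _ => ?_
      rw [ev_const_mul, ev_sum]
      congr 1
      refine sum_congr rfl fun j _ => ?_
      rw [ev_const_mul, ← pr_eq_ev]
    rw [h1]
    calc _ ≤ ∑ _i : Fin m, 1 / (m : ℝ) * (8 * C * ε / L) := by
          refine sum_le_sum fun i _ => mul_le_mul_of_nonneg_left ?_ (by positivity)
          calc _ ≤ ∑ j ∈ range (m + 1), (2 * (j : ℝ) + 1) *
                (C * (ε / ((max j L : ℕ) : ℝ) ^ 3 + Real.exp (-c * m))) :=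
                sum_le_sum fun j hj => mul_le_mul_of_nonneg_left (hTp i j hj) (by positivity)
            _ = C * ε * ∑ j ∈ range (m + 1), (2 * (j : ℝ) + 1) / ((max j L : ℕ) : ℝ) ^ 3 +
                C * (((m : ℝ) + 1) ^ 2 * Real.exp (-c * m)) := by
              have := sum_odd (m + 1)
              push_cast at this
              rw [← this, mul_sum, sum_mul, mul_sum, ← sum_add_distrib]
              exact sum_congr rfl fun j _ => by ring
            _ ≤ C * ε * (7 / L) + C * (ε / L) := by
              gcongr
              exact sum_div_max_le hLn _
            _ = _ := by ring
      _ = _ := by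
        rw [sum_const, card_univ, Fintype.card_fin, nsmul_eq_mul]
        field_simp
  calc _ ≤ ev fun D => 1 / η * Z D := by
        refine pr_le_ev (fun D => mul_nonneg (by positivity) (hZ0 D)) fun D ⟨v, hv, hη'⟩ => ?_
        rw [one_div, inv_mul_eq_div, one_le_div hη]
        exact hη'.le.trans (hZv D v hv)
    _ = 1 / η * ev Z := ev_const_mul _ _
    _ ≤ 1 / η * (8 * C * ε / L) := by gcongr
    _ = 8 * C / (η * L) * ε := by field_simp
    _ ≤ δ * ε := by
      gcongr
      rw [div_lt_iff₀ (by positivity)] at hL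
      rw [div_le_iff₀ (by positivity)]
      linarith

end LSV

namespace LSV

open Finset Filter Topology

section Sampling

variable {Ω : Type*} [Fintype Ω] [Nonempty Ω]

lemma ev_sq_sum {w : Ω → ℝ} (hw : ev w = 0) (s : ℕ) :
    ev (fun τ : Fin s → Ω => (∑ a, w (τ a)) ^ 2) = s * ev fun x => w x ^ 2 := by
  induction s with
  | zero => simp [ev_const]
  | succ s ih =>
    rw [ev_cons]
    have h : ∀ (x : Ω) (τ : Fin s → Ω), (∑ a, w ((Fin.cons x τ : Fin (s + 1) → Ω) a)) ^ 2 =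
        w x ^ 2 + w x * (2 * ∑ a, w (τ a)) + (∑ a, w (τ a)) ^ 2 := fun x τ => by
      simp only [Fin.sum_univ_succ, Fin.cons_zero, Fin.cons_succ]
      ring
    simp only [h, ev_add, ev_const_mul, ev_const, ev_mul_const, hw, ih]
    push_cast
    ring

lemma pr_not_injective_le (s : ℕ) :
    pr (fun τ : Fin s → Ω => ¬ Function.Injective τ) ≤ (s : ℝ) ^ 2 / Fintype.card Ω := by
  classical
  have h1 : ∀ a b : Fin s, a ≠ b → pr (fun τ : Fin s → Ω => τ a = τ b) ≤ 1 / Fintype.card Ω := by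
    intro a b hab
    have hinj : Function.Injective fun _ : Fin 1 => a := Function.injective_of_subsingleton _
    refine (pr_resample_le _ hinj _ (fun _ => 1 / (Fintype.card Ω : ℝ)) fun D => ?_).trans_eq
      (ev_const _)
    have h2 : ∀ d : Fin 1 → Ω, Function.extend (fun _ : Fin 1 => a) d D a = d 0 :=
      fun d => hinj.extend_apply d D 0
    have h3 : ∀ d : Fin 1 → Ω, Function.extend (fun _ : Fin 1 => a) d D b = D b :=
      fun d => Function.extend_apply' _ _ _ fun ⟨_, h⟩ => hab h
    simp only [h2, h3]
    rw [pr_eq_ev, ev_fin_one fun x => if x = D b then (1 : ℝ) else 0, ev]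
    simp
  calc _ ≤ pr (fun τ : Fin s → Ω => ∃ p ∈ (univ : Finset (Fin s × Fin s)), p.1 ≠ p.2 ∧ τ p.1 = τ p.2) := by
        refine pr_mono fun τ hτ => ?_
        simp only [Function.Injective, not_forall] at hτ
        obtain ⟨a, b, h, hab⟩ := hτ
        exact ⟨(a, b), mem_univ _, hab, h⟩
    _ ≤ ∑ _p : Fin s × Fin s, 1 / (Fintype.card Ω : ℝ) := by
        refine (pr_exists_le _ _).trans (sum_le_sum fun p _ => ?_)
        by_cases hp : p.1 = p.2
        · rw [pr_eq_zero fun τ h => h.1 hp]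
          positivity
        · exact (pr_mono fun τ h => h.2).trans (h1 _ _ hp)
    _ = _ := by
      rw [sum_const, card_univ, Fintype.card_prod, Fintype.card_fin, nsmul_eq_mul]
      push_cast
      ring

lemma pr_sample_lt_le {u : Ω → ℝ} {a B : ℝ} {s : ℕ} (ha : 0 < a) (hs : 0 < s) (hu0 : ∀ x, 0 ≤ u x)
    (hu : ∀ x, u x ≤ B / Fintype.card Ω) (hsum : 1 - a ≤ ∑ x, u x) (hsum1 : ∑ x, u x ≤ 1) :
    pr (fun τ : Fin s → Ω => ∑ i, u (τ i) < (1 - 2 * a) * s / Fintype.card Ω) ≤ B / (s * a ^ 2) := by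
  obtain ⟨m, hm⟩ : ∃ m : ℝ, m = Fintype.card Ω := ⟨_, rfl⟩
  have hm0 : 0 < m := by
    rw [hm]
    exact_mod_cast Fintype.card_pos
  have hs0 : (0 : ℝ) < s := Nat.cast_pos.2 hs
  rw [← hm] at hu ⊢
  obtain ⟨μ, hμ⟩ : ∃ μ, μ = ev u := ⟨_, rfl⟩
  have hμm : μ = (∑ x, u x) / m := by rw [hμ, ev, hm]
  have hB : 0 ≤ B := by
    obtain ⟨x⟩ := ‹Nonempty Ω›
    have := (hu0 x).trans (hu x)
    rwa [le_div_iff₀ hm0, zero_mul] at this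
  have hw : ev (fun x => u x - μ) = 0 := by rw [ev_sub, ev_const, hμ, sub_self]
  have hvar : ev (fun x => (u x - μ) ^ 2) ≤ B / m ^ 2 := by
    have h1 : ∀ x, (u x - μ) ^ 2 = u x ^ 2 - 2 * μ * (u x - μ) - μ ^ 2 := fun x => by ring
    simp only [h1, ev_sub, ev_const_mul, ev_const, ← hμ, sub_self, mul_zero, sub_zero]
    calc _ ≤ ev (fun x => u x ^ 2) := sub_le_self _ (sq_nonneg _)
      _ ≤ ev fun x => B / m * u x := ev_mono fun x => by
        rw [sq]
        exact mul_le_mul_of_nonneg_right (hu x) (hu0 x)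
      _ = B / m * μ := by rw [ev_const_mul, hμ]
      _ ≤ B / m * (1 / m) := by
        rw [hμm]
        gcongr
      _ = _ := by ring
  calc _ ≤ ev (fun τ : Fin s → Ω => (a * s / m)⁻¹ ^ 2 * (∑ i, (u (τ i) - μ)) ^ 2) := by
        refine pr_le_ev (fun τ => by positivity) fun τ hτ => ?_
        rw [← mul_pow, one_le_sq_iff_one_le_abs]
        refine le_abs.2 (Or.inr ?_)
        rw [sum_sub_distrib, sum_const, card_univ, Fintype.card_fin, nsmul_eq_mul, ← mul_neg,
          le_inv_mul_iff₀ (by positivity), mul_one]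
        have h1 : (1 - a) * s / m ≤ s * μ := by
          rw [hμm, mul_div_assoc', mul_comm (s : ℝ)]
          gcongr
        have h2 : (1 - a) * s / m = (1 - 2 * a) * s / m + a * s / m := by ring
        linarith
    _ = (a * s / m)⁻¹ ^ 2 * (s * ev fun x => (u x - μ) ^ 2) := by rw [ev_const_mul, ev_sq_sum hw]
    _ ≤ (a * s / m)⁻¹ ^ 2 * (s * (B / m ^ 2)) := by gcongr
    _ = _ := by field_simp

end Sampling

lemma exists_sampling_loss {δ : ℝ} (hδ : 0 < δ) :
    ∃ a : ℝ, 0 < a ∧ a < 1 / 2 ∧ a + (1 + a) / (1 - 2 * a) ^ 2 ≤ 1 + δ := by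
  have h : Tendsto (fun a : ℝ => a + (1 + a) / (1 - 2 * a) ^ 2) (𝓝[>] 0) (𝓝 1) := by
    have h0 : ContinuousAt (fun a : ℝ => a + (1 + a) / (1 - 2 * a) ^ 2) 0 := by
      refine ContinuousAt.add continuousAt_id (ContinuousAt.div ?_ ?_ (by norm_num))
      · fun_prop
      · fun_prop
    have h1 := h0.tendsto.mono_left (nhdsWithin_le_nhds (s := Set.Ioi 0))
    simpa using h1
  have h2 := h.eventually (ge_mem_nhds (show (1 : ℝ) < 1 + δ by linarith))
  obtain ⟨a, ha, ha'⟩ := (h2.and (Ioo_mem_nhdsGT (show (0 : ℝ) < 1 / 2 by norm_num))).exists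
  exact ⟨a, ha'.1, ha'.2, ha⟩

lemma pr_sample_good_ge {m s : ℕ} [NeZero m] {ε L a : ℝ} (hs : 0 < s) (hL : 0 < L) (ha : 0 < a)
    (ha2 : a < 1 / 2) {D : Fin m → Fin m → Bool} {v : Fin m → ℝ} (hv : NearNull ε D v)
    (hlight : (∑ i, if L / √m ≤ |v i| then v i ^ 2 else 0) ≤ a) :
    1 - ((s : ℝ) ^ 2 / m + L ^ 2 / (s * a ^ 2)) ≤ pr fun τ : Fin s → Fin m =>
      Function.Injective τ ∧ SubSmall τ (ε / √((1 - 2 * a) * s)) D := by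
  classical
  have hm0 : (0 : ℝ) < m := Nat.cast_pos.2 (NeZero.pos m)
  have hs0 : (0 : ℝ) < s := Nat.cast_pos.2 hs
  have hpos : 0 < (1 - 2 * a) * s := mul_pos (by linarith) hs0
  obtain ⟨u, hu⟩ : ∃ u : Fin m → ℝ, u = fun i => if L / √m ≤ |v i| then 0 else v i ^ 2 := ⟨_, rfl⟩
  have hu0 : ∀ i, 0 ≤ u i := fun i => by
    rw [hu]
    dsimp only
    split_ifs <;> positivity
  have huv : ∀ i, u i ≤ v i ^ 2 := fun i => by
    rw [hu]
    dsimp only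
    split_ifs
    · positivity
    · exact le_rfl
  have huL : ∀ i, u i ≤ L ^ 2 / Fintype.card (Fin m) := fun i => by
    rw [hu, Fintype.card_fin]
    dsimp only
    split_ifs with h
    · positivity
    · rw [← sq_abs, ← Real.sq_sqrt hm0.le, ← div_pow]
      exact pow_le_pow_left₀ (abs_nonneg _) (not_le.1 h).le 2
  have hsum : ∑ i, u i + (∑ i, if L / √m ≤ |v i| then v i ^ 2 else 0) = 1 := by
    rw [← hv.1, q, ← sum_add_distrib]
    refine sum_congr rfl fun i _ => ?_
    rw [hu]
    dsimp only
    split_ifs <;> simp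
  have hsum1 : ∑ i, u i ≤ 1 := by
    rw [← hv.1]
    exact sum_le_sum fun i _ => huv i
  have h1 := pr_sample_lt_le ha hs hu0 huL (by linarith) hsum1
  have h2 := pr_not_injective_le (Ω := Fin m) s
  rw [Fintype.card_fin] at h1 h2
  have h3 : 1 ≤ pr (fun τ : Fin s → Fin m => (Function.Injective τ ∧
      SubSmall τ (ε / √((1 - 2 * a) * s)) D) ∨ (¬ Function.Injective τ ∨
      ∑ i, u (τ i) < (1 - 2 * a) * s / m)) := by
    refine (ev_const (Ω := Fin s → Fin m) (1 : ℝ)).symm.trans_le ?_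
    rw [pr_eq_ev]
    refine ev_mono fun τ => ?_
    rw [if_pos]
    by_cases hinj : Function.Injective τ
    · by_cases hlt : ∑ i, u (τ i) < (1 - 2 * a) * s / m
      · exact Or.inr (Or.inr hlt)
      · refine Or.inl ⟨hinj, v, ?_⟩
        have h4 : (1 - 2 * a) * s / m ≤ ∑ i, v (τ i) ^ 2 :=
          (not_lt.1 hlt).trans (sum_le_sum fun i _ => huv _)
        refine ⟨lt_of_lt_of_le (by positivity) h4, hv.2.trans ?_⟩
        rw [div_pow, div_pow, Real.sq_sqrt hm0.le, Real.sq_sqrt hpos.le]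
        calc ε ^ 2 / m = ε ^ 2 / ((1 - 2 * a) * s) * ((1 - 2 * a) * s / m) := by
              rw [div_mul_div_comm, mul_comm (ε ^ 2), mul_div_mul_left _ _ hpos.ne']
          _ ≤ _ := by gcongr
    · exact Or.inr (Or.inl hinj)
  have h4 := h3.trans ((pr_or_le _ _).trans (add_le_add_right (pr_or_le _ _) _))
  linarith

theorem pr_nearNull_le {δ : ℝ} (hδ : 0 < δ) : ∃ c : ℝ, 0 < c ∧ ∃ N0 : ℕ, ∀ m : ℕ, N0 ≤ m →
    ∀ ε : ℝ, ε ≤ 1 → Real.exp (-c * m) ≤ ε →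
    pr (fun D : Fin m → Fin m → Bool => ∃ v, NearNull ε D v) ≤ (1 + δ) * ε := by
  classical
  obtain ⟨a, ha, ha2, haδ⟩ := exists_sampling_loss hδ
  obtain ⟨L, hL, c1, hc1, N1, H1⟩ := pr_heavy_le ha ha
  obtain ⟨k, hk⟩ := exists_nat_gt (2 * L ^ 2 / a ^ 3)
  obtain ⟨c2, hc2, N2, H2⟩ := pr_subSmall_le k ha
  obtain ⟨N3, hN3⟩ := exists_nat_gt (2 * ((k + 1 : ℕ) : ℝ) ^ 2 / a)
  obtain ⟨N4, H4⟩ := exists_nat_exp_le (√(k + 1)) (half_pos hc2) zero_lt_one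
  refine ⟨min c1 (c2 / 2), by positivity, max (max N1 N2) (max N3 N4), ?_⟩
  intro m hm ε hε1 hε
  simp only [max_le_iff] at hm
  obtain ⟨⟨hm1, hm2⟩, hm3, hm4⟩ := hm
  have hε0 : 0 < ε := (Real.exp_pos _).trans_le hε
  have hexp : ∀ b, min c1 (c2 / 2) ≤ b → Real.exp (-b * m) ≤ ε := fun b hb => by
    refine le_trans (Real.exp_le_exp.2 ?_) hε
    gcongr
  have hm3' : 2 * ((k + 1 : ℕ) : ℝ) ^ 2 / a < m := hN3.trans_le (Nat.cast_le.2 hm3)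
  have hm0 : (0 : ℝ) < m := lt_of_le_of_lt (by positivity) hm3'
  have : NeZero m := ⟨by rintro rfl; simp at hm0⟩
  obtain ⟨t, ht⟩ : ∃ t, t = ε / √((1 - 2 * a) * ((k + 1 : ℕ) : ℝ)) := ⟨_, rfl⟩
  have hb : 0 < 1 - 2 * a := by linarith
  have hb1 : 1 - 2 * a ≤ 1 := by linarith
  have hk1 : (0 : ℝ) < (k + 1 : ℕ) := by positivity
  have hkk : ((k + 1 : ℕ) : ℝ) = (k : ℝ) + 1 := by push_cast; rfl
  have htε : √((k : ℝ) + 1) * t ≤ ε / (1 - 2 * a) := by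
    rw [ht, hkk, Real.sqrt_mul hb.le]
    have h1 : 1 - 2 * a ≤ √(1 - 2 * a) := Real.le_sqrt_of_sq_le (by nlinarith)
    calc _ = ε / √(1 - 2 * a) := by
          have : √((k : ℝ) + 1) ≠ 0 := by positivity
          field_simp
      _ ≤ _ := by gcongr
  have htexp : Real.exp (-c2 * m) ≤ t := by
    have h1 : √((1 - 2 * a) * ((k + 1 : ℕ) : ℝ)) ≤ √((k : ℝ) + 1) := by
      rw [hkk]
      exact Real.sqrt_le_sqrt (mul_le_of_le_one_left (by positivity) hb1)
    have h2 : Real.exp (-c2 * m) = Real.exp (-(c2 / 2) * m) * Real.exp (-(c2 / 2) * m) := by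
      rw [← Real.exp_add]
      congr 1
      ring
    rw [ht, le_div_iff₀ (Real.sqrt_pos.2 (by positivity)), h2]
    calc _ ≤ Real.exp (-(c2 / 2) * m) * Real.exp (-(c2 / 2) * m) * √((k : ℝ) + 1) := by gcongr
      _ = Real.exp (-(c2 / 2) * m) * (√((k : ℝ) + 1) * Real.exp (-(c2 / 2) * m)) := by ring
      _ ≤ ε * 1 := mul_le_mul (hexp _ (min_le_right _ _)) (H4 m hm4) (by positivity) hε0.le
      _ = ε := mul_one ε
  have hθ : ((k + 1 : ℕ) : ℝ) ^ 2 / m + L ^ 2 / (((k + 1 : ℕ) : ℝ) * a ^ 2) ≤ a := by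
    have h1 : ((k + 1 : ℕ) : ℝ) ^ 2 / m ≤ a / 2 := by
      rw [div_lt_iff₀ ha] at hm3'
      rw [div_le_iff₀ hm0]
      linarith
    have h2 : L ^ 2 / (((k + 1 : ℕ) : ℝ) * a ^ 2) ≤ a / 2 := by
      rw [div_lt_iff₀ (by positivity)] at hk
      rw [div_le_iff₀ (by positivity), hkk]
      have : 0 < a ^ 3 := by positivity
      nlinarith
    linarith
  obtain ⟨P, hP⟩ : ∃ P : (Fin m → Fin m → Bool) → Prop, P = fun D => ∃ v, NearNull ε D v ∧
    (∑ i, if L / √m ≤ |v i| then v i ^ 2 else 0) ≤ a := ⟨_, rfl⟩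
  have hlight : pr P * (1 - a) ≤ (1 + a) * √(k + 1) * t := by
    calc pr P * (1 - a) = ev fun D => (if P D then 1 else 0) * (1 - a) := by rw [pr_eq_ev, ev_mul_const]
      _ ≤ ev fun D => pr fun τ : Fin (k + 1) → Fin m => Function.Injective τ ∧ SubSmall τ t D := by
        refine ev_mono fun D => ?_
        by_cases hD : P D
        · rw [if_pos hD, one_mul]
          rw [hP] at hD
          obtain ⟨v, hv, hl⟩ := hD
          have := pr_sample_good_ge (s := k + 1) (Nat.succ_pos k) hL ha ha2 hv hl
          rw [← ht] at this
          linarith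
        · rw [if_neg hD, zero_mul]
          exact pr_nonneg _
      _ = ev fun τ : Fin (k + 1) → Fin m => pr fun D => Function.Injective τ ∧ SubSmall τ t D := by
        simp only [pr_eq_ev]
        exact ev_comm _
      _ ≤ _ := by
        have ht0 : 0 ≤ t := (Real.exp_nonneg _).trans htexp
        refine (ev_mono fun τ => ?_).trans_eq (ev_const _)
        by_cases hτ : Function.Injective τ
        · exact (pr_mono fun D h => h.2).trans (H2 m hm2 τ hτ t htexp)
        · rw [pr_eq_zero fun D h => hτ h.1]
          positivity
  have hlight' : pr P ≤ (1 + a) / (1 - 2 * a) ^ 2 * ε := by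
    have h1 : pr P * (1 - 2 * a) ≤ pr P * (1 - a) := by
      have := pr_nonneg P
      gcongr
      linarith
    have h2 : (1 + a) * √(k + 1) * t ≤ (1 + a) * (ε / (1 - 2 * a)) := by
      rw [mul_assoc]
      gcongr
    have h3 := (h1.trans hlight).trans h2
    rw [← le_div_iff₀ hb] at h3
    refine h3.trans_eq ?_
    field_simp
  calc _ ≤ pr (fun D : Fin m → Fin m → Bool => (∃ v, NearNull ε D v ∧
        a < ∑ i, if L / √m ≤ |v i| then v i ^ 2 else 0) ∨ P D) := by
        refine pr_mono fun D ⟨v, hv⟩ => ?_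
        rw [hP]
        rcases lt_or_ge a (∑ i, if L / √m ≤ |v i| then v i ^ 2 else 0) with h | h
        · exact Or.inl ⟨v, hv, h⟩
        · exact Or.inr ⟨v, hv, h⟩
    _ ≤ a * ε + (1 + a) / (1 - 2 * a) ^ 2 * ε :=
      (pr_or_le _ _).trans (add_le_add (H1 m hm1 ε hε1 (hexp _ (min_le_left _ _))) hlight')
    _ = (a + (1 + a) / (1 - 2 * a) ^ 2) * ε := by ring
    _ ≤ _ := by gcongr

end LSV

namespace LSV

open Finset

/-- The least singular value of a matrix is attained at a unit vector. -/
lemma exists_unit_euclNorm_mulVec {n : ℕ} (hn : 0 < n) (M : Matrix (Fin n) (Fin n) ℝ) :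
    ∃ x : Fin n → ℝ, euclNorm x = 1 ∧ euclNorm (M.mulVec x) = sigmaMin M := by
  obtain ⟨S, hS⟩ : ∃ S : Set (Fin n → ℝ), S = {x | euclNorm x = 1} := ⟨_, rfl⟩
  have hcont : Continuous fun x : Fin n → ℝ => euclNorm x := by
    unfold euclNorm
    fun_prop
  have hclosed : IsClosed S := by
    rw [hS]
    exact isClosed_eq hcont continuous_const
  have hbdd : S ⊆ Metric.closedBall 0 1 := fun x hx => by
    rw [hS] at hx
    have hx1 : euclNorm x = 1 := hx
    rw [mem_closedBall_zero_iff, pi_norm_le_iff_of_nonneg zero_le_one]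
    intro i
    rw [Real.norm_eq_abs, ← hx1, euclNorm]
    refine Real.abs_le_sqrt ?_
    exact single_le_sum (f := fun i => x i ^ 2) (fun j _ => sq_nonneg _) (mem_univ i)
  have hcomp : IsCompact S := (isCompact_closedBall _ _).of_isClosed_subset hclosed hbdd
  have hne : S.Nonempty := by
    refine ⟨Pi.single ⟨0, hn⟩ 1, ?_⟩
    rw [hS]
    change euclNorm _ = 1
    rw [euclNorm, sum_eq_single ⟨0, hn⟩]
    · simp
    · intro b _ hb
      simp [Pi.single_eq_of_ne hb]
    · simp
  have hcM : Continuous fun x : Fin n → ℝ => euclNorm (M.mulVec x) :=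
    hcont.comp (by fun_prop)
  obtain ⟨x, hx, hmin⟩ := hcomp.exists_isMinOn hne hcM.continuousOn
  rw [hS] at hx
  have hx1 : euclNorm x = 1 := hx
  refine ⟨x, hx1, ?_⟩
  have hleast : IsLeast {r : ℝ | ∃ x : Fin n → ℝ, euclNorm x = 1 ∧ r = euclNorm (M.mulVec x)}
      (euclNorm (M.mulVec x)) := by
    refine ⟨⟨x, hx1, rfl⟩, ?_⟩
    rintro r ⟨y, hy, rfl⟩
    exact hmin (show y ∈ S by rw [hS]; exact hy)
  exact hleast.csInf_eq.symm

/-- The sign matrix with prescribed Boolean columns. -/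
def signMatrix {n : ℕ} (D : Fin n → Fin n → Bool) : Matrix (Fin n) (Fin n) ℝ :=
  Matrix.of fun i j => sg (D j i)

lemma signMatrix_injective {n : ℕ} : Function.Injective (signMatrix (n := n)) := by
  intro D E h
  funext j i
  have h1 : sg (D j i) = sg (E j i) := congrFun (congrFun h i) j
  revert h1
  cases D j i <;> cases E j i <;> norm_num [sg]

lemma range_signMatrix {n : ℕ} :
    Set.range (signMatrix (n := n)) = {B | ∀ i j, B i j = 1 ∨ B i j = -1} := by
  ext B
  constructor
  · rintro ⟨D, rfl⟩ i j
    simp only [signMatrix, Matrix.of_apply]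
    cases D j i <;> simp [sg]
  · intro hB
    classical
    refine ⟨fun j i => decide (B i j = 1), ?_⟩
    ext i j
    simp only [signMatrix, Matrix.of_apply, sg]
    rcases hB i j with h | h <;> norm_num [h]

lemma exists_nearNull_of_sigmaMin_le {n : ℕ} (hn : 0 < n) {ε : ℝ} {D : Fin n → Fin n → Bool}
    (h : sigmaMin (signMatrix D) ≤ ε / √n) : ∃ v, NearNull ε D v := by
  obtain ⟨x, hx, hmin⟩ := exists_unit_euclNorm_mulVec hn (signMatrix D)
  have hq : ∀ y : Fin n → ℝ, euclNorm y ^ 2 = q y := fun y =>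
    Real.sq_sqrt (sum_nonneg fun i _ => sq_nonneg _)
  refine ⟨x, ?_, ?_⟩
  · rw [← hq, hx, one_pow]
  · have htr : tr D x = (signMatrix D).mulVec x := by
      funext i
      simp only [tr, Matrix.mulVec, dotProduct, signMatrix, Matrix.of_apply]
      exact sum_congr rfl fun k _ => mul_comm _ _
    rw [htr, ← hq, hmin]
    refine pow_le_pow_left₀ ?_ h 2
    rw [← hmin]
    exact Real.sqrt_nonneg _

lemma ncard_sigmaMin_le {n : ℕ} (hn : 0 < n) (ε : ℝ) :
    ({B : Matrix (Fin n) (Fin n) ℝ |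
        (∀ i j, B i j = 1 ∨ B i j = -1) ∧ sigmaMin B ≤ ε / √n}.ncard : ℝ) ≤
      pr (fun D : Fin n → Fin n → Bool => ∃ v, NearNull ε D v) *
        {B : Matrix (Fin n) (Fin n) ℝ | ∀ i j, B i j = 1 ∨ B i j = -1}.ncard := by
  have hcard : {B : Matrix (Fin n) (Fin n) ℝ | ∀ i j, B i j = 1 ∨ B i j = -1}.ncard =
      Fintype.card (Fin n → Fin n → Bool) := by
    rw [← range_signMatrix, ← Set.image_univ, Set.ncard_image_of_injective _ signMatrix_injective,
      Set.ncard_univ, Nat.card_eq_fintype_card]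
  have hpos : (Fintype.card (Fin n → Fin n → Bool) : ℝ) ≠ 0 :=
    Nat.cast_ne_zero.2 Fintype.card_ne_zero
  rw [hcard, pr_eq_ncard, div_mul_cancel₀ _ hpos, Nat.cast_le,
    ← Set.ncard_image_of_injective _ signMatrix_injective]
  refine Set.ncard_le_ncard ?_ (Set.toFinite _)
  rintro B ⟨hB, hσ⟩
  have hB' : B ∈ Set.range (signMatrix (n := n)) := by
    rw [range_signMatrix]
    exact hB
  obtain ⟨D, rfl⟩ := hB'
  exact ⟨D, exists_nearNull_of_sigmaMin_le hn hσ, rfl⟩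

lemma NearNull.mono {m : ℕ} {ε ε' : ℝ} {D : Fin m → Fin m → Bool} {v : Fin m → ℝ}
    (h : NearNull ε D v) (hε : 0 ≤ ε) (hle : ε ≤ ε') : NearNull ε' D v := by
  refine ⟨h.1, h.2.trans ?_⟩
  gcongr

theorem pr_nearNull_le_add {δ : ℝ} (hδ : 0 < δ) : ∃ c : ℝ, 0 < c ∧ ∃ N0 : ℕ, ∀ n : ℕ, N0 ≤ n →
    ∀ ε : ℝ, 0 < ε → pr (fun D : Fin n → Fin n → Bool => ∃ v, NearNull ε D v) ≤
      (1 + δ) * ε + 2 * Real.exp (-c * n) := by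
  obtain ⟨c, hc, N0, H⟩ := pr_nearNull_le (lt_min hδ one_pos)
  refine ⟨c, hc, N0, fun n hn ε hε => ?_⟩
  have hexp := Real.exp_pos (-c * n)
  have h1 : min δ 1 ≤ δ := min_le_left _ _
  have h2 : min δ 1 ≤ 1 := min_le_right _ _
  have h3 : 0 < δ * ε := mul_pos hδ hε
  rcases le_or_gt 1 ε with hε1 | hε1
  · refine (pr_le_one _).trans ?_
    linarith
  · rcases le_or_gt (Real.exp (-c * n)) ε with hle | hlt
    · refine (H n hn ε hε1.le hle).trans ?_
      nlinarith
    · have hexp1 : Real.exp (-c * n) ≤ 1 := by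
        rw [Real.exp_le_one_iff]
        nlinarith [(Nat.cast_nonneg n : (0 : ℝ) ≤ n)]
      have h4 := H n hn _ hexp1 le_rfl
      refine (pr_mono fun D h => ?_).trans (h4.trans ?_)
      · obtain ⟨v, hv⟩ := h
        exact ⟨v, hv.mono hε.le hlt.le⟩
      · nlinarith

end LSV

/-- **The Spielman–Teng conjecture up to a `1 + o(1)` factor (Sah–Sahasrabudhe–Sawhney).**
For every `δ > 0` there are `c > 0` and `n₀` such that for all `n ≥ n₀` and all `ε > 0`,
an `n × n` random matrix `B_n` with independent uniform `{-1,1}` entries satisfies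
`ℙ(σ_min(B_n) ≤ ε n^{-1/2}) ≤ (1 + δ) ε + 2 e^{-cn}`, formulated by counting. -/
theorem iid_least_singular_value (δ : ℝ) (hδ : 0 < δ) :
    ∃ c : ℝ, 0 < c ∧ ∃ n₀ : ℕ, ∀ n : ℕ, n₀ ≤ n → ∀ ε : ℝ, 0 < ε →
      ({B : Matrix (Fin n) (Fin n) ℝ |
          (∀ i j, B i j = 1 ∨ B i j = -1) ∧ sigmaMin B ≤ ε / Real.sqrt n}.ncard : ℝ) ≤
        ((1 + δ) * ε + 2 * Real.exp (-c * n)) *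
          {B : Matrix (Fin n) (Fin n) ℝ | ∀ i j, B i j = 1 ∨ B i j = -1}.ncard := by
  obtain ⟨c, hc, N0, H⟩ := LSV.pr_nearNull_le_add hδ
  refine ⟨c, hc, max N0 1, fun n hn ε hε => ?_⟩
  refine (LSV.ncard_sigmaMin_le (lt_of_lt_of_le one_pos ((le_max_right _ _).trans hn)) ε).trans ?_
  exact mul_le_mul_of_nonneg_right (H n ((le_max_left _ _).trans hn) ε hε) (Nat.cast_nonneg _)
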